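/- Roy's theorem on extremal numbers: Let γ = (1+√5)/2. There exists a real number ξ which is neither rational nor a quadratic irrational and a constant c > 0 such that for all sufficiently large integers N the inequalities 0 < |x₀ + x₁ξ + x₂ξ²| ≤ c·N^{−γ−1} and max{|x₀|, |x₁|, |x₂|} ≤ N have a solution (x₀, x₁, x₂) ∈ ℤ³. Moreover, any real number ξ with this property is transcendental over ℚ, and the set of such real numbers is countable. -/

import Mathlib

/-- `ξ` is neither rational nor a quadratic irrational, i.e. not algebraic of
degree `≤ 2` over `ℚ`. -/
def NotQuadraticOrRational (ξ : ℝ) : Prop :=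
  ¬ ∃ Q : Polynomial ℚ, Q ≠ 0 ∧ Q.natDegree ≤ 2 ∧ Polynomial.aeval ξ Q = 0

/-- Roy's extremality property: for some `c > 0` and all sufficiently large `N`,
the inequalities `0 < |x₀ + x₁ξ + x₂ξ²| ≤ c N^{-γ-1}`, `max(|x₀|,|x₁|,|x₂|) ≤ N`
have an integer solution, where `γ = (1+√5)/2`. -/
def RoyExtremalProperty (ξ : ℝ) : Prop :=
  ∃ c : ℝ, 0 < c ∧ ∃ N₁ : ℕ, ∀ N : ℕ, N₁ ≤ N → ∃ x₀ x₁ x₂ : ℤ,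
    0 < |(x₀ : ℝ) + (x₁ : ℝ) * ξ + (x₂ : ℝ) * ξ ^ 2| ∧
    |(x₀ : ℝ) + (x₁ : ℝ) * ξ + (x₂ : ℝ) * ξ ^ 2| ≤
      c * (N : ℝ) ^ (-((1 + Real.sqrt 5) / 2) - 1) ∧
    max |x₀| (max |x₁| |x₂|) ≤ (N : ℤ)

namespace RoyExt

open MvPolynomial Finset

section Basic

variable {σ : Type*} {R : Type*}

/-- The sum of the norms of the coefficients. -/
noncomputable def lOne [NormedCommRing R] (p : MvPolynomial σ R) : ℝ :=
  ∑ i ∈ p.support, ‖p.coeff i‖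

section LOne

variable [NormedCommRing R]

lemma lOne_nonneg (p : MvPolynomial σ R) : 0 ≤ lOne p :=
  Finset.sum_nonneg fun _ _ => norm_nonneg _

lemma lOne_eq_sum {p : MvPolynomial σ R} {S : Finset (σ →₀ ℕ)} (h : p.support ⊆ S) :
    lOne p = ∑ i ∈ S, ‖p.coeff i‖ := by
  refine Finset.sum_subset h fun i _ hi => ?_
  rw [notMem_support_iff.1 hi, norm_zero]

lemma norm_coeff_le_lOne (p : MvPolynomial σ R) (i : σ →₀ ℕ) : ‖p.coeff i‖ ≤ lOne p := by
  by_cases hi : i ∈ p.support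
  · exact Finset.single_le_sum (f := fun i => ‖p.coeff i‖) (fun _ _ => norm_nonneg _) hi
  · rw [notMem_support_iff.1 hi, norm_zero]
    exact lOne_nonneg p

@[simp] lemma lOne_zero : lOne (0 : MvPolynomial σ R) = 0 := by simp [lOne]

lemma lOne_monomial (i : σ →₀ ℕ) (a : R) : lOne (monomial i a) = ‖a‖ := by
  classical
  rw [lOne_eq_sum (S := {i}) support_monomial_subset]
  simp

lemma lOne_C (a : R) : lOne (C a : MvPolynomial σ R) = ‖a‖ := lOne_monomial 0 a

lemma lOne_one [NormOneClass R] : lOne (1 : MvPolynomial σ R) = 1 := by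
  rw [← C_1, lOne_C, norm_one]

lemma lOne_X [NormOneClass R] (s : σ) : lOne (X s : MvPolynomial σ R) = 1 := by
  rw [X, lOne_monomial, norm_one]

lemma lOne_add_le (p q : MvPolynomial σ R) : lOne (p + q) ≤ lOne p + lOne q := by
  classical
  rw [lOne_eq_sum (S := p.support ∪ q.support) support_add,
    lOne_eq_sum (p := p) (S := p.support ∪ q.support) Finset.subset_union_left,
    lOne_eq_sum (p := q) (S := p.support ∪ q.support) Finset.subset_union_right,
    ← Finset.sum_add_distrib]
  exact Finset.sum_le_sum fun i _ => by rw [coeff_add]; exact norm_add_le _ _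

lemma lOne_neg (p : MvPolynomial σ R) : lOne (-p) = lOne p := by
  simp [lOne, support_neg]

lemma lOne_sum_le {ι : Type*} (s : Finset ι) (f : ι → MvPolynomial σ R) :
    lOne (∑ i ∈ s, f i) ≤ ∑ i ∈ s, lOne (f i) := by
  classical
  induction s using Finset.induction_on with
  | empty => simp
  | insert a s ha ih =>
    rw [Finset.sum_insert ha, Finset.sum_insert ha]
    exact (lOne_add_le _ _).trans (by gcongr)

lemma lOne_mul_le (p q : MvPolynomial σ R) : lOne (p * q) ≤ lOne p * lOne q := by
  classical
  have h : p * q = ∑ i ∈ p.support, ∑ j ∈ q.support,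
      monomial (i + j) (p.coeff i * q.coeff j) := by
    conv_lhs => rw [p.as_sum, q.as_sum, Finset.sum_mul_sum]
    simp only [monomial_mul]
  rw [h]
  refine (lOne_sum_le _ _).trans ?_
  refine (Finset.sum_le_sum fun i _ => lOne_sum_le _ _).trans ?_
  rw [lOne, lOne, Finset.sum_mul_sum]
  refine Finset.sum_le_sum fun i _ => Finset.sum_le_sum fun j _ => ?_
  rw [lOne_monomial]
  exact norm_mul_le _ _

lemma lOne_prod_le [NormOneClass R] {ι : Type*} (s : Finset ι) (f : ι → MvPolynomial σ R) :
    lOne (∏ i ∈ s, f i) ≤ ∏ i ∈ s, lOne (f i) := by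
  classical
  induction s using Finset.induction_on with
  | empty => simp [lOne_one]
  | insert a s ha ih =>
    rw [Finset.prod_insert ha, Finset.prod_insert ha]
    exact (lOne_mul_le _ _).trans (mul_le_mul_of_nonneg_left ih (lOne_nonneg _))

lemma lOne_pow_le [NormOneClass R] (p : MvPolynomial σ R) (n : ℕ) :
    lOne (p ^ n) ≤ lOne p ^ n := by
  simpa using lOne_prod_le (Finset.range n) fun _ => p

lemma lOne_det_le [NormOneClass R] {h : ℕ} (M : Matrix (Fin h) (Fin h) (MvPolynomial σ R))
    {B : ℝ} (hM : ∀ i j, lOne (M i j) ≤ B) : lOne M.det ≤ h.factorial * B ^ h := by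
  rw [Matrix.det_apply]
  refine (lOne_sum_le _ _).trans ?_
  have : ∀ τ ∈ (Finset.univ : Finset (Equiv.Perm (Fin h))),
      lOne (Equiv.Perm.sign τ • ∏ i, M (τ i) i) ≤ B ^ h := by
    intro τ _
    have h1 : lOne (Equiv.Perm.sign τ • ∏ i, M (τ i) i) = lOne (∏ i, M (τ i) i) := by
      rcases Int.units_eq_one_or (Equiv.Perm.sign τ) with hs | hs <;> simp [hs, lOne_neg]
    rw [h1]
    refine (lOne_prod_le _ _).trans ?_
    refine (Finset.prod_le_prod (fun _ _ => lOne_nonneg _) fun i _ => hM (τ i) i).trans ?_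
    simp
  refine (Finset.sum_le_sum this).trans ?_
  simp [Fintype.card_perm]

end LOne

section Hasse

variable [Fintype σ] [CommRing R]

/-- The product of binomial coefficients of two multi-indices. -/
def mchoose (i μ : σ →₀ ℕ) : ℕ := ∏ s, (i s).choose (μ s)

lemma mchoose_eq_zero {i μ : σ →₀ ℕ} (h : ¬ μ ≤ i) : mchoose i μ = 0 := by
  rw [Finsupp.le_def, not_forall] at h
  obtain ⟨s, hs⟩ := h
  exact Finset.prod_eq_zero (Finset.mem_univ s) (Nat.choose_eq_zero_of_lt (not_le.1 hs))

/-- The multivariate Hasse derivative. -/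
noncomputable def hasse (μ : σ →₀ ℕ) : MvPolynomial σ R →ₗ[R] MvPolynomial σ R :=
  (MvPolynomial.basisMonomials σ R).constr R
    fun i => monomial (i - μ) ((mchoose i μ : ℕ) : R)

lemma hasse_monomial (μ i : σ →₀ ℕ) (a : R) :
    hasse μ (monomial i a) = monomial (i - μ) (a * mchoose i μ) := by
  have : (monomial i a : MvPolynomial σ R) = a • MvPolynomial.basisMonomials σ R i := by
    simp [smul_monomial]
  rw [this, map_smul, hasse, Module.Basis.constr_basis, smul_monomial, smul_eq_mul]

lemma coeff_hasse (μ k : σ →₀ ℕ) (p : MvPolynomial σ R) :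
    coeff k (hasse μ p) = mchoose (k + μ) μ * coeff (k + μ) p := by
  classical
  induction p using MvPolynomial.induction_on' with
  | add p q hp hq => rw [map_add, coeff_add, hp, hq, coeff_add, mul_add]
  | monomial i a =>
    rw [hasse_monomial, coeff_monomial, coeff_monomial]
    by_cases h : i = k + μ
    · subst h
      simp [mul_comm]
    · rw [if_neg h, mul_zero]
      split_ifs with h1
      · by_cases hle : μ ≤ i
        · exact absurd (by rw [← h1, tsub_add_cancel_of_le hle]) h
        · rw [mchoose_eq_zero hle]; simp
      · rfl

lemma mchoose_mul (k μ ν : σ →₀ ℕ) :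
    mchoose (k + ν) ν * mchoose (k + ν + μ) μ =
      mchoose (μ + ν) μ * mchoose (k + (μ + ν)) (μ + ν) := by
  simp only [mchoose, ← Finset.prod_mul_distrib]
  refine Finset.prod_congr rfl fun s _ => ?_
  simp only [Finsupp.add_apply]
  have := Nat.choose_mul (n := k s + (μ s + ν s)) (k := μ s + ν s) (s := μ s) (by omega)
  rw [mul_comm ((μ s + ν s).choose _), this]
  rw [show k s + (μ s + ν s) - μ s = k s + ν s by omega, show μ s + ν s - μ s = ν s by omega,
    show k s + ν s + μ s = k s + (μ s + ν s) by omega, mul_comm]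

lemma hasse_hasse (μ ν : σ →₀ ℕ) (p : MvPolynomial σ R) :
    hasse ν (hasse μ p) = (mchoose (μ + ν) μ : R) • hasse (μ + ν) p := by
  ext k
  rw [coeff_smul, coeff_hasse, coeff_hasse, coeff_hasse, smul_eq_mul, ← mul_assoc, ← mul_assoc,
    ← Nat.cast_mul, ← Nat.cast_mul, mchoose_mul, show k + ν + μ = k + (μ + ν) by abel]

lemma pderiv_hasse (s : σ) (μ : σ →₀ ℕ) (p : MvPolynomial σ R) :
    pderiv s (hasse μ p) = ((μ s + 1 : ℕ) : R) • hasse (μ + Finsupp.single s 1) p := by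
  classical
  ext k
  rw [coeff_smul, coeff_pderiv, coeff_hasse, coeff_hasse, smul_eq_mul]
  have h1 : k + Finsupp.single s 1 + μ = k + (μ + Finsupp.single s 1) := by abel
  have h2 : mchoose (k + (μ + Finsupp.single s 1)) μ * (k s + 1)
      = (μ s + 1) * mchoose (k + (μ + Finsupp.single s 1)) (μ + Finsupp.single s 1) := by
    simp only [mchoose]
    rw [← Finset.mul_prod_erase Finset.univ (fun t => Nat.choose _ (μ t)) (Finset.mem_univ s),
      ← Finset.mul_prod_erase Finset.univ (fun t => Nat.choose _ ((μ + Finsupp.single s 1 : σ →₀ ℕ) t))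
        (Finset.mem_univ s)]
    have : ∀ t ∈ Finset.univ.erase s, ((k + (μ + Finsupp.single s 1) : σ →₀ ℕ) t).choose (μ t) =
        ((k + (μ + Finsupp.single s 1) : σ →₀ ℕ) t).choose ((μ + Finsupp.single s 1 : σ →₀ ℕ) t) := by
      intro t ht
      have : t ≠ s := (Finset.mem_erase.1 ht).1
      simp [this.symm]
    rw [Finset.prod_congr rfl this]
    simp only [Finsupp.add_apply, Finsupp.single_eq_same]
    have := Nat.choose_succ_right_eq (k s + (μ s + 1)) (μ s)
    rw [show k s + (μ s + 1) - μ s = k s + 1 by omega] at this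
    rw [mul_right_comm, ← this]
    rw [mul_right_comm, mul_comm (μ s + 1), mul_right_comm]
  rw [h1]
  have h3 := congrArg (Nat.cast : ℕ → R) h2
  push_cast at h3 ⊢
  linear_combination (coeff (k + (μ + Finsupp.single s 1)) p) * h3

end Hasse

end Basic
end RoyExt

namespace RoyExt

open MvPolynomial Finset

section Basic

variable {σ : Type*} {R : Type*}

section Shift

variable [Fintype σ] [CommRing R]

lemma lOne_hasse_le {S : Type*} [NormedCommRing S] (hS : ∀ n : ℕ, ‖(n : S)‖ ≤ n) {r : σ → ℕ}
    {p : MvPolynomial σ S} (hp : ∀ s, p.degreeOf s ≤ r s) (μ : σ →₀ ℕ) :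
    lOne (hasse μ p) ≤ 2 ^ (∑ s, r s) * lOne p := by
  have h : hasse μ p = ∑ i ∈ p.support, monomial (i - μ) (p.coeff i * mchoose i μ) := by
    conv_lhs => rw [p.as_sum, map_sum]
    simp only [hasse_monomial]
  rw [h]
  refine (lOne_sum_le _ _).trans ?_
  rw [lOne, Finset.mul_sum]
  refine (Finset.sum_le_sum fun i hi => ?_)
  rw [lOne_monomial, mul_comm]
  refine (norm_mul_le _ _).trans ?_
  rw [mul_comm (_ ^ _)]
  have : mchoose i μ ≤ 2 ^ (∑ s, r s) := by
    rw [← Finset.prod_pow_eq_pow_sum]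
    refine Finset.prod_le_prod' fun s _ => (Nat.choose_le_two_pow _ _).trans ?_
    exact Nat.pow_le_pow_right (by norm_num) ((monomial_le_degreeOf s hi).trans (hp s))
  rw [mul_comm]
  refine mul_le_mul_of_nonneg_left ((hS _).trans ?_) (norm_nonneg _)
  exact_mod_cast this

lemma degreeOf_hasse_le (s : σ) (μ : σ →₀ ℕ) (p : MvPolynomial σ R) :
    (hasse μ p).degreeOf s ≤ p.degreeOf s := by
  rw [degreeOf_le_iff]
  intro k hk
  rw [mem_support_iff, coeff_hasse] at hk
  have : k + μ ∈ p.support := mem_support_iff.2 (right_ne_zero_of_mul hk)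
  have := monomial_le_degreeOf s this
  simp only [Finsupp.add_apply] at this
  omega

/-- Translation of a polynomial. -/
noncomputable def shift (ζ : σ → R) : MvPolynomial σ R →ₐ[R] MvPolynomial σ R :=
  aeval fun s => X s + C (ζ s)

lemma coeff_prod_X_add_C (ζ : σ → R) (i μ : σ →₀ ℕ) :
    coeff μ (∏ s, (X s + C (ζ s)) ^ i s) = ∏ s, ((i s).choose (μ s) : R) * ζ s ^ (i s - μ s) := by
  classical
  simp only [add_pow]
  rw [Finset.prod_univ_sum, coeff_sum]
  have key : ∀ k : σ → ℕ, (∏ s, (X s ^ k s * C (ζ s) ^ (i s - k s) * ((i s).choose (k s) :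
      MvPolynomial σ R))) = monomial (Finsupp.equivFunOnFinite.symm k)
        (∏ s, ((i s).choose (k s) : R) * ζ s ^ (i s - k s)) := by
    intro k
    rw [monomial_eq, Finsupp.prod_fintype _ _ (by simp), map_prod, ← Finset.prod_mul_distrib]
    refine Finset.prod_congr rfl fun s _ => ?_
    simp only [map_mul, map_pow, map_natCast, Finsupp.equivFunOnFinite_symm_apply_apply]
    ring
  simp only [key, coeff_monomial]
  by_cases hμ : μ ≤ i
  · rw [Finset.sum_eq_single (μ : σ → ℕ)]
    · rw [if_pos (by ext; simp)]
    · intro k _ hk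
      rw [if_neg]
      rintro rfl
      exact hk (by ext; simp)
    · intro h
      refine absurd (Fintype.mem_piFinset.2 fun s => ?_) h
      have := hμ s
      simp only [Finset.mem_range]
      omega
  · rw [Finset.sum_eq_zero]
    · rw [Finsupp.le_def, not_forall] at hμ
      obtain ⟨s, hs⟩ := hμ
      rw [Finset.prod_eq_zero (Finset.mem_univ s)]
      rw [Nat.choose_eq_zero_of_lt (not_le.1 hs)]
      simp
    · intro k hk
      rw [if_neg]
      rintro rfl
      refine hμ fun s => ?_
      have := Finset.mem_range.1 (Fintype.mem_piFinset.1 hk s)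
      simp only [Finsupp.equivFunOnFinite_symm_apply_apply]
      omega

lemma coeff_shift (ζ : σ → R) (μ : σ →₀ ℕ) (p : MvPolynomial σ R) :
    coeff μ (shift ζ p) = eval ζ (hasse μ p) := by
  induction p using MvPolynomial.induction_on' with
  | add p q hp hq => simp only [map_add, coeff_add, hp, hq]
  | monomial i a =>
    rw [hasse_monomial, shift, aeval_monomial, eval_monomial, Finsupp.prod_fintype _ _ (by simp),
      Finsupp.prod_fintype _ _ (by simp), algebraMap_eq, coeff_C_mul, coeff_prod_X_add_C,
      Finset.prod_mul_distrib, mchoose]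
    push_cast
    simp only [Pi.sub_apply]
    ring

lemma shift_injective (ζ : σ → R) : Function.Injective (shift ζ) := by
  have : ∀ p, shift (-ζ) (shift ζ p) = p := by
    intro p
    have : (shift (-ζ)).comp (shift ζ) = AlgHom.id R _ := by
      ext s
      simp [shift]
    exact DFunLike.congr_fun this p
  exact Function.LeftInverse.injective this

lemma exists_eval_hasse_ne_zero {p : MvPolynomial σ R} (hp : p ≠ 0) (ζ : σ → R) :
    ∃ μ, eval ζ (hasse μ p) ≠ 0 := by
  by_contra! h
  refine hp (shift_injective ζ ?_)
  ext μ
  rw [coeff_shift, h, map_zero, coeff_zero]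

lemma hasse_eq_zero_iff_shift {ζ : σ → R} (p : MvPolynomial σ R) :
    (∀ μ, eval ζ (hasse μ p) = 0) ↔ p = 0 :=
  ⟨fun h => by_contra fun hp => (exists_eval_hasse_ne_zero hp ζ).elim fun μ hμ => hμ (h μ),
    fun h μ => by simp [h]⟩

/-- All monomials of `p` have weight at least `θ`. -/
def HasIndex (w : σ → ℝ) (θ : ℝ) (p : MvPolynomial σ R) : Prop :=
  ∀ μ : σ →₀ ℕ, coeff μ p ≠ 0 → θ ≤ ∑ s, w s * μ s

namespace HasIndex

variable {w : σ → ℝ} {θ θ' : ℝ} {p q : MvPolynomial σ R}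

lemma mono (h : HasIndex w θ p) (hle : θ' ≤ θ) : HasIndex w θ' p :=
  fun μ hμ => hle.trans (h μ hμ)

lemma sum {ι : Type*} {s : Finset ι} {f : ι → MvPolynomial σ R}
    (h : ∀ i ∈ s, HasIndex w θ (f i)) : HasIndex w θ (∑ i ∈ s, f i) := by
  intro μ hμ
  rw [coeff_sum] at hμ
  obtain ⟨i, hi, h'⟩ := Finset.exists_ne_zero_of_sum_ne_zero hμ
  exact h i hi μ h'

lemma mul (hp : HasIndex w θ p) (hq : HasIndex w θ' q) : HasIndex w (θ + θ') (p * q) := by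
  classical
  intro μ hμ
  rw [coeff_mul] at hμ
  obtain ⟨⟨i, j⟩, hij, h'⟩ := Finset.exists_ne_zero_of_sum_ne_zero hμ
  rw [Finset.HasAntidiagonal.mem_antidiagonal] at hij
  have h1 := hp i (left_ne_zero_of_mul h')
  have h2 := hq j (right_ne_zero_of_mul h')
  rw [← hij]
  simp only [Finsupp.add_apply, Nat.cast_add, mul_add, Finset.sum_add_distrib]
  simpa using add_le_add h1 h2

lemma one : HasIndex w 0 (1 : MvPolynomial σ R) := by
  classical
  intro μ hμ
  rw [coeff_one] at hμ
  have : μ = 0 := by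
    by_contra h
    exact hμ (if_neg (Ne.symm h))
  simp [this]

lemma prod {ι : Type*} {s : Finset ι} {f : ι → MvPolynomial σ R} {t : ι → ℝ}
    (h : ∀ i ∈ s, HasIndex w (t i) (f i)) : HasIndex w (∑ i ∈ s, t i) (∏ i ∈ s, f i) := by
  classical
  induction s using Finset.induction_on with
  | empty => simpa using one
  | insert a s ha ih =>
    rw [Finset.sum_insert ha, Finset.prod_insert ha]
    exact (h a (Finset.mem_insert_self _ _)).mul
      (ih fun i hi => h i (Finset.mem_insert_of_mem hi))

lemma det {h : ℕ} {M : Matrix (Fin h) (Fin h) (MvPolynomial σ R)} {t : Fin h → ℝ}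
    (hM : ∀ i j, HasIndex w (t j) (M i j)) : HasIndex w (∑ j, t j) M.det := by
  rw [Matrix.det_apply]
  refine sum fun τ _ => ?_
  have h1 : HasIndex w (∑ j, t j) (∏ i, M (τ i) i) := prod fun i _ => hM _ _
  rcases Int.units_eq_one_or (Equiv.Perm.sign τ) with hs | hs
  · simpa [hs] using h1
  · intro μ hμ
    exact h1 μ (by simpa [hs] using hμ)

/-- Hasse derivatives lower the index at most by the weight. -/
lemma shift_hasse {ζ : σ → R} (h : HasIndex w θ (shift ζ p)) (ν : σ →₀ ℕ) :
    HasIndex w (θ - ∑ s, w s * ν s) (shift ζ (hasse ν p)) := by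
  intro μ hμ
  rw [coeff_shift, hasse_hasse, smul_eval] at hμ
  have := h (ν + μ) (by rw [coeff_shift]; exact right_ne_zero_of_mul hμ)
  simp only [Finsupp.add_apply, Nat.cast_add, mul_add, Finset.sum_add_distrib] at this
  linarith

end HasIndex

end Shift
end Basic
end RoyExt

namespace RoyExt

open MvPolynomial Finset

section Wronskian

variable {σ : Type*} [Fintype σ]

lemma finsupp_induction_single {P : (σ →₀ ℕ) → Prop} (h0 : P 0)
    (hs : ∀ μ s, P μ → P (μ + Finsupp.single s 1)) (μ : σ →₀ ℕ) : P μ := by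
  classical
  obtain ⟨n, hn⟩ : ∃ n, ∑ s, μ s = n := ⟨_, rfl⟩
  induction n generalizing μ with
  | zero =>
    have : μ = 0 := by
      ext s
      exact Finset.sum_eq_zero_iff.1 hn s (Finset.mem_univ s)
    rwa [this]
  | succ n ih =>
    obtain ⟨s, -, hs'⟩ : ∃ s ∈ Finset.univ, μ s ≠ 0 :=
      Finset.exists_ne_zero_of_sum_ne_zero (by rw [hn]; exact Nat.succ_ne_zero n)
    have hle : Finsupp.single s 1 ≤ μ := by
      rw [Finsupp.single_le_iff]
      omega
    have heq : μ - Finsupp.single s 1 + Finsupp.single s 1 = μ := tsub_add_cancel_of_le hle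
    rw [← heq]
    refine hs _ _ (ih _ ?_)
    rw [← heq] at hn
    simp only [Finsupp.add_apply, Finset.sum_add_distrib] at hn
    have : ∑ t, (Finsupp.single s 1 : σ →₀ ℕ) t = 1 := by
      simp [Finsupp.single_apply]
    omega

/-- A generalized Wronskian of linearly independent polynomials does not vanish. -/
theorem exists_wronskian_ne_zero {h : ℕ} (f : Fin h → MvPolynomial σ ℝ)
    (hf : LinearIndependent ℝ f) :
    ∃ μ : Fin h → (σ →₀ ℕ), (∀ i, ∑ s, μ i s + 1 ≤ h) ∧
      (Matrix.of fun i j => hasse (μ i) (f j)).det ≠ 0 := by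
  induction h with
  | zero => exact ⟨fun i => i.elim0, fun i => i.elim0, by simp⟩
  | succ h ih =>
    obtain ⟨μ, hμ, hdet⟩ := ih (f ∘ Fin.castSucc) (hf.comp _ (Fin.castSucc_injective h))
    by_contra! hcon
    set M : Matrix (Fin h) (Fin h) (MvPolynomial σ ℝ) :=
      Matrix.of fun i j => hasse (μ i) ((f ∘ Fin.castSucc) j) with hM
    set a : Fin (h + 1) → MvPolynomial σ ℝ := fun j => (-1) ^ (h + (j : ℕ)) *
      (Matrix.of fun (i : Fin h) (k : Fin h) => hasse (μ i) (f (j.succAbove k))).det with ha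
    have halast : a (Fin.last h) = M.det := by
      simp only [ha, hM, Fin.val_last, Fin.succAbove_last, Function.comp]
      rw [Even.neg_one_pow ⟨h, rfl⟩, one_mul]
    have hrel : ∀ ν : σ →₀ ℕ, ∑ s, ν s ≤ h → ∑ j, a j * hasse ν (f j) = 0 := by
      intro ν hν
      have := hcon (Fin.snoc (α := fun _ => σ →₀ ℕ) μ ν) (by
        intro i
        refine Fin.lastCases ?_ (fun i => ?_) i
        · simpa using hν
        · simpa using (hμ i).trans (Nat.le_succ h))
      rw [Matrix.det_succ_row _ (Fin.last h)] at this
      rw [← this]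
      refine Finset.sum_congr rfl fun j _ => ?_
      simp only [ha, Fin.val_last, Matrix.of_apply, Fin.snoc_last]
      rw [mul_right_comm]
      congr 2
      ext1 i k
      simp
    have hd : ∀ (ν : σ →₀ ℕ) (s : σ), pderiv s (∑ j, a j * hasse ν (f j)) =
        ∑ j, pderiv s (a j) * hasse ν (f j) +
          ((ν s + 1 : ℕ) : ℝ) • ∑ j, a j * hasse (ν + Finsupp.single s 1) (f j) := by
      intro ν s
      rw [map_sum, Finset.smul_sum, ← Finset.sum_add_distrib]
      refine Finset.sum_congr rfl fun j _ => ?_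
      rw [Derivation.leibniz, pderiv_hasse, smul_eq_mul, smul_eq_mul, mul_smul_comm, add_comm,
        mul_comm (hasse ν (f j))]
    have hlow : ∀ (ν : σ →₀ ℕ) (s : σ), ∑ s, ν s + 1 ≤ h →
        ∑ j, pderiv s (a j) * hasse ν (f j) = 0 := by
      intro ν s hν
      have h1 := hd ν s
      rw [hrel ν (by omega), hrel (ν + Finsupp.single s 1) (by
        classical
        simp only [Finsupp.add_apply, Finset.sum_add_distrib]
        have : ∑ t, (Finsupp.single s 1 : σ →₀ ℕ) t = 1 := by simp [Finsupp.single_apply]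
        omega)] at h1
      simpa using h1.symm
    have hprop : ∀ (s : σ) (j : Fin (h + 1)),
        M.det * pderiv s (a j) = a j * pderiv s M.det := by
      intro s
      have hv : M.mulVec (fun j => M.det * pderiv s (a j.castSucc) -
          a j.castSucc * pderiv s M.det) = 0 := by
        ext1 i
        have e1 := hlow (μ i) s (hμ i)
        have e2 := hrel (μ i) ((Nat.le_succ _).trans (hμ i))
        rw [Fin.sum_univ_castSucc, halast] at e1 e2
        have e3 : M.det * (∑ j : Fin h, pderiv s (a j.castSucc) * hasse (μ i) (f j.castSucc)) -
            pderiv s M.det * (∑ j : Fin h, a j.castSucc * hasse (μ i) (f j.castSucc)) = 0 := by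
          linear_combination M.det * e1 - pderiv s M.det * e2
        rw [Finset.mul_sum, Finset.mul_sum, ← Finset.sum_sub_distrib] at e3
        rw [Pi.zero_apply, ← e3]
        simp only [Matrix.mulVec, dotProduct]
        refine Finset.sum_congr rfl fun j _ => ?_
        simp only [hM, Matrix.of_apply, Function.comp]
        ring
      have h0 := Matrix.eq_zero_of_mulVec_eq_zero hdet hv
      intro j
      refine Fin.lastCases ?_ (fun j => ?_) j
      · rw [halast]
      · exact sub_eq_zero.1 (congrFun h0 j)
    have hall : ∀ ν : σ →₀ ℕ, ∑ j, a j * hasse ν (f j) = 0 := by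
      refine finsupp_induction_single (hrel 0 (by simp)) fun ν s hν => ?_
      have h1 := congrArg (M.det * ·) (hd ν s)
      simp only [hν, map_zero, mul_zero, mul_add, Finset.mul_sum] at h1
      have h2 : ∑ j, M.det * (pderiv s (a j) * hasse ν (f j)) = 0 := by
        have : ∑ j, M.det * (pderiv s (a j) * hasse ν (f j)) =
            pderiv s M.det * ∑ j, a j * hasse ν (f j) := by
          rw [Finset.mul_sum]
          refine Finset.sum_congr rfl fun j _ => ?_
          rw [← mul_assoc, hprop]
          ring
        rw [this, hν, mul_zero]
      rw [h2, zero_add, eq_comm, mul_eq_zero, smul_eq_zero] at h1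
      rcases h1 with h1 | h1 | h1
      · exact absurd h1 hdet
      · exact absurd h1 (by positivity)
      · exact h1
    obtain ⟨x, hx⟩ : ∃ x, eval x M.det ≠ 0 := by
      by_contra! hx
      exact hdet (MvPolynomial.funext fun x => by rw [hx, map_zero])
    have hz : ∑ j, eval x (a j) • f j = 0 := by
      rw [← hasse_eq_zero_iff_shift (ζ := x)]
      intro ν
      have := congrArg (eval x) (hall ν)
      simp only [map_sum, map_mul, map_zero] at this
      simpa [map_sum, map_smul, smul_eval] using this
    have := Fintype.linearIndependent_iff.1 hf _ hz (Fin.last h)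
    rw [halast] at this
    exact hx this

end Wronskian
end RoyExt

namespace RoyExt

open Polynomial in
lemma pUnit_hasse (μ : PUnit.{1} →₀ ℕ) (p : MvPolynomial PUnit ℝ) :
    MvPolynomial.uniqueAlgEquiv ℝ PUnit.{1} (hasse μ p) =
      hasseDeriv (μ PUnit.unit) (MvPolynomial.uniqueAlgEquiv ℝ PUnit.{1} p) := by
  induction p using MvPolynomial.induction_on' with
  | add p q hp hq => simp only [map_add, hp, hq]
  | monomial i a =>
    rw [hasse_monomial, MvPolynomial.uniqueAlgEquiv_monomial, MvPolynomial.uniqueAlgEquiv_monomial,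
      hasseDeriv_monomial]
    simp [mchoose, mul_comm]

open Polynomial in
theorem wronskian_ne_zero {h : ℕ} (f : Fin h → ℝ[X]) (hf : LinearIndependent ℝ f) :
    (Matrix.of fun i j : Fin h => hasseDeriv (i : ℕ) (f j)).det ≠ 0 := by
  let e := MvPolynomial.uniqueAlgEquiv ℝ PUnit.{1}
  have hf' : LinearIndependent ℝ (fun j => e.symm (f j)) :=
    hf.map' e.symm.toLinearEquiv.toLinearMap (LinearEquiv.ker _)
  obtain ⟨μ, hμ, hdet⟩ := exists_wronskian_ne_zero _ hf'
  have hlt : ∀ i, μ i PUnit.unit < h := fun i => by simpa using hμ i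
  let k : Fin h → Fin h := fun i => ⟨μ i PUnit.unit, hlt i⟩
  have hinj : Function.Injective k := by
    intro i j hij
    by_contra hne
    have : μ i = μ j := by
      ext
      simpa [k] using hij
    exact hdet (Matrix.det_zero_of_row_eq hne (by ext1 l; simp [this]))
  let τ : Equiv.Perm (Fin h) := Equiv.ofBijective k (Finite.injective_iff_bijective.1 hinj)
  intro h0
  apply hdet
  apply e.injective
  rw [map_zero, AlgEquiv.map_det]
  have : e.mapMatrix (Matrix.of fun i j => hasse (μ i) (e.symm (f j))) =
      (Matrix.of fun i j : Fin h => hasseDeriv (i : ℕ) (f j)).submatrix τ id := by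
    ext1 i j
    simp only [AlgEquiv.mapMatrix_apply, Matrix.map_apply, Matrix.of_apply, Matrix.submatrix_apply]
    rw [pUnit_hasse, AlgEquiv.apply_symm_apply]
    simp [τ, k]
  rw [this, Matrix.det_permute, h0, mul_zero]

section OneVar

open Polynomial

lemma isPrimitive_linear {A B : ℤ} (hAB : IsCoprime A B) : (C B * X - C A : ℤ[X]).IsPrimitive := by
  intro r hr
  rw [C_dvd_iff_dvd_coeff] at hr
  have h0 := hr 0
  have h1 := hr 1
  rw [coeff_sub, coeff_C_succ] at h1
  simp at h0 h1
  exact hAB.isUnit_of_dvd' h0 h1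

lemma isPrimitive_pow {p : ℤ[X]} (hp : p.IsPrimitive) (n : ℕ) : (p ^ n).IsPrimitive := by
  induction n with
  | zero => simp
  | succ n ih => rw [pow_succ]; exact ih.mul hp

lemma trailingCoeff_pow' (p : ℤ[X]) (n : ℕ) : (p ^ n).trailingCoeff = p.trailingCoeff ^ n := by
  induction n with
  | zero => simp [trailingCoeff]
  | succ n ih => rw [pow_succ, trailingCoeff_mul, ih, pow_succ]

lemma hasseDeriv_rootMultiplicity_ne_zero {U : ℝ[X]} (hU : U ≠ 0) (t : ℝ) :
    (hasseDeriv (U.rootMultiplicity t) U).eval t ≠ 0 := by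
  obtain ⟨q, hq, hdvd⟩ := exists_eq_pow_rootMultiplicity_mul_and_not_dvd U hU t
  rw [← taylor_coeff]
  generalize U.rootMultiplicity t = l at *
  rw [hq]
  rw [taylor_mul, taylor_pow]
  have : taylor t (X - C t) = X := by simp
  rw [this, coeff_X_pow_mul', if_pos le_rfl, Nat.sub_self, taylor_coeff_zero]
  rwa [dvd_iff_isRoot] at hdvd

theorem exists_hasseDeriv_ne_zero {Q : ℤ[X]} {A B : ℤ} (hAB : IsCoprime A B) (hB : B ≠ 0)
    {U : ℝ[X]} {c : ℝ} (hc : c ≠ 0) (hU : U ≠ 0)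
    (hQU : Q.map (Int.castRingHom ℝ) = C c * U) {T : ℝ} (hT : ∀ n, |(Q.coeff n : ℝ)| ≤ T) :
    ∃ l, (hasseDeriv l U).eval ((A : ℝ) / B) ≠ 0 ∧ (max |(A : ℝ)| |(B : ℝ)|) ^ l ≤ T := by
  have hQ : Q ≠ 0 := by
    rintro rfl
    rw [Polynomial.map_zero, eq_comm, mul_eq_zero, C_eq_zero] at hQU
    exact hQU.elim hc hU
  refine ⟨U.rootMultiplicity ((A : ℝ) / B), hasseDeriv_rootMultiplicity_ne_zero hU _, ?_⟩
  set l := U.rootMultiplicity ((A : ℝ) / B) with hl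
  have hl' : l = (Q.map (Int.castRingHom ℚ)).rootMultiplicity ((A : ℚ) / B) := by
    rw [eq_rootMultiplicity_map (f := algebraMap ℚ ℝ) (algebraMap ℚ ℝ).injective, map_map]
    have : (algebraMap ℚ ℝ).comp (Int.castRingHom ℚ) = Int.castRingHom ℝ := RingHom.ext_int _ _
    rw [this, hQU, rootMultiplicity_mul (mul_ne_zero (C_ne_zero.2 hc) hU), rootMultiplicity_C,
      zero_add, hl]
    simp
  have hdvd : (C B * X - C A) ^ l ∣ Q := by
    refine (isPrimitive_pow (isPrimitive_linear hAB) l).dvd_of_fraction_map_dvd_fraction_map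
      (K := ℚ) ?_
    have hmap : ((C B * X - C A) ^ l : ℤ[X]).map (algebraMap ℤ ℚ) =
        C ((B : ℚ) ^ l) * (X - C ((A : ℚ) / B)) ^ l := by
      have hB' : (B : ℚ) ≠ 0 := by exact_mod_cast hB
      rw [C_pow, ← mul_pow, mul_sub, ← C_mul, mul_div_cancel₀ _ hB']
      simp
    rw [hmap, hl']
    refine (IsUnit.mul_left_dvd ?_).2 ?_
    · exact isUnit_C.2 (IsUnit.mk0 _ (by positivity))
    · exact pow_rootMultiplicity_dvd _ _
  obtain ⟨q, rfl⟩ := hdvd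
  have hq : q ≠ 0 := right_ne_zero_of_mul hQ
  have one_le : ∀ z : ℤ, z ≠ 0 → (1 : ℝ) ≤ |(z : ℝ)| := fun z hz => by
    exact_mod_cast Int.one_le_abs hz
  have key : ∀ z w : ℤ, w ≠ 0 → (∃ n, ((C B * X - C A) ^ l * q).coeff n = z ^ l * w) →
      |(z : ℝ)| ^ l ≤ T := by
    rintro z w hw ⟨n, hn⟩
    have := hT n
    rw [hn] at this
    push_cast at this
    rw [abs_mul, abs_pow] at this
    exact (le_mul_of_one_le_right (by positivity) (one_le w hw)).trans this
  have hlead : |(B : ℝ)| ^ l ≤ T := by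
    refine key B q.leadingCoeff (leadingCoeff_ne_zero.2 hq) ⟨((C B * X - C A) ^ l * q).natDegree, ?_⟩
    rw [coeff_natDegree, leadingCoeff_mul, leadingCoeff_pow]
    congr 2
    rw [sub_eq_add_neg, ← C_neg, leadingCoeff_linear hB]
  by_cases hA : A = 0
  · subst hA
    simpa using hlead
  rcases le_total |(A : ℝ)| |(B : ℝ)| with h | h
  · rwa [max_eq_right h]
  · rw [max_eq_left h]
    have := key (-A) q.trailingCoeff (trailingCoeff_nonzero_iff_nonzero.2 hq)
      ⟨((C B * X - C A) ^ l * q).natTrailingDegree, ?_⟩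
    · simpa using this
    have h0 : (C B * X - C A).coeff 0 = -A := by simp
    have ht : ((C B * X - C A)).natTrailingDegree = 0 :=
      natTrailingDegree_eq_zero.2 (Or.inr (by rw [h0]; simpa using hA))
    rw [← trailingCoeff, trailingCoeff_mul, trailingCoeff_pow', trailingCoeff, ht, h0]

end OneVar

end RoyExt

namespace RoyExt

open MvPolynomial Finset

lemma hasse_map {σ R S : Type*} [Fintype σ] [CommRing R] [CommRing S] (f : R →+* S)
    (μ : σ →₀ ℕ) (p : MvPolynomial σ R) : hasse μ (map f p) = map f (hasse μ p) := by
  ext k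
  simp [coeff_hasse, coeff_map]

lemma mchoose_cons {m : ℕ} (i a : ℕ) (k ν : Fin m →₀ ℕ) :
    mchoose (k.cons i) (ν.cons a) = i.choose a * mchoose k ν := by
  simp [mchoose, Fin.prod_univ_succ]

lemma cons_add_cons {m : ℕ} (i a : ℕ) (k ν : Fin m →₀ ℕ) :
    k.cons i + ν.cons a = (k + ν).cons (i + a) := by
  ext j
  refine Fin.cases ?_ (fun j => ?_) j <;> simp

lemma finSuccEquiv_hasse {m h : ℕ} {p : MvPolynomial (Fin (m + 1)) ℝ} {g : Fin h → Polynomial ℝ}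
    {e : Fin h → MvPolynomial (Fin m) ℝ}
    (hp : finSuccEquiv ℝ m p = ∑ s, (g s).map C * Polynomial.C (e s)) (a : ℕ) (ν : Fin m →₀ ℕ) :
    finSuccEquiv ℝ m (hasse (ν.cons a) p) =
      ∑ s, (Polynomial.hasseDeriv a (g s)).map C * Polynomial.C (hasse ν (e s)) := by
  ext i k
  rw [finSuccEquiv_coeff_coeff, coeff_hasse, cons_add_cons, mchoose_cons,
    ← finSuccEquiv_coeff_coeff, hp]
  simp only [Polynomial.finsetSum_coeff, Polynomial.coeff_mul_C, Polynomial.coeff_map, coeff_sum,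
    coeff_C_mul, coeff_hasse, Polynomial.hasseDeriv_coeff, Finset.mul_sum]
  refine Finset.sum_congr rfl fun s _ => ?_
  push_cast
  ring

lemma eval_cons_hasse {m : ℕ} {p : MvPolynomial (Fin (m + 1)) ℝ} {U : Polynomial ℝ}
    {V : MvPolynomial (Fin m) ℝ} (hp : finSuccEquiv ℝ m p = U.map C * Polynomial.C V)
    (a : ℕ) (ν : Fin m →₀ ℕ) (ζ : Fin (m + 1) → ℝ) :
    eval ζ (hasse (ν.cons a) p) =
      (Polynomial.hasseDeriv a U).eval (ζ 0) * eval (fun i => ζ i.succ) (hasse ν V) := by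
  have h1 := finSuccEquiv_hasse (h := 1) (g := fun _ => U) (e := fun _ => V) (p := p)
    (by simpa using hp) a ν
  have hζ : ζ = Fin.cons (ζ 0) (fun i => ζ i.succ) := (Fin.cons_self_tail ζ).symm
  rw [hζ, eval_eq_eval_mv_eval', h1]
  simp [Polynomial.map_map]
  left
  have h2 : (eval fun i : Fin m => ζ i.succ).comp C = RingHom.id ℝ := by ext; simp
  rw [h2, Polynomial.map_id]

lemma exists_rank_factorization {V : Type*} [AddCommGroup V] [Module ℝ V] {n : ℕ}
    (f : Fin n → V) : ∃ (h : ℕ) (c : Fin n → Fin h → ℝ) (e : Fin h → V), h ≤ n ∧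
      LinearIndependent ℝ e ∧ (∀ d : Fin h → ℝ, (∀ b, ∑ s, c b s * d s = 0) → ∀ s, d s = 0) ∧
      ∀ b, f b = ∑ s, c b s • e s := by
  let E := Submodule.span ℝ (Set.range f)
  have : FiniteDimensional ℝ E := FiniteDimensional.span_of_finite ℝ (Set.finite_range f)
  let B := Module.finBasis ℝ E
  have hmem : ∀ b, f b ∈ E := fun b => Submodule.subset_span ⟨b, rfl⟩
  refine ⟨Module.finrank ℝ E, fun b s => B.repr ⟨f b, hmem b⟩ s, fun s => (B s : V), ?_, ?_, ?_, ?_⟩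
  · have : Module.finrank ℝ E ≤ _ := finrank_range_le_card (R := ℝ) f
    rwa [Fintype.card_fin] at this
  · exact B.linearIndependent.map' E.subtype (Submodule.ker_subtype E)
  · intro d hd'
    let φ : E →ₗ[ℝ] ℝ := B.constr ℝ d
    have hφ : φ = 0 := by
      refine LinearMap.ext fun x => ?_
      obtain ⟨x, hx⟩ := x
      induction hx using Submodule.span_induction with
      | mem x hx =>
        obtain ⟨b, rfl⟩ := hx
        have := hd' b
        simp only [φ, Module.Basis.constr_apply_fintype, smul_eq_mul]
        exact this
      | zero => exact map_zero φ
      | add x y hx hy h1 h2 =>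
        have : (⟨x + y, add_mem hx hy⟩ : E) = ⟨x, hx⟩ + ⟨y, hy⟩ := rfl
        rw [this, map_add, h1, h2]; simp
      | smul a x hx h1 =>
        have : (⟨a • x, Submodule.smul_mem _ a hx⟩ : E) = a • ⟨x, hx⟩ := rfl
        rw [this, map_smul, h1]; simp
    intro s
    have : φ (B s) = d s := by simp [φ]
    rw [← this, hφ]; rfl
  · intro b
    have h2 := congrArg Subtype.val (B.sum_repr ⟨f b, hmem b⟩)
    simp only [Submodule.coe_sum, Submodule.coe_smul] at h2
    exact h2.symm

lemma exists_tensor_decomposition {m r : ℕ} (p : MvPolynomial (Fin (m + 1)) ℝ)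
    (hr : p.degreeOf 0 ≤ r) :
    ∃ (h : ℕ) (g : Fin h → Polynomial ℝ) (e : Fin h → MvPolynomial (Fin m) ℝ),
      h ≤ r + 1 ∧ LinearIndependent ℝ g ∧ LinearIndependent ℝ e ∧
      finSuccEquiv ℝ m p = ∑ s, (g s).map C * Polynomial.C (e s) := by
  obtain ⟨h, c, e, hh, he, hc, hf⟩ := exists_rank_factorization
    fun b : Fin (r + 1) => (finSuccEquiv ℝ m p).coeff b
  have hcoeff : ∀ (s : Fin h) (b : Fin (r + 1)),
      (∑ b : Fin (r + 1), Polynomial.monomial (b : ℕ) (c b s)).coeff (b : ℕ) = c b s := by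
    intro s b
    rw [Polynomial.finsetSum_coeff, Finset.sum_eq_single b]
    · rw [Polynomial.coeff_monomial, if_pos rfl]
    · intro b' _ hb'
      rw [Polynomial.coeff_monomial, if_neg]
      exact fun h => hb' (Fin.ext h)
    · simp
  refine ⟨h, fun s => ∑ b : Fin (r + 1), Polynomial.monomial (b : ℕ) (c b s), e, hh, ?_, he, ?_⟩
  · rw [Fintype.linearIndependent_iff]
    refine fun d hd => hc d fun b => ?_
    have := congrArg (fun q => Polynomial.coeff q (b : ℕ)) hd
    simp only [Polynomial.finsetSum_coeff, Polynomial.coeff_smul, Polynomial.coeff_zero,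
      smul_eq_mul] at this
    rw [← this]
    refine Finset.sum_congr rfl fun s _ => ?_
    rw [← Polynomial.finsetSum_coeff, hcoeff, mul_comm]
  · ext1 i
    rw [Polynomial.finsetSum_coeff]
    simp only [Polynomial.coeff_mul_C, Polynomial.coeff_map]
    by_cases hi : i < r + 1
    · have h1 := hf ⟨i, hi⟩
      simp only at h1
      rw [h1]
      refine Finset.sum_congr rfl fun s _ => ?_
      rw [hcoeff s ⟨i, hi⟩, MvPolynomial.smul_eq_C_mul]
    · rw [Polynomial.coeff_eq_zero_of_natDegree_lt]
      · symm
        refine Finset.sum_eq_zero fun s _ => ?_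
        rw [Polynomial.finsetSum_coeff, Finset.sum_eq_zero, map_zero, zero_mul]
        intro b _
        rw [Polynomial.coeff_monomial, if_neg]
        have := b.2
        omega
      · rw [natDegree_finSuccEquiv]
        omega

lemma degreeOf_det_le {σ R : Type*} [CommRing R] {h : ℕ}
    (M : Matrix (Fin h) (Fin h) (MvPolynomial σ R)) (s : σ) {B : ℕ}
    (hM : ∀ i j, (M i j).degreeOf s ≤ B) : M.det.degreeOf s ≤ h * B := by
  rw [Matrix.det_apply]
  refine (degreeOf_sum_le _ _ _).trans (Finset.sup_le fun τ _ => ?_)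
  have h1 : (∏ i, M (τ i) i).degreeOf s ≤ h * B := by
    refine (degreeOf_prod_le _ _ _).trans ?_
    refine (Finset.sum_le_sum fun i _ => hM (τ i) i).trans ?_
    simp
  rcases Int.units_eq_one_or (Equiv.Perm.sign τ) with hs | hs
  · simpa [hs] using h1
  · simpa [hs, degreeOf_neg] using h1

lemma lOne_finSucc_coeff_le {m : ℕ} (p : MvPolynomial (Fin (m + 1)) ℤ) (a : ℕ) :
    lOne ((finSuccEquiv ℤ m p).coeff a) ≤ lOne p := by
  classical
  rw [lOne, lOne]
  have : ∀ ν ∈ ((finSuccEquiv ℤ m p).coeff a).support,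
      ‖coeff ν ((finSuccEquiv ℤ m p).coeff a)‖ = ‖coeff (ν.cons a) p‖ := fun ν _ => by
    rw [finSuccEquiv_coeff_coeff]
  rw [Finset.sum_congr rfl this]
  rw [← Finset.sum_image (f := fun i => ‖coeff i p‖) (g := fun ν : Fin m →₀ ℕ => ν.cons a)
    (fun ν _ ν' _ h => (Finsupp.cons_injective2 h).2)]
  refine Finset.sum_le_sum_of_subset_of_nonneg ?_ fun _ _ _ => norm_nonneg _
  intro i hi
  obtain ⟨ν, hν, rfl⟩ := Finset.mem_image.1 hi
  rw [mem_support_iff, ← finSuccEquiv_coeff_coeff]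
  exact mem_support_iff.1 hν

lemma one_le_lOne {σ : Type*} {p : MvPolynomial σ ℤ} (hp : p ≠ 0) : 1 ≤ lOne p := by
  obtain ⟨i, hi⟩ := exists_coeff_ne_zero hp
  refine le_trans ?_ (norm_coeff_le_lOne p i)
  rw [Int.norm_eq_abs]
  exact_mod_cast Int.one_le_abs hi

end RoyExt

namespace RoyExt

open MvPolynomial Finset

lemma sum_max_ge {h r : ℕ} (hr : 0 < r) (hh : h ≤ r + 1) {c : ℝ} (hc : 0 < c) (hc1 : c ≤ 1) :
    h * c ^ 2 / 8 ≤ ∑ j : Fin h, max 0 (c - (j : ℕ) / r) := by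
  have hr' : (0 : ℝ) < r := by exact_mod_cast hr
  rw [Fin.sum_univ_eq_sum_range (fun j : ℕ => max 0 (c - (j : ℝ) / r)) h]
  set k := min h (⌊c * r / 2⌋₊ + 1) with hk
  have h1 : ∑ j ∈ Finset.range k, c / 2 ≤ ∑ j ∈ Finset.range h, max 0 (c - (j : ℝ) / r) := by
    refine (Finset.sum_le_sum fun j hj => ?_).trans (Finset.sum_le_sum_of_subset_of_nonneg
      (Finset.range_mono (min_le_left _ _)) fun _ _ _ => le_max_left _ _)
    refine le_max_of_le_right ?_
    have : j ≤ ⌊c * r / 2⌋₊ := by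
      have := Finset.mem_range.1 hj
      omega
    have h2 : (j : ℝ) ≤ c * r / 2 := (Nat.cast_le.2 this).trans (Nat.floor_le (by positivity))
    have : (j : ℝ) / r ≤ c / 2 := by
      rw [div_le_iff₀ hr']
      linarith
    linarith
  refine le_trans ?_ h1
  rw [Finset.sum_const, Finset.card_range, nsmul_eq_mul]
  have h2 : (h : ℝ) * c / 4 ≤ k := by
    rcases min_choice h (⌊c * r / 2⌋₊ + 1) with h' | h'
    · rw [hk, h']
      have : (0 : ℝ) ≤ h := by positivity
      nlinarith
    · rw [hk, h']
      push_cast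
      have h3 := Nat.lt_floor_add_one (c * r / 2)
      have h4 : (h : ℝ) ≤ 2 * r := by
        have : h ≤ 2 * r := by omega
        exact_mod_cast this
      nlinarith
  nlinarith

/-- The inductive statement of Roth's lemma in `m` variables. -/
def RothStatement (m : ℕ) : Prop :=
  ∀ ε : ℝ, 0 < ε → ∃ ω : ℝ, 0 < ω ∧ ∀ (r : Fin m → ℕ) (a b : Fin m → ℤ) (Λ : ℝ)
    (P : MvPolynomial (Fin m) ℤ), (∀ i, 0 < r i) → (∀ i j, i < j → (r i : ℝ) ≤ ω * r j) →
    (∀ i, IsCoprime (a i) (b i)) → (∀ i, b i ≠ 0) → 0 < Λ →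
    (∀ i, Λ ≤ r i * Real.log (max |(a i : ℝ)| |(b i : ℝ)|)) → (∀ i, (r i : ℝ) ≤ ω * Λ) →
    P ≠ 0 → (∀ i, P.degreeOf i ≤ r i) → Real.log (lOne P) ≤ ω * Λ →
    ∃ μ : Fin m →₀ ℕ, ∑ i, (1 / (r i : ℝ)) * μ i < ε ∧
      eval (fun i => (a i : ℝ) / b i) (hasse μ (map (Int.castRingHom ℝ) P)) ≠ 0

lemma map_int_ne_zero {σ : Type*} {P : MvPolynomial σ ℤ} (hP : P ≠ 0) :
    map (Int.castRingHom ℝ) P ≠ 0 := by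
  intro h
  exact hP (map_injective _ (RingHom.injective_int _) (by rw [h, map_zero]))

lemma roth_zero : RothStatement 0 := by
  intro ε hε
  refine ⟨1, one_pos, fun r a b Λ P _ _ _ _ _ _ _ hP _ _ => ?_⟩
  obtain ⟨μ, hμ⟩ := exists_eval_hasse_ne_zero (map_int_ne_zero hP) fun i => (a i : ℝ) / b i
  exact ⟨μ, by simpa using hε, hμ⟩

lemma degreeOf_map_int_le {σ : Type*} (P : MvPolynomial σ ℤ) (s : σ) :
    (map (Int.castRingHom ℝ) P).degreeOf s ≤ P.degreeOf s := by
  classical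
  rw [degreeOf_le_iff]
  exact fun k hk => monomial_le_degreeOf s (support_map_subset _ _ hk)

lemma coeff_slice {m : ℕ} (W : MvPolynomial (Fin (m + 1)) ℤ) (k : Fin m →₀ ℕ) (n : ℕ) :
    (∑ i ∈ Finset.range ((finSuccEquiv ℤ m W).natDegree + 1),
      Polynomial.monomial i (coeff (k.cons i) W)).coeff n = coeff (k.cons n) W := by
  simp only [Polynomial.finsetSum_coeff, Polynomial.coeff_monomial, Finset.sum_ite_eq',
    Finset.mem_range]
  split_ifs with hn
  · rfl
  · rw [← finSuccEquiv_coeff_coeff, Polynomial.coeff_eq_zero_of_natDegree_lt (by omega), coeff_zero]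

lemma log_lOne_det_hasse_le {σ : Type*} [Fintype σ] {P : MvPolynomial σ ℤ} (hP : P ≠ 0)
    {r : σ → ℕ} (hr : ∀ s, P.degreeOf s ≤ r s) {h : ℕ} (μ : Fin h → Fin h → (σ →₀ ℕ))
    (hW : (Matrix.of fun i j => hasse (μ i j) P).det ≠ 0) :
    Real.log (lOne (Matrix.of fun i j => hasse (μ i j) P).det) ≤
      h * ((h - 1 : ℝ) + ∑ s, (r s : ℝ) + Real.log (lOne P)) := by
  have hP1 := one_le_lOne hP
  rcases Nat.eq_zero_or_pos h with rfl | hpos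
  · simp [lOne_one]
  have h1 : lOne (Matrix.of fun i j => hasse (μ i j) P).det ≤
      h.factorial * (2 ^ (∑ s, r s) * lOne P) ^ h :=
    lOne_det_le _ fun i j => lOne_hasse_le (fun n => by rw [Int.norm_eq_abs]; simp) hr _
  have h2 : (h.factorial : ℝ) ≤ (h : ℝ) ^ h := by exact_mod_cast Nat.factorial_le_pow h
  have hh : (0 : ℝ) < h := by exact_mod_cast hpos
  have h3 : lOne (Matrix.of fun i j => hasse (μ i j) P).det ≤
      (h * (2 ^ (∑ s, r s) * lOne P)) ^ h := by
    rw [mul_pow]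
    exact h1.trans (by gcongr)
  refine (Real.log_le_log (by linarith [one_le_lOne hW]) h3).trans ?_
  rw [Real.log_pow, Real.log_mul (by positivity) (by positivity),
    Real.log_mul (by positivity) (by positivity), Real.log_pow]
  have h4 := Real.log_le_sub_one_of_pos hh
  have h5 : Real.log 2 ≤ 1 := by
    have := Real.log_le_sub_one_of_pos (show (0 : ℝ) < 2 by norm_num)
    linarith
  have h6 : ((∑ s, r s : ℕ) : ℝ) * Real.log 2 ≤ ∑ s, (r s : ℝ) := by
    rw [Nat.cast_sum]
    exact mul_le_of_le_one_right (by positivity) h5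
  refine mul_le_mul_of_nonneg_left ?_ hh.le
  linarith

theorem roth_succ {m : ℕ} (ih : RothStatement m) : RothStatement (m + 1) := by
  intro ε₀ hε₀
  obtain ⟨ε, hε, hε1, hεle⟩ : ∃ ε : ℝ, 0 < ε ∧ ε ≤ 1 ∧ ε ≤ ε₀ :=
    ⟨min ε₀ 1, lt_min hε₀ one_pos, min_le_right _ _, min_le_left _ _⟩
  obtain ⟨ω', hω', H⟩ := ih (ε ^ 2 / 64) (by positivity)
  set ω := min (min ω' (ε ^ 2 / 64) / (m + 3)) (ε / 2) with hω
  have hω0 : 0 < ω := by positivity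
  have hω1 : (m + 3) * ω ≤ min ω' (ε ^ 2 / 64) := by
    have : ω ≤ min ω' (ε ^ 2 / 64) / (m + 3) := min_le_left _ _
    rw [le_div_iff₀ (by positivity)] at this
    linarith
  have hω2 : (m + 3) * ω ≤ ω' := hω1.trans (min_le_left _ _)
  have hω3 : (m + 3) * ω ≤ ε ^ 2 / 64 := hω1.trans (min_le_right _ _)
  have hω4 : ω ≤ ε / 2 := min_le_right _ _
  have hω5 : ω ≤ ω' := by nlinarith [(Nat.cast_nonneg m : (0 : ℝ) ≤ m)]
  refine ⟨ω, hω0, fun r a b Λ P hr hrr hab hb hΛ hΛr hrω hP hdeg hlog => ?_⟩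
  by_contra! hcon
  set ζ : Fin (m + 1) → ℝ := fun i => (a i : ℝ) / b i with hζ
  set Pr := map (Int.castRingHom ℝ) P with hPr
  have hPr0 : Pr ≠ 0 := map_int_ne_zero hP
  have hr' : ∀ i, (0 : ℝ) < r i := fun i => by exact_mod_cast hr i
  obtain ⟨h, g, e, hh, hg, he, hdec⟩ := exists_tensor_decomposition (r := r 0) Pr
    ((degreeOf_map_int_le _ _).trans (hdeg 0))
  have hpos : 0 < h := by
    rcases Nat.eq_zero_or_pos h with rfl | h'
    · simp at hdec
      exact absurd hdec hPr0
    · exact h'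
  have hh' : (0 : ℝ) < h := by exact_mod_cast hpos
  have hhr : (h : ℝ) - 1 ≤ r 0 := by
    have : (h : ℝ) ≤ r 0 + 1 := by exact_mod_cast hh
    linarith
  obtain ⟨μ, hμ, hV⟩ := exists_wronskian_ne_zero e he
  have hU := wronskian_ne_zero g hg
  set V := (Matrix.of fun i j => hasse (μ i) (e j)).det with hVdef
  set U := (Matrix.of fun i j : Fin h => Polynomial.hasseDeriv (i : ℕ) (g j)).det with hUdef
  set W := (Matrix.of fun i j : Fin h => hasse ((μ i).cons (j : ℕ)) P).det with hWdef
  have hWmap : map (Int.castRingHom ℝ) W =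
      (Matrix.of fun i j : Fin h => hasse ((μ i).cons (j : ℕ)) Pr).det := by
    rw [hWdef, RingHom.map_det]
    congr 1
    ext1 i j
    simp [hPr, hasse_map]
  have hWfac : finSuccEquiv ℝ m (map (Int.castRingHom ℝ) W) = U.map C * Polynomial.C V := by
    rw [hWmap, AlgEquiv.map_det, hUdef, hVdef, ← Matrix.det_transpose (Matrix.of fun i j : Fin h =>
      Polynomial.hasseDeriv (i : ℕ) (g j)), ← Polynomial.coe_mapRingHom, RingHom.map_det,
      RingHom.map_det, mul_comm, ← Matrix.det_mul]
    congr 1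
    ext1 i j
    simp only [AlgEquiv.mapMatrix_apply, Matrix.map_apply, Matrix.of_apply, Matrix.mul_apply,
      RingHom.mapMatrix_apply, Matrix.transpose_apply, Polynomial.coe_mapRingHom]
    rw [finSuccEquiv_hasse hdec]
    exact Finset.sum_congr rfl fun s _ => mul_comm _ _
  have hcoef : ∀ (i : ℕ) (k : Fin m →₀ ℕ),
      ((coeff (k.cons i) W : ℤ) : ℝ) = U.coeff i * coeff k V := by
    intro i k
    have := finSuccEquiv_coeff_coeff k (map (Int.castRingHom ℝ) W) i
    rw [hWfac, Polynomial.coeff_mul_C, Polynomial.coeff_map, coeff_C_mul, coeff_map] at this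
    simpa using this.symm
  have hW0 : W ≠ 0 := by
    intro h0
    rw [h0, map_zero, map_zero, eq_comm, mul_eq_zero, Polynomial.C_eq_zero,
      Polynomial.map_eq_zero_iff (C_injective _ _)] at hWfac
    exact hWfac.elim hU hV
  have hWlog : Real.log (lOne W) ≤ h * (((m : ℝ) + 3) * ω * Λ) := by
    refine (log_lOne_det_hasse_le hP hdeg _ hW0).trans
      (mul_le_mul_of_nonneg_left ?_ hh'.le)
    have h1 : ∑ s, (r s : ℝ) ≤ ∑ s : Fin (m + 1), ω * Λ := Finset.sum_le_sum fun s _ => hrω s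
    simp at h1
    linarith [hrω 0]
  -- the part in the remaining variables
  obtain ⟨a₀, ha₀⟩ : ∃ i, U.coeff i ≠ 0 := by
    by_contra! h0
    exact hU (Polynomial.ext h0)
  obtain ⟨k₀, hk₀⟩ := exists_coeff_ne_zero hV
  have hVint : map (Int.castRingHom ℝ) ((finSuccEquiv ℤ m W).coeff a₀) = U.coeff a₀ • V := by
    ext k
    rw [coeff_map, finSuccEquiv_coeff_coeff, coeff_smul, smul_eq_mul, ← hcoef]
    simp
  have hVint0 : (finSuccEquiv ℤ m W).coeff a₀ ≠ 0 := by
    intro h0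
    rw [h0, map_zero, eq_comm, smul_eq_zero] at hVint
    exact hVint.elim ha₀ hV
  have hdegW : ∀ i, W.degreeOf i ≤ h * r i := fun i =>
    degreeOf_det_le _ _ fun _ _ => (degreeOf_hasse_le _ _ _).trans (hdeg i)
  obtain ⟨ν, hν, hνV⟩ := H (fun i => h * r i.succ) (fun i => a i.succ) (fun i => b i.succ)
    (h * Λ) ((finSuccEquiv ℤ m W).coeff a₀) (fun i => Nat.mul_pos hpos (hr _))
    (fun i j hij => by
      have := hrr i.succ j.succ (Fin.succ_lt_succ_iff.2 hij)
      push_cast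
      have h2 : (r i.succ : ℝ) ≤ ω' * r j.succ :=
        this.trans (mul_le_mul_of_nonneg_right hω5 (hr' _).le)
      nlinarith)
    (fun i => hab _) (fun i => hb _) (by positivity)
    (fun i => by
      push_cast
      rw [mul_assoc]
      exact mul_le_mul_of_nonneg_left (hΛr _) hh'.le)
    (fun i => by
      push_cast
      have h2 : (r i.succ : ℝ) ≤ ω' * Λ :=
        (hrω _).trans (mul_le_mul_of_nonneg_right hω5 hΛ.le)
      nlinarith)
    hVint0
    (fun i => (degreeOf_coeff_finSuccEquiv _ _ _).trans (hdegW _))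
    (by
      refine (Real.log_le_log (by linarith [one_le_lOne hVint0])
        (lOne_finSucc_coeff_le W a₀)).trans (hWlog.trans ?_)
      have : (m + 3) * ω * Λ ≤ ω' * Λ := mul_le_mul_of_nonneg_right hω2 hΛ.le
      nlinarith)
  rw [hVint, map_smul, smul_eval] at hνV
  have hνV' := right_ne_zero_of_mul hνV
  -- the part in the first variable
  obtain ⟨l, hl, hlT⟩ := exists_hasseDeriv_ne_zero
    (Q := ∑ i ∈ Finset.range ((finSuccEquiv ℤ m W).natDegree + 1),
      Polynomial.monomial i (coeff (k₀.cons i) W)) (hab 0) (hb 0) hk₀ hU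
    (by
      ext n
      rw [Polynomial.coeff_map, coeff_slice, Polynomial.coeff_C_mul, mul_comm, ← hcoef]
      simp) (T := lOne W)
    (fun n => by
      rw [coeff_slice, ← Int.norm_eq_abs]
      exact norm_coeff_le_lOne _ _)
  have hmax : (1 : ℝ) ≤ max |(a 0 : ℝ)| |(b 0 : ℝ)| :=
    le_max_of_le_right (by exact_mod_cast Int.one_le_abs (hb 0))
  have hl' : (l : ℝ) / r 0 ≤ h * (ε ^ 2 / 64) := by
    have h1 := Real.log_le_log (by positivity) hlT
    rw [Real.log_pow] at h1
    have h2 := h1.trans hWlog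
    have h3 : (l : ℝ) * Λ ≤ r 0 * (h * (((m : ℝ) + 3) * ω * Λ)) := by
      have := mul_le_mul_of_nonneg_left (hΛr 0) (Nat.cast_nonneg (α := ℝ) l)
      have h4 := mul_le_mul_of_nonneg_left h2 (hr' 0).le
      linarith
    have h5 : (l : ℝ) ≤ r 0 * (h * (((m : ℝ) + 3) * ω)) := by
      refine le_of_mul_le_mul_right ?_ hΛ
      linarith
    rw [div_le_iff₀ (hr' 0), mul_comm _ (r 0 : ℝ)]
    exact h5.trans (by gcongr)
  have hev := eval_cons_hasse hWfac l ν ζ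
  have hne : coeff (ν.cons l) (shift ζ (map (Int.castRingHom ℝ) W)) ≠ 0 := by
    rw [coeff_shift, hev]
    exact mul_ne_zero hl hνV'
  have hidx : HasIndex (fun i => 1 / (r i : ℝ)) ε (shift ζ Pr) := by
    intro κ hκ
    rw [coeff_shift] at hκ
    by_contra! hlt
    exact hκ (hcon κ (hlt.trans_le hεle))
  have hidxW : HasIndex (fun i => 1 / (r i : ℝ))
      (∑ j : Fin h, max 0 ((ε - ω) - (j : ℕ) / r 0)) (shift ζ (map (Int.castRingHom ℝ) W)) := by
    rw [hWmap, AlgHom.map_det]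
    refine HasIndex.det fun i j => ?_
    simp only [AlgHom.mapMatrix_apply, Matrix.map_apply, Matrix.of_apply]
    rcases le_total ((ε - ω) - (j : ℕ) / (r 0 : ℝ)) 0 with hle | hle
    · rw [max_eq_left hle]
      exact fun κ _ => Finset.sum_nonneg fun s _ => by positivity
    · rw [max_eq_right hle]
      refine (hidx.shift_hasse ((μ i).cons (j : ℕ))).mono ?_
      rw [Fin.sum_univ_succ]
      simp only [Finsupp.cons_zero, Finsupp.cons_succ]
      have h1 : ∀ s : Fin m, 1 / (r s.succ : ℝ) * (μ i s : ℝ) ≤ ω / r 0 * μ i s := by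
        intro s
        refine mul_le_mul_of_nonneg_right ?_ (by positivity)
        rw [div_le_div_iff₀ (hr' _) (hr' _), one_mul]
        exact hrr 0 s.succ (Fin.succ_pos s)
      have h2 := Finset.sum_le_sum fun s (_ : s ∈ Finset.univ) => h1 s
      rw [← Finset.mul_sum] at h2
      have h3 : ∑ s, (μ i s : ℝ) ≤ r 0 := by
        have := (hμ i).trans hh
        exact_mod_cast (Nat.le_of_succ_le_succ this)
      have h4 : ω / r 0 * ∑ s, (μ i s : ℝ) ≤ ω := by
        rw [div_mul_eq_mul_div, div_le_iff₀ (hr' 0)]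
        exact mul_le_mul_of_nonneg_left h3 hω0.le
      have h5 : 1 / (r 0 : ℝ) * (j : ℕ) = (j : ℕ) / r 0 := by ring
      linarith
  have hlower := hidxW _ hne
  have hcount := sum_max_ge (hr 0) hh (c := ε - ω) (by linarith) (by linarith)
  rw [Fin.sum_univ_succ] at hlower
  simp only [Finsupp.cons_zero, Finsupp.cons_succ] at hlower
  have hν2 : ∑ s : Fin m, 1 / (r s.succ : ℝ) * ν s < h * (ε ^ 2 / 64) := by
    rw [← div_lt_iff₀' hh', Finset.sum_div]
    refine lt_of_eq_of_lt (Finset.sum_congr rfl fun s _ => ?_) hν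
    push_cast
    field_simp
  have h6 : h * ε ^ 2 / 32 ≤ h * (ε - ω) ^ 2 / 8 := by
    have : ε / 2 ≤ ε - ω := by linarith
    have := pow_le_pow_left₀ (by positivity) this 2
    nlinarith
  have h7 : 1 / (r 0 : ℝ) * l = l / r 0 := by ring
  linarith

theorem roth (m : ℕ) : RothStatement m := by
  induction m with
  | zero => exact roth_zero
  | succ m ih => exact roth_succ ih

end RoyExt

namespace RoyExt

open Finset

/-- Pairs of exponents with sum at most `r`. -/
def tri (r : ℕ) : Finset (ℕ × ℕ) := (range (r + 1)).biUnion fun k => antidiagonal k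

lemma mem_tri {r : ℕ} {g : ℕ × ℕ} : g ∈ tri r ↔ g.1 + g.2 ≤ r := by
  simp [tri]

lemma sum_tri (r : ℕ) (f : ℕ → ℝ) :
    ∑ g ∈ tri r, f (g.1 + g.2) = ∑ k ∈ range (r + 1), ((k : ℝ) + 1) * f k := by
  rw [tri, Finset.sum_biUnion]
  · refine Finset.sum_congr rfl fun k _ => ?_
    rw [Finset.sum_congr rfl (g := fun _ => f k)]
    · simp
    · intro g hg
      rw [mem_antidiagonal.1 hg]
  · intro i _ j _ hij
    rw [Function.onFun, Finset.disjoint_left]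
    intro g hi hj
    exact hij ((mem_antidiagonal.1 hi).symm.trans (mem_antidiagonal.1 hj))

lemma card_tri (r : ℕ) : ((tri r).card : ℝ) = (r + 1) * (r + 2) / 2 := by
  have h := sum_tri r fun _ => 1
  simp only [sum_const, nsmul_eq_mul, mul_one] at h
  rw [h]
  induction r with
  | zero => simp
  | succ r ih =>
    rw [Finset.sum_range_succ, ih (by simpa using sum_tri r fun _ => 1)]
    push_cast
    ring

lemma card_tri_le (r : ℕ) : (tri r).card ≤ 4 ^ r := by
  have : (tri r).card ≤ (r + 1) * (r + 1) := by
    have h := card_tri r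
    have h2 : ((tri r).card : ℝ) ≤ (r + 1) * (r + 1) := by
      rw [h]
      nlinarith [(Nat.cast_nonneg r : (0 : ℝ) ≤ r)]
    exact_mod_cast h2
  refine this.trans ?_
  have h1 : r + 1 ≤ 2 ^ r := Nat.lt_two_pow_self
  calc (r + 1) * (r + 1) ≤ 2 ^ r * 2 ^ r := Nat.mul_le_mul h1 h1
    _ = 4 ^ r := by rw [← mul_pow]; norm_num

lemma sum_tri_weight (r : ℕ) :
    ∑ g ∈ tri r, (((g.1 + g.2 : ℕ) : ℝ)) = 2 / 3 * r * (tri r).card := by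
  rw [card_tri, sum_tri r fun k => (k : ℝ)]
  induction r with
  | zero => simp
  | succ r ih =>
    rw [Finset.sum_range_succ, ih]
    push_cast
    ring

lemma sum_tri_exp_le {r : ℕ} (hr : 0 < r) {t : ℝ} (ht0 : 0 ≤ t) (ht1 : t ≤ 1) :
    ∑ g ∈ tri r, Real.exp (-(t * (((g.1 + g.2 : ℕ) : ℝ) / r))) ≤
      (tri r).card * Real.exp (-(2 / 3 * t) + t ^ 2) := by
  have hr' : (0 : ℝ) < r := by exact_mod_cast hr
  have h1 : ∀ g ∈ tri r, Real.exp (-(t * (((g.1 + g.2 : ℕ) : ℝ) / r))) ≤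
      1 - t * (((g.1 + g.2 : ℕ) : ℝ) / r) + t ^ 2 := by
    intro g hg
    have hg' : ((g.1 + g.2 : ℕ) : ℝ) ≤ r := by exact_mod_cast mem_tri.1 hg
    set w := ((g.1 + g.2 : ℕ) : ℝ) / r with hw
    have hw0 : 0 ≤ w := by positivity
    have hw1 : w ≤ 1 := (div_le_one hr').2 hg'
    have hx0 : 0 ≤ t * w := mul_nonneg ht0 hw0
    have hx1 : t * w ≤ t := mul_le_of_le_one_right ht0 hw1
    have hb := (abs_le.1 (Real.abs_exp_sub_one_sub_id_le (x := -(t * w))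
      (by rw [abs_neg, abs_of_nonneg hx0]; linarith))).2
    nlinarith
  refine (Finset.sum_le_sum h1).trans ?_
  rw [Finset.sum_add_distrib, Finset.sum_sub_distrib, ← Finset.mul_sum, ← Finset.sum_div,
    sum_tri_weight]
  simp only [sum_const, nsmul_eq_mul, mul_one]
  have h2 := Real.add_one_le_exp (-(2 / 3 * t) + t ^ 2)
  have h3 : ((tri r).card : ℝ) - t * (2 / 3 * r * (tri r).card / r) + (tri r).card * t ^ 2 =
      (tri r).card * (-(2 / 3 * t) + t ^ 2 + 1) := by
    field_simp
    ring
  rw [h3]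
  exact mul_le_mul_of_nonneg_left h2 (by positivity)

/-- The multi-indices. -/
def box {m : ℕ} (r : Fin m → ℕ) : Finset (Fin m → ℕ × ℕ) := Fintype.piFinset fun l => tri (r l)

/-- The normalized weight of a multi-index. -/
noncomputable def wt {m : ℕ} (r : Fin m → ℕ) (g : Fin m → ℕ × ℕ) : ℝ :=
  ∑ l, ((((g l).1 + (g l).2 : ℕ) : ℝ) / r l)

lemma card_bad_le {m : ℕ} {r : Fin m → ℕ} (hr : ∀ l, 0 < r l) {δ : ℝ} (hδ0 : 0 ≤ δ) (hδ1 : δ ≤ 1) :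
    (((box r).filter fun g => wt r g < (2 / 3 - δ) * m).card : ℝ) ≤
      (box r).card * Real.exp (-(m * δ ^ 2 / 4)) := by
  have h1 : (((box r).filter fun g => wt r g < (2 / 3 - δ) * m).card : ℝ) ≤
      ∑ g ∈ box r, Real.exp (δ / 2 * ((2 / 3 - δ) * m - wt r g)) := by
    rw [Finset.card_eq_sum_ones, Nat.cast_sum]
    refine (Finset.sum_le_sum fun g hg => ?_).trans (Finset.sum_le_sum_of_subset_of_nonneg
      (Finset.filter_subset _ _) fun _ _ _ => (Real.exp_pos _).le)
    have := (Finset.mem_filter.1 hg).2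
    rw [Nat.cast_one]
    refine Real.one_le_exp ?_
    have : 0 ≤ (2 / 3 - δ) * m - wt r g := by linarith
    positivity
  refine h1.trans ?_
  have h2 : ∀ g ∈ box r, Real.exp (δ / 2 * ((2 / 3 - δ) * m - wt r g)) =
      Real.exp (δ / 2 * ((2 / 3 - δ) * m)) *
        ∏ l, Real.exp (-(δ / 2 * ((((g l).1 + (g l).2 : ℕ) : ℝ) / r l))) := by
    intro g _
    rw [← Real.exp_sum, ← Real.exp_add, Finset.sum_neg_distrib, ← Finset.mul_sum, wt]
    congr 1
    ring
  rw [Finset.sum_congr rfl h2, ← Finset.mul_sum, box, ← Finset.prod_univ_sum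
    (fun l => tri (r l)) fun l g => Real.exp (-(δ / 2 * (((g.1 + g.2 : ℕ) : ℝ) / r l)))]
  have h3 : ∏ l, ∑ g ∈ tri (r l), Real.exp (-(δ / 2 * (((g.1 + g.2 : ℕ) : ℝ) / r l))) ≤
      ∏ l, ((tri (r l)).card * Real.exp (-(2 / 3 * (δ / 2)) + (δ / 2) ^ 2)) :=
    Finset.prod_le_prod (fun l _ => Finset.sum_nonneg fun _ _ => (Real.exp_pos _).le)
      fun l _ => sum_tri_exp_le (hr l) (by linarith) (by linarith)
  refine (mul_le_mul_of_nonneg_left h3 (Real.exp_pos _).le).trans ?_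
  rw [Finset.prod_mul_distrib, Finset.prod_const, Fintype.card_piFinset, Nat.cast_prod,
    mul_left_comm, ← Real.exp_nat_mul, ← Real.exp_add]
  refine le_of_eq ?_
  congr 2
  simp
  ring

lemma card_box_le {m : ℕ} (r : Fin m → ℕ) : (box r).card ≤ 4 ^ ∑ l, r l := by
  rw [box, Fintype.card_piFinset, ← Finset.prod_pow_eq_pow_sum]
  exact Finset.prod_le_prod' fun l _ => card_tri_le _

end RoyExt

namespace RoyExt

open Finset

/-- Siegel's lemma with at least twice as many unknowns as equations. -/
lemma siegel {ι κ : Type*} [Fintype ι] [Fintype κ] (A : Matrix ι κ ℤ) (E : ℝ) (hE : 1 ≤ E)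
    (hκ : 0 < Fintype.card κ) (h : 2 * Fintype.card ι ≤ Fintype.card κ)
    (hA : ∀ i j, |(A i j : ℝ)| ≤ E) :
    ∃ t : κ → ℤ, t ≠ 0 ∧ A.mulVec t = 0 ∧ ∀ j, |(t j : ℝ)| ≤ Fintype.card κ * E := by
  classical
  have hκ1 : (1 : ℝ) ≤ Fintype.card κ := by exact_mod_cast hκ
  rcases Nat.eq_zero_or_pos (Fintype.card ι) with h0 | h0
  · obtain ⟨j0⟩ := Fintype.card_pos_iff.1 hκ
    refine ⟨fun _ => 1, fun hh => one_ne_zero (congrFun hh j0), ?_, fun j => ?_⟩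
    · ext i
      exact (Fintype.card_eq_zero_iff.1 h0).elim i
    · simp only [Int.cast_one, abs_one]
      nlinarith
  · obtain ⟨t, ht0, htA, ht⟩ := Int.Matrix.exists_ne_zero_int_vec_norm_le A (by omega) h0
    refine ⟨t, ht0, htA, fun j => ?_⟩
    have h1 := norm_le_pi_norm t j
    rw [Int.norm_eq_abs] at h1
    refine h1.trans (ht.trans ?_)
    have h2 : max 1 (@norm (Matrix ι κ ℤ) Matrix.seminormedAddCommGroup.toNorm A) ≤ E :=
      max_le hE ((Matrix.norm_le_iff (by linarith)).2 fun i j => by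
        rw [Int.norm_eq_abs]; exact hA i j)
    have h3 : (Fintype.card ι : ℝ) / (Fintype.card κ - Fintype.card ι) ≤ 1 := by
      have : (2 : ℝ) * Fintype.card ι ≤ Fintype.card κ := by exact_mod_cast h
      have h0' : (0 : ℝ) < Fintype.card ι := by exact_mod_cast h0
      rw [div_le_one (by linarith)]
      linarith
    have h4 : (1 : ℝ) ≤ Fintype.card κ *
        max 1 (@norm (Matrix ι κ ℤ) Matrix.seminormedAddCommGroup.toNorm A) :=
      one_le_mul_of_one_le_of_one_le hκ1 (le_max_left _ _)
    calc _ ≤ (Fintype.card κ *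
          max 1 (@norm (Matrix ι κ ℤ) Matrix.seminormedAddCommGroup.toNorm A)) ^ (1 : ℝ) :=
          Real.rpow_le_rpow_of_exponent_le h4 h3
      _ ≤ _ := by
        rw [Real.rpow_one]
        exact mul_le_mul_of_nonneg_left h2 (by positivity)

/-- `x` is an integer combination of the `B i` with coefficients at most `M`. -/
def IntComb {d : ℕ} (B : Fin d → ℝ) (M x : ℝ) : Prop :=
  ∃ c : Fin d → ℤ, x = ∑ i, (c i : ℝ) * B i ∧ ∀ i, |(c i : ℝ)| ≤ M

lemma IntComb.mono {d : ℕ} {B : Fin d → ℝ} {M M' x : ℝ} (h : IntComb B M x) (hM : M ≤ M') :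
    IntComb B M' x := by
  obtain ⟨c, hx, hc⟩ := h
  exact ⟨c, hx, fun i => (hc i).trans hM⟩

lemma IntComb.exists_mul {d : ℕ} {B : Fin d → ℝ} {θ : ℝ}
    (h : ∀ i, θ * B i ∈ Submodule.span ℤ (Set.range B)) :
    ∃ E : ℝ, 1 ≤ E ∧ ∀ M x, IntComb B M x → IntComb B (E * M) (θ * x) := by
  simp only [Submodule.mem_span_range_iff_exists_fun] at h
  choose a ha using h
  refine ⟨1 + ∑ i, ∑ j, |(a i j : ℝ)|, by
    have : 0 ≤ ∑ i, ∑ j, |(a i j : ℝ)| := by positivity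
    linarith, ?_⟩
  rintro M x ⟨c, rfl, hc⟩
  refine ⟨fun j => ∑ i, c i * a i j, ?_, fun j => ?_⟩
  · rw [Finset.mul_sum]
    push_cast
    simp only [Finset.sum_mul]
    rw [Finset.sum_comm]
    refine Finset.sum_congr rfl fun i _ => ?_
    rw [mul_left_comm, ← ha i, Finset.mul_sum]
    refine Finset.sum_congr rfl fun j _ => ?_
    rw [zsmul_eq_mul]
    ring
  · push_cast
    have hM : 0 ≤ M := (abs_nonneg _).trans (hc j)
    calc |∑ i, (c i : ℝ) * a i j| ≤ ∑ i, |(c i : ℝ) * a i j| := Finset.abs_sum_le_sum_abs _ _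
      _ ≤ ∑ i, M * ∑ j, |(a i j : ℝ)| := by
        refine Finset.sum_le_sum fun i _ => ?_
        rw [abs_mul]
        exact mul_le_mul (hc i) (Finset.single_le_sum (f := fun j => |(a i j : ℝ)|)
          (fun _ _ => abs_nonneg _) (Finset.mem_univ j)) (abs_nonneg _) hM
      _ ≤ _ := by
        rw [← Finset.mul_sum]
        nlinarith

lemma IntComb.pow_mul {d : ℕ} {B : Fin d → ℝ} {θ E : ℝ}
    (h : ∀ M x, IntComb B M x → IntComb B (E * M) (θ * x)) {M x : ℝ} (hx : IntComb B M x) (e : ℕ) :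
    IntComb B (E ^ e * M) (θ ^ e * x) := by
  induction e with
  | zero => simpa using hx
  | succ e ih => simpa [pow_succ', mul_assoc] using h _ _ ih

lemma exists_intComb {α β : ℝ} (hα : IsAlgebraic ℚ α) (hβ : IsAlgebraic ℚ β) :
    ∃ (d : ℕ) (D : ℤ) (B : Fin d → ℝ) (E : ℝ), D ≠ 0 ∧ 1 ≤ E ∧
      ∀ e f S : ℕ, e + f ≤ S → IntComb B (E ^ (S + 1)) ((D : ℝ) ^ S * (α ^ e * β ^ f)) := by
  have hα' : IsAlgebraic ℤ α := (IsFractionRing.isAlgebraic_iff ℤ ℚ ℝ).2 hα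
  have hβ' : IsAlgebraic ℤ β := (IsFractionRing.isAlgebraic_iff ℤ ℚ ℝ).2 hβ
  obtain ⟨a, ha0, ha⟩ := hα'.exists_integral_multiple
  obtain ⟨b, hb0, hb⟩ := hβ'.exists_integral_multiple
  have hfg := fg_adjoin_of_finite (R := ℤ) (A := ℝ) (s := {b * (a • α), a * (b • β)})
    (by simp) (by
      intro x hx
      rcases hx with rfl | rfl
      · exact (isIntegral_algebraMap (x := b)).mul ha
      · exact (isIntegral_algebraMap (x := a)).mul hb)
  set R := Algebra.adjoin ℤ ({(b : ℝ) * (a • α), (a : ℝ) * (b • β)} : Set ℝ) with hR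
  obtain ⟨d, B, hB⟩ := Submodule.fg_iff_exists_fin_generating_family.1 hfg
  have hBR : ∀ i, B i ∈ R := fun i => by
    have : B i ∈ Submodule.span ℤ (Set.range B) := Submodule.subset_span ⟨i, rfl⟩
    rwa [hB] at this
  have hmul : ∀ θ ∈ R, ∀ i, θ * B i ∈ Submodule.span ℤ (Set.range B) := fun θ hθ i => by
    rw [hB]
    exact R.mul_mem hθ (hBR i)
  obtain ⟨E1, hE1, h1⟩ := IntComb.exists_mul (hmul _ (Algebra.subset_adjoin (Set.mem_insert _ _)))
  obtain ⟨E2, hE2, h2⟩ := IntComb.exists_mul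
    (hmul _ (Algebra.subset_adjoin (Set.mem_insert_of_mem _ rfl)))
  obtain ⟨E3, hE3, h3⟩ := IntComb.exists_mul (hmul ((a * b : ℤ) : ℝ) (R.intCast_mem _))
  have hone : ∃ M, 1 ≤ M ∧ IntComb B M 1 := by
    have : (1 : ℝ) ∈ Submodule.span ℤ (Set.range B) := by rw [hB]; exact R.one_mem
    obtain ⟨c, hc⟩ := (Submodule.mem_span_range_iff_exists_fun ℤ).1 this
    refine ⟨1 + ∑ i, |(c i : ℝ)|, ?_, c, ?_, fun i => ?_⟩
    · have : 0 ≤ ∑ i, |(c i : ℝ)| := by positivity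
      linarith
    · simpa [zsmul_eq_mul] using hc.symm
    · have := Finset.single_le_sum (f := fun j => |(c j : ℝ)|)
        (fun _ _ => abs_nonneg _) (Finset.mem_univ i)
      linarith
  obtain ⟨M, hM, hone⟩ := hone
  set E := E1 * E2 * E3 * M with hE
  have h12 : 1 ≤ E1 * E2 := one_le_mul_of_one_le_of_one_le hE1 hE2
  have h123 : 1 ≤ E1 * E2 * E3 := one_le_mul_of_one_le_of_one_le h12 hE3
  have hEE : 1 ≤ E := one_le_mul_of_one_le_of_one_le h123 hM
  refine ⟨d, a * b, B, E, mul_ne_zero ha0 hb0, hEE, fun e f S hS => ?_⟩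
  have key := IntComb.pow_mul h3 (IntComb.pow_mul h1 (IntComb.pow_mul h2 hone f) e) (S - (e + f))
  have e1 : ((a * b : ℤ) : ℝ) ^ (S - (e + f)) * ((b * a • α) ^ e * ((a * b • β) ^ f * 1)) =
      ((a * b : ℤ) : ℝ) ^ S * (α ^ e * β ^ f) := by
    conv_rhs => rw [← Nat.sub_add_cancel hS, pow_add, pow_add]
    simp only [zsmul_eq_mul]
    push_cast
    ring
  rw [e1] at key
  refine key.mono ?_
  have g1 : E1 ^ e ≤ (E1 * E2) ^ e :=
    pow_le_pow_left₀ (by linarith) (le_mul_of_one_le_right (by linarith) hE2) _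
  have g2 : E2 ^ f ≤ (E1 * E2) ^ f :=
    pow_le_pow_left₀ (by linarith) (le_mul_of_one_le_left (by linarith) hE1) _
  have g3 : E3 ^ (S - (e + f)) ≤ E3 ^ S := pow_le_pow_right₀ hE3 (by omega)
  have g4 : (E1 * E2) ^ (e + f) ≤ (E1 * E2) ^ S := pow_le_pow_right₀ h12 hS
  calc E3 ^ (S - (e + f)) * (E1 ^ e * (E2 ^ f * M))
      ≤ E3 ^ S * ((E1 * E2) ^ e * ((E1 * E2) ^ f * M)) := by gcongr
    _ = E3 ^ S * ((E1 * E2) ^ (e + f) * M) := by rw [pow_add]; ring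
    _ ≤ E3 ^ S * ((E1 * E2) ^ S * M) := by gcongr
    _ = (E1 * E2 * E3) ^ S * M := by rw [mul_pow (E1 * E2)]; ring
    _ ≤ E ^ S * E := by
      gcongr
      · exact le_mul_of_one_le_right (by linarith) hM
      · exact le_mul_of_one_le_left (by linarith) h123
    _ = E ^ (S + 1) := (pow_succ _ _).symm

/-- The Taylor coefficient, indexed by `g`, of the form with coefficients `p`. -/
noncomputable def taylorCoeff {m : ℕ} (α β : ℝ) (r : Fin m → ℕ) (p : (Fin m → ℕ × ℕ) → ℤ)
    (g : Fin m → ℕ × ℕ) : ℝ :=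
  ∑ n ∈ box r, (p n : ℝ) * ∏ l, ((((n l).1.choose (g l).1 * (n l).2.choose (g l).2 : ℕ) : ℝ) *
    (α ^ ((n l).1 - (g l).1) * β ^ ((n l).2 - (g l).2)))

lemma exists_auxiliary {α β : ℝ} (hα : IsAlgebraic ℚ α) (hβ : IsAlgebraic ℚ β) :
    ∃ (d : ℕ) (E : ℝ), 1 ≤ E ∧ ∀ (m : ℕ) (δ : ℝ) (r : Fin m → ℕ), (∀ l, 0 < r l) → 0 ≤ δ → δ ≤ 1 →
      2 * d * Real.exp (-(m * δ ^ 2 / 4)) ≤ 1 →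
      ∃ p : (Fin m → ℕ × ℕ) → ℤ, (∃ n ∈ box r, p n ≠ 0) ∧
        (∀ n ∈ box r, |(p n : ℝ)| ≤ E ^ (∑ l, r l + 1)) ∧
        ∀ g ∈ box r, wt r g < (2 / 3 - δ) * m → taylorCoeff α β r p g = 0 := by
  classical
  obtain ⟨d, D, B, E, hD, hE, hB⟩ := exists_intComb hα hβ
  choose! c hc hcE using hB
  refine ⟨d, 8 * E, by linarith, fun m δ r hr hδ0 hδ1 hm => ?_⟩
  set S := ∑ l, r l with hS
  set bad := (box r).filter fun g => wt r g < (2 / 3 - δ) * m with hbad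
  have hsum : ∀ n ∈ box r, ∀ g : Fin m → ℕ × ℕ,
      ∑ l, ((n l).1 - (g l).1) + ∑ l, ((n l).2 - (g l).2) ≤ S := fun n hn g => by
    rw [← Finset.sum_add_distrib]
    refine Finset.sum_le_sum fun l _ => ?_
    have := mem_tri.1 (Fintype.mem_piFinset.1 hn l)
    omega
  let A : Matrix (Fin d × bad) (box r) ℤ := fun ig n =>
    (∏ l, ((n.1 l).1.choose (ig.2.1 l).1 * (n.1 l).2.choose (ig.2.1 l).2 : ℕ) : ℕ) *
      c (∑ l, ((n.1 l).1 - (ig.2.1 l).1)) (∑ l, ((n.1 l).2 - (ig.2.1 l).2)) S ig.1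
  have hbox : (0 : ℝ) < (box r).card := by
    have : (fun _ => (0, 0)) ∈ box r := Fintype.mem_piFinset.2 fun l => mem_tri.2 (by simp)
    exact_mod_cast Finset.card_pos.2 ⟨_, this⟩
  have hcard : 2 * (d * bad.card) ≤ (box r).card := by
    have h1 := card_bad_le hr hδ0 hδ1
    have h2 : (2 : ℝ) * (d * bad.card) ≤ (box r).card := by
      calc (2 : ℝ) * (d * bad.card) ≤
          2 * (d * ((box r).card * Real.exp (-(m * δ ^ 2 / 4)))) := by gcongr
        _ = (box r).card * (2 * d * Real.exp (-(m * δ ^ 2 / 4))) := by ring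
        _ ≤ (box r).card * 1 := by gcongr
        _ = _ := mul_one _
    exact_mod_cast h2
  obtain ⟨t, ht0, htA, htE⟩ := siegel A (2 ^ S * E ^ (S + 1))
    (one_le_mul_of_one_le_of_one_le (one_le_pow₀ (by norm_num)) (one_le_pow₀ hE))
    (by simpa using hbox) (by simpa using hcard) (by
      rintro ⟨i, g⟩ ⟨n, hn⟩
      simp only [A, Int.cast_mul, abs_mul]
      refine mul_le_mul ?_ (hcE _ _ _ (hsum n hn _) _) (abs_nonneg _) (by positivity)
      rw [Int.cast_natCast, abs_of_nonneg (by positivity)]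
      have : (∏ l, ((n l).1.choose (g.1 l).1 * (n l).2.choose (g.1 l).2 : ℕ) : ℕ) ≤ 2 ^ S := by
        rw [hS, ← Finset.prod_pow_eq_pow_sum]
        refine Finset.prod_le_prod' fun l _ => ?_
        calc _ ≤ 2 ^ (n l).1 * 2 ^ (n l).2 :=
              Nat.mul_le_mul (Nat.choose_le_two_pow _ _) (Nat.choose_le_two_pow _ _)
          _ = 2 ^ ((n l).1 + (n l).2) := (pow_add _ _ _).symm
          _ ≤ 2 ^ r l := Nat.pow_le_pow_right (by norm_num)
              (mem_tri.1 (Fintype.mem_piFinset.1 hn l))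
      exact_mod_cast this)
  refine ⟨fun n => if hn : n ∈ box r then t ⟨n, hn⟩ else 0, ?_, fun n hn => ?_, fun g hg hwt => ?_⟩
  · obtain ⟨⟨n, hn⟩, hne⟩ := Function.ne_iff.1 ht0
    exact ⟨n, hn, by simpa [hn] using hne⟩
  · simp only [hn, dif_pos]
    refine (htE ⟨n, hn⟩).trans ?_
    have h4 : ((box r).card : ℝ) ≤ 4 ^ S := by exact_mod_cast card_box_le r
    rw [Fintype.card_coe]
    calc ((box r).card : ℝ) * (2 ^ S * E ^ (S + 1)) ≤ 4 ^ S * (2 ^ S * E ^ (S + 1)) := by gcongr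
      _ = 8 ^ S * E ^ (S + 1) := by rw [← mul_assoc, ← mul_pow]; norm_num
      _ ≤ 8 ^ (S + 1) * E ^ (S + 1) := by
        gcongr
        · norm_num
        · omega
      _ = _ := (mul_pow _ _ _).symm
  · have hgb : g ∈ bad := Finset.mem_filter.2 ⟨hg, hwt⟩
    have hD' : (D : ℝ) ^ S ≠ 0 := pow_ne_zero _ (by exact_mod_cast hD)
    refine (mul_eq_zero.1 (?_ : (D : ℝ) ^ S * _ = 0)).resolve_left hD'
    rw [taylorCoeff, ← Finset.sum_coe_sort, Finset.mul_sum]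
    have key : ∀ n : box r, (D : ℝ) ^ S * (((if hn : n.1 ∈ box r then t ⟨n.1, hn⟩ else 0 : ℤ) : ℝ) *
        ∏ l, ((((n.1 l).1.choose (g l).1 * (n.1 l).2.choose (g l).2 : ℕ) : ℝ) *
        (α ^ ((n.1 l).1 - (g l).1) * β ^ ((n.1 l).2 - (g l).2)))) =
        ∑ i, ((A (i, ⟨g, hgb⟩) n * t n : ℤ) : ℝ) * B i := fun n => by
      rw [dif_pos n.2, Finset.prod_mul_distrib, Finset.prod_mul_distrib, Finset.prod_pow_eq_pow_sum,
        Finset.prod_pow_eq_pow_sum]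
      have h1 := hc _ _ _ (hsum n.1 n.2 g)
      calc _ = (t n : ℝ) * (∏ l, (((n.1 l).1.choose (g l).1 * (n.1 l).2.choose (g l).2 : ℕ) : ℝ)) *
            ((D : ℝ) ^ S * (α ^ (∑ l, ((n.1 l).1 - (g l).1)) *
              β ^ (∑ l, ((n.1 l).2 - (g l).2)))) := by ring
        _ = _ := by
          rw [h1, Finset.mul_sum]
          refine Finset.sum_congr rfl fun i _ => ?_
          simp only [A]
          push_cast
          ring
    rw [Finset.sum_congr rfl fun n _ => key n, Finset.sum_comm]
    refine Finset.sum_eq_zero fun i _ => ?_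
    rw [← Finset.sum_mul]
    have := congrFun htA (i, ⟨g, hgb⟩)
    rw [Matrix.mulVec, dotProduct] at this
    rw [← Int.cast_sum, this]
    simp

end RoyExt

namespace RoyExt

open Finset MvPolynomial

section Taylor

variable {R : Type*} [CommRing R]

lemma choose_mul_add_pow (a x c : R) (n I : ℕ) :
    (n.choose I : R) * (a * x + c) ^ (n - I) =
      ∑ g ∈ range (n + 1), (n.choose g : R) * a ^ (n - g) * (g.choose I) * x ^ (n - g) *
        c ^ (g - I) := by
  rcases lt_or_ge n I with h | h
  · rw [Nat.choose_eq_zero_of_lt h, Nat.cast_zero, zero_mul]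
    refine (Finset.sum_eq_zero fun g hg => ?_).symm
    rw [Nat.choose_eq_zero_of_lt (n := g) (by have := mem_range.1 hg; omega)]
    simp
  · obtain ⟨k, rfl⟩ := Nat.exists_eq_add_of_le h
    rw [add_assoc, Finset.sum_range_add, Finset.sum_eq_zero (s := range I), zero_add,
      Nat.add_sub_cancel_left, add_comm (a * x), add_pow, Finset.mul_sum]
    · refine Finset.sum_congr rfl fun j hj => ?_
      have h1 : (I + k).choose (I + j) * (I + j).choose I = (I + k).choose I * k.choose j := by
        have := Nat.choose_mul (n := I + k) (k := I + j) (s := I) (by omega)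
        simpa using this
      have h2 : ((I + k).choose (I + j) : R) * (I + j).choose I = (I + k).choose I * k.choose j := by
        exact_mod_cast congrArg (Nat.cast (R := R)) h1
      rw [Nat.add_sub_add_left, Nat.add_sub_cancel_left, mul_pow]
      linear_combination -(a ^ (k - j) * x ^ (k - j) * c ^ j) * h2
    · intro g hg
      rw [Nat.choose_eq_zero_of_lt (n := g) (mem_range.1 hg)]
      simp

lemma taylor_single (a b x y c : R) {r I : ℕ} {n : ℕ × ℕ} (hn : n ∈ tri r) :
    (n.2.choose I : R) * x ^ (r - n.1 - n.2) * (a * x + y) ^ n.1 * (b * x + c) ^ (n.2 - I) =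
      ∑ g ∈ tri r, (((n.1.choose g.1 * n.2.choose g.2 : ℕ) : R) *
        (a ^ (n.1 - g.1) * b ^ (n.2 - g.2))) *
        ((g.2.choose I : R) * x ^ (r - g.1 - g.2) * y ^ g.1 * c ^ (g.2 - I)) := by
  have hn' := mem_tri.1 hn
  have h1 := choose_mul_add_pow a x y n.1 0
  have h2 := choose_mul_add_pow b x c n.2 I
  rw [Nat.choose_zero_right, Nat.cast_one, one_mul, Nat.sub_zero] at h1
  rw [← Finset.sum_subset (s₁ := range (n.1 + 1) ×ˢ range (n.2 + 1))]
  · calc _ = x ^ (r - n.1 - n.2) * ((a * x + y) ^ n.1 *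
          ((n.2.choose I : R) * (b * x + c) ^ (n.2 - I))) := by ring
      _ = _ := by
        rw [h1, h2, Finset.sum_mul_sum, Finset.sum_product, Finset.mul_sum]
        refine Finset.sum_congr rfl fun g hg => ?_
        rw [Finset.mul_sum]
        refine Finset.sum_congr rfl fun g' hg' => ?_
        have hg1 := mem_range.1 hg
        have hg2 := mem_range.1 hg'
        dsimp only
        rw [show r - g - g' = (r - n.1 - n.2) + (n.1 - g) + (n.2 - g') by omega, pow_add, pow_add]
        simp only [Nat.choose_zero_right, Nat.sub_zero]
        push_cast
        ring
  · intro g hg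
    rw [mem_product, mem_range, mem_range] at hg
    exact mem_tri.2 (by omega)
  · intro g _ hg
    rw [mem_product, mem_range, mem_range] at hg
    rcases lt_or_ge n.1 g.1 with h | h
    · simp [Nat.choose_eq_zero_of_lt h]
    · rw [Nat.choose_eq_zero_of_lt (n := n.2) (k := g.2) (by omega)]
      simp

variable {m : ℕ}

/-- The multihomogeneous form with coefficients `p`, differentiated `I` times in the third
variables. -/
def blockForm (r I : Fin m → ℕ) (p : (Fin m → ℕ × ℕ) → ℤ) (x y w : Fin m → R) : R :=
  ∑ n ∈ box r, (p n : R) * ∏ l, (((n l).2.choose (I l) : R) * x l ^ (r l - (n l).1 - (n l).2) *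
    y l ^ (n l).1 * w l ^ ((n l).2 - I l))

lemma map_blockForm {S : Type*} [CommRing S] (f : R →+* S) (r I : Fin m → ℕ)
    (p : (Fin m → ℕ × ℕ) → ℤ) (x y w : Fin m → R) :
    f (blockForm r I p x y w) =
      blockForm r I p (fun l => f (x l)) (fun l => f (y l)) fun l => f (w l) := by
  simp [blockForm]

lemma blockForm_eq_taylor (f : ℝ →+* R) (α β : ℝ) (r I : Fin m → ℕ) (p : (Fin m → ℕ × ℕ) → ℤ)
    (x y w : Fin m → R) :
    blockForm r I p x (fun l => f α * x l + y l) (fun l => f β * x l + w l) =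
      ∑ g ∈ box r, f (taylorCoeff α β r p g) * ∏ l, (((g l).2.choose (I l) : R) *
        x l ^ (r l - (g l).1 - (g l).2) * y l ^ (g l).1 * w l ^ ((g l).2 - I l)) := by
  simp only [blockForm, taylorCoeff, map_sum, Finset.sum_mul]
  rw [Finset.sum_comm]
  refine Finset.sum_congr rfl fun n hn => ?_
  rw [Finset.prod_congr rfl fun l _ => taylor_single (f α) (f β) (x l) (y l) (w l)
    (Fintype.mem_piFinset.1 hn l), Finset.prod_univ_sum, Finset.mul_sum]
  refine Finset.sum_congr rfl fun g _ => ?_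
  rw [Finset.prod_mul_distrib]
  simp only [map_mul, map_prod, map_pow, map_intCast, map_natCast]
  ring

end Taylor

lemma abs_taylorCoeff_le {m : ℕ} {α β A E : ℝ} (hA : 1 ≤ A) (hα : |α| ≤ A) (hβ : |β| ≤ A)
    {r : Fin m → ℕ} {p : (Fin m → ℕ × ℕ) → ℤ} (hp : ∀ n ∈ box r, |(p n : ℝ)| ≤ E)
    (g : Fin m → ℕ × ℕ) : |taylorCoeff α β r p g| ≤ E * (8 * A) ^ ∑ l, r l := by
  have hprod : ∀ n ∈ box r, |∏ l, ((((n l).1.choose (g l).1 * (n l).2.choose (g l).2 : ℕ) : ℝ) *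
      (α ^ ((n l).1 - (g l).1) * β ^ ((n l).2 - (g l).2)))| ≤ (2 * A) ^ ∑ l, r l := by
    intro n hn
    rw [Finset.abs_prod, ← Finset.prod_pow_eq_pow_sum]
    refine Finset.prod_le_prod (fun _ _ => abs_nonneg _) fun l _ => ?_
    have hl := mem_tri.1 (Fintype.mem_piFinset.1 hn l)
    rw [abs_mul, abs_mul, abs_pow, abs_pow, Nat.abs_cast, mul_pow]
    have h1 : (n l).1.choose (g l).1 * (n l).2.choose (g l).2 ≤ 2 ^ r l :=
      calc _ ≤ 2 ^ (n l).1 * 2 ^ (n l).2 :=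
            Nat.mul_le_mul (Nat.choose_le_two_pow _ _) (Nat.choose_le_two_pow _ _)
        _ = 2 ^ ((n l).1 + (n l).2) := (pow_add _ _ _).symm
        _ ≤ 2 ^ r l := Nat.pow_le_pow_right (by norm_num) hl
    have h2 : |α| ^ ((n l).1 - (g l).1) * |β| ^ ((n l).2 - (g l).2) ≤ A ^ r l :=
      calc _ ≤ A ^ ((n l).1 - (g l).1) * A ^ ((n l).2 - (g l).2) := by gcongr
        _ = A ^ (((n l).1 - (g l).1) + ((n l).2 - (g l).2)) := (pow_add _ _ _).symm
        _ ≤ A ^ r l := pow_le_pow_right₀ hA (by omega)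
    exact mul_le_mul (by exact_mod_cast h1) h2 (by positivity) (by positivity)
  calc |taylorCoeff α β r p g| ≤ ∑ n ∈ box r, E * (2 * A) ^ ∑ l, r l := by
        refine (Finset.abs_sum_le_sum_abs _ _).trans (Finset.sum_le_sum fun n hn => ?_)
        rw [abs_mul]
        exact mul_le_mul (hp n hn) (hprod n hn) (abs_nonneg _) ((abs_nonneg _).trans (hp n hn))
    _ = (box r).card * (E * (2 * A) ^ ∑ l, r l) := by rw [sum_const, nsmul_eq_mul]
    _ ≤ 4 ^ (∑ l, r l) * (E * (2 * A) ^ ∑ l, r l) := by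
        rcases (box r).eq_empty_or_nonempty with h | ⟨n, hn⟩
        · exact absurd h (Finset.Nonempty.ne_empty
            ⟨fun _ => (0, 0), Fintype.mem_piFinset.2 fun l => mem_tri.2 (by simp)⟩)
        · have : 0 ≤ E := (abs_nonneg _).trans (hp n hn)
          have h4 : ((box r).card : ℝ) ≤ 4 ^ ∑ l, r l := by exact_mod_cast card_box_le r
          gcongr
    _ = _ := by
        rw [mul_left_comm, ← mul_pow]
        ring_nf

open scoped goldenRatio

lemma lOne_blockForm_le {m : ℕ} {σ : Type*} {α β A E K T w0 : ℝ} (hA : 1 ≤ A) (hα : |α| ≤ A)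
    (hβ : |β| ≤ A) (hK : 0 ≤ K) (hE : 0 ≤ E) {r I : Fin m → ℕ} {p : (Fin m → ℕ × ℕ) → ℤ}
    (hp : ∀ n ∈ box r, |(p n : ℝ)| ≤ E)
    (hbad : ∀ g ∈ box r, wt r g < w0 → taylorCoeff α β r p g = 0)
    {z : Fin m → ℝ} {x y w : Fin m → MvPolynomial σ ℝ}
    (hx : ∀ l, lOne (x l) ≤ Real.exp (φ * z l + K)) (hy : ∀ l, lOne (y l) ≤ Real.exp (-z l + K))
    (hw : ∀ l, lOne (w l) ≤ Real.exp (-z l + K))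
    (hT : ∀ g ∈ box r, w0 ≤ wt r g → ∑ l, z l * (φ * r l - (φ + 1) * ((g l).1 + (g l).2 : ℕ) + I l)
      ≤ T) :
    lOne (blockForm r I p x (fun l => C α * x l + y l) (fun l => C β * x l + w l)) ≤
      E * (64 * A * Real.exp K) ^ (∑ l, r l) * Real.exp T := by
  set S := ∑ l, r l with hS
  rw [blockForm_eq_taylor C α β r I p]
  have hterm : ∀ g ∈ box r, lOne (C (taylorCoeff α β r p g) *
      ∏ l, (((g l).2.choose (I l) : MvPolynomial σ ℝ) *
        x l ^ (r l - (g l).1 - (g l).2) * y l ^ (g l).1 * w l ^ ((g l).2 - I l))) ≤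
      (E * (8 * A) ^ S) * ((2 * Real.exp K) ^ S * Real.exp T) := by
    intro g hg
    have hnn : 0 ≤ (E * (8 * A) ^ S) * ((2 * Real.exp K) ^ S * Real.exp T) := by positivity
    rcases lt_or_ge (wt r g) w0 with h0 | h0
    · rw [hbad g hg h0, C_0, zero_mul, lOne_zero]
      exact hnn
    by_cases hI : ∀ l, I l ≤ (g l).2
    · refine (lOne_mul_le _ _).trans (mul_le_mul ?_ ?_ (lOne_nonneg _) (by positivity))
      · rw [lOne_C, Real.norm_eq_abs]
        exact abs_taylorCoeff_le hA hα hβ hp g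
      · refine (lOne_prod_le _ _).trans ?_
        have hl : ∀ l, lOne (((g l).2.choose (I l) : MvPolynomial σ ℝ) *
            x l ^ (r l - (g l).1 - (g l).2) * y l ^ (g l).1 * w l ^ ((g l).2 - I l)) ≤
            (2 * Real.exp K) ^ r l *
              Real.exp (z l * (φ * r l - (φ + 1) * ((g l).1 + (g l).2 : ℕ) + I l)) := by
          intro l
          have hgl := mem_tri.1 (Fintype.mem_piFinset.1 hg l)
          have hIl := hI l
          have e1 : lOne ((g l).2.choose (I l) : MvPolynomial σ ℝ) ≤ 2 ^ r l := by
            rw [← map_natCast C, lOne_C, Real.norm_natCast]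
            have : (g l).2.choose (I l) ≤ 2 ^ r l :=
              (Nat.choose_le_two_pow _ _).trans (Nat.pow_le_pow_right (by norm_num) (by omega))
            exact_mod_cast this
          have hpw : ∀ (q : MvPolynomial σ ℝ) (a : ℝ) (k : ℕ), lOne q ≤ Real.exp a →
              lOne (q ^ k) ≤ Real.exp (k * a) := fun q a k h => by
            rw [Real.exp_nat_mul]
            exact (lOne_pow_le _ _).trans (pow_le_pow_left₀ (lOne_nonneg _) h _)
          have e2 := hpw _ _ (r l - (g l).1 - (g l).2) (hx l)
          have e3 := hpw _ _ (g l).1 (hy l)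
          have e4 := hpw _ _ ((g l).2 - I l) (hw l)
          calc _ ≤ lOne ((g l).2.choose (I l) : MvPolynomial σ ℝ) *
                lOne (x l ^ (r l - (g l).1 - (g l).2)) * lOne (y l ^ (g l).1) *
                lOne (w l ^ ((g l).2 - I l)) := by
                refine (lOne_mul_le _ _).trans (mul_le_mul_of_nonneg_right ?_ (lOne_nonneg _))
                refine (lOne_mul_le _ _).trans (mul_le_mul_of_nonneg_right ?_ (lOne_nonneg _))
                exact lOne_mul_le _ _
            _ ≤ 2 ^ r l * Real.exp ((r l - (g l).1 - (g l).2 : ℕ) * (φ * z l + K)) *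
                Real.exp ((g l).1 * (-z l + K)) * Real.exp (((g l).2 - I l : ℕ) * (-z l + K)) := by
                have n1 := lOne_nonneg ((g l).2.choose (I l) : MvPolynomial σ ℝ)
                have n2 := lOne_nonneg (x l ^ (r l - (g l).1 - (g l).2))
                have n3 := lOne_nonneg (y l ^ (g l).1)
                gcongr
                exact lOne_nonneg _
            _ ≤ _ := by
                rw [mul_pow, ← Real.exp_nat_mul]
                simp only [mul_assoc, ← Real.exp_add]
                refine mul_le_mul_of_nonneg_left (Real.exp_le_exp.2 ?_) (by positivity)
                rw [Nat.sub_sub, Nat.cast_sub hgl, Nat.cast_sub hIl]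
                push_cast
                have : (0 : ℝ) ≤ I l * K := by positivity
                nlinarith
        refine (Finset.prod_le_prod (fun _ _ => lOne_nonneg _) fun l _ => hl l).trans ?_
        rw [Finset.prod_mul_distrib, Finset.prod_pow_eq_pow_sum, ← Real.exp_sum]
        gcongr
        exact hT g hg h0
    · push Not at hI
      obtain ⟨l, hl⟩ := hI
      rw [Finset.prod_eq_zero (Finset.mem_univ l), mul_zero, lOne_zero]
      · exact hnn
      · rw [Nat.choose_eq_zero_of_lt hl]
        simp
  refine (lOne_sum_le _ _).trans ((Finset.sum_le_sum hterm).trans ?_)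
  rw [sum_const, nsmul_eq_mul]
  have h4 : ((box r).card : ℝ) ≤ 4 ^ S := by exact_mod_cast card_box_le r
  calc _ ≤ 4 ^ S * ((E * (8 * A) ^ S) * ((2 * Real.exp K) ^ S * Real.exp T)) := by gcongr
    _ = E * (4 ^ S * (8 * A) ^ S * (2 * Real.exp K) ^ S) * Real.exp T := by ring
    _ = _ := by
      rw [← mul_pow, ← mul_pow]
      ring_nf

/-- An integer vector tuple whose forms are small makes an integral multihomogeneous form vanish
identically on the planes spanned by the vectors. -/
lemma blockForm_eq_zero {m : ℕ} {α β A E K T w0 : ℝ} (hA : 1 ≤ A) (hα : |α| ≤ A)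
    (hβ : |β| ≤ A) (hK : 0 ≤ K) (hE : 0 ≤ E) {r I : Fin m → ℕ} {p : (Fin m → ℕ × ℕ) → ℤ}
    (hp : ∀ n ∈ box r, |(p n : ℝ)| ≤ E)
    (hbad : ∀ g ∈ box r, wt r g < w0 → taylorCoeff α β r p g = 0)
    {z : Fin m → ℝ} {y : Fin 2 → Fin 3 → Fin m → ℤ}
    (h0 : ∀ k l, |(y k 0 l : ℝ)| ≤ Real.exp (φ * z l + K))
    (h1 : ∀ k l, |(y k 1 l : ℝ) - α * y k 0 l| ≤ Real.exp (-z l + K))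
    (h2 : ∀ k l, |(y k 2 l : ℝ) - β * y k 0 l| ≤ Real.exp (-z l + K))
    (hT : ∀ g ∈ box r, w0 ≤ wt r g → ∑ l, z l * (φ * r l - (φ + 1) * ((g l).1 + (g l).2 : ℕ) + I l)
      ≤ T)
    (hsmall : E * (64 * A * Real.exp (K + Real.log 2)) ^ (∑ l, r l) * Real.exp T < 1)
    (u v : Fin m → ℝ) :
    blockForm r I p (fun l => u l * y 0 0 l + v l * y 1 0 l)
      (fun l => u l * y 0 1 l + v l * y 1 1 l) (fun l => u l * y 0 2 l + v l * y 1 2 l) = 0 := by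
  let Y : Fin 3 → Fin m → MvPolynomial (Fin m ⊕ Fin m) ℤ := fun j l =>
    X (Sum.inl l) * (y 0 j l : MvPolynomial (Fin m ⊕ Fin m) ℤ) +
      X (Sum.inr l) * (y 1 j l : MvPolynomial (Fin m ⊕ Fin m) ℤ)
  let G := blockForm r I p (Y 0) (Y 1) (Y 2)
  have hlin : ∀ (a b B : ℝ) (l : Fin m), |a| ≤ Real.exp B → |b| ≤ Real.exp B →
      lOne (X (Sum.inl l) * C a + X (Sum.inr l) * C b : MvPolynomial (Fin m ⊕ Fin m) ℝ) ≤
        Real.exp (B + Real.log 2) := by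
    intro a b B l ha hb
    rw [Real.exp_add, Real.exp_log (by norm_num)]
    refine (lOne_add_le _ _).trans ?_
    have e1 := lOne_mul_le (X (Sum.inl l)) (C a : MvPolynomial (Fin m ⊕ Fin m) ℝ)
    have e2 := lOne_mul_le (X (Sum.inr l)) (C b : MvPolynomial (Fin m ⊕ Fin m) ℝ)
    rw [lOne_X, lOne_C, one_mul, Real.norm_eq_abs] at e1 e2
    linarith
  have hG : lOne (map (Int.castRingHom ℝ) G) < 1 := by
    refine lt_of_le_of_lt ?_ hsmall
    let x : Fin m → MvPolynomial (Fin m ⊕ Fin m) ℝ := fun l =>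
      X (Sum.inl l) * C (y 0 0 l : ℝ) + X (Sum.inr l) * C (y 1 0 l : ℝ)
    have hx : ∀ (a : ℝ) (j : Fin 3) (l : Fin m), map (Int.castRingHom ℝ) (Y j l) = C a * x l +
        (X (Sum.inl l) * C ((y 0 j l : ℝ) - a * y 0 0 l) +
          X (Sum.inr l) * C ((y 1 j l : ℝ) - a * y 1 0 l)) := by
      intro a j l
      simp only [Y, x, map_add, map_mul, map_X, C_sub, map_intCast]
      ring
    have hx0 : ∀ l, map (Int.castRingHom ℝ) (Y 0 l) = x l := fun l => by
      simp [Y, x]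
    have := lOne_blockForm_le (K := K + Real.log 2) hA hα hβ
      (add_nonneg hK (Real.log_nonneg (by norm_num))) hE hp hbad (z := z)
      (x := x) (y := fun l => X (Sum.inl l) * C ((y 0 1 l : ℝ) - α * y 0 0 l) +
          X (Sum.inr l) * C ((y 1 1 l : ℝ) - α * y 1 0 l))
      (w := fun l => X (Sum.inl l) * C ((y 0 2 l : ℝ) - β * y 0 0 l) +
          X (Sum.inr l) * C ((y 1 2 l : ℝ) - β * y 1 0 l))
      (fun l => by rw [← add_assoc]; exact hlin _ _ _ l (h0 0 l) (h0 1 l))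
      (fun l => by rw [← add_assoc]; exact hlin _ _ _ l (h1 0 l) (h1 1 l))
      (fun l => by rw [← add_assoc]; exact hlin _ _ _ l (h2 0 l) (h2 1 l)) hT
    refine le_trans (le_of_eq ?_) this
    rw [map_blockForm]
    simp only [← hx, hx0]
  have hG0 : G = 0 := by
    ext i
    rw [coeff_zero]
    have := (norm_coeff_le_lOne (map (Int.castRingHom ℝ) G) i).trans_lt hG
    rw [coeff_map, eq_intCast, Real.norm_eq_abs, ← Int.cast_abs] at this
    exact Int.abs_lt_one_iff.1 (by exact_mod_cast this)
  have := congrArg (eval₂Hom (Int.castRingHom ℝ) (Sum.elim u v)) hG0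
  rw [map_zero, map_blockForm] at this
  simpa only [Y, map_add, map_mul, map_intCast, coe_eval₂Hom, eval₂_X, Sum.elim_inl,
    Sum.elim_inr] using this

end RoyExt

namespace RoyExt

open Finset MvPolynomial

lemma exists_polynomial_of_blockForm {m : ℕ} {r : Fin m → ℕ} {p : (Fin m → ℕ × ℕ) → ℤ} {E : ℝ}
    (hp : ∃ n ∈ box r, p n ≠ 0) (hE : ∀ n ∈ box r, |(p n : ℝ)| ≤ E) (x t : Fin m → ℝ) :
    ∃ P : MvPolynomial (Fin m) ℤ, P ≠ 0 ∧ (∀ i, P.degreeOf i ≤ r i) ∧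
      lOne P ≤ 4 ^ (∑ l, r l) * E ∧ ∀ I : Fin m →₀ ℕ,
        (∀ s : Fin m → ℝ, blockForm r I p (fun _ => 1) s (fun l => x l + t l * s l) = 0) →
        eval x (hasse I (map (Int.castRingHom ℝ) P)) = 0 := by
  classical
  let e1 : (Fin m → ℕ × ℕ) → (Fin m →₀ ℕ) := fun n => Finsupp.equivFunOnFinite.symm fun l => (n l).1
  let e2 : (Fin m → ℕ × ℕ) → (Fin m →₀ ℕ) := fun n => Finsupp.equivFunOnFinite.symm fun l => (n l).2
  have he : ∀ n n', e1 n = e1 n' → e2 n = e2 n' → n = n' := fun n n' h h' => by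
    funext l
    exact Prod.ext (DFunLike.congr_fun h l) (DFunLike.congr_fun h' l)
  obtain ⟨n0, hn0, hpn0⟩ := hp
  obtain ⟨e, hemin⟩ := Finset.exists_minimal (s := ((box r).filter fun n => p n ≠ 0).image e1)
    ⟨e1 n0, mem_image_of_mem _ (mem_filter.2 ⟨hn0, hpn0⟩)⟩
  obtain ⟨n1, hn1, hn1e⟩ := mem_image.1 hemin.prop
  rw [mem_filter] at hn1
  set B := (box r).filter fun n => e1 n = e with hB
  refine ⟨∑ n ∈ B, monomial (e2 n) (p n), fun h => ?_, fun i => ?_, ?_, fun I hI => ?_⟩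
  · have := congrArg (coeff (e2 n1)) h
    rw [coeff_sum, Finset.sum_eq_single n1, coeff_monomial, if_pos rfl, coeff_zero] at this
    · exact hn1.2 this
    · intro n hn hne
      rw [coeff_monomial, if_neg]
      exact fun h2 => hne (he _ _ ((mem_filter.1 hn).2.trans hn1e.symm) h2)
    · exact fun h2 => absurd (mem_filter.2 ⟨hn1.1, hn1e⟩) h2
  · refine (degreeOf_sum_le _ _ _).trans (Finset.sup_le fun n hn => ?_)
    have := mem_tri.1 (Fintype.mem_piFinset.1 (mem_filter.1 hn).1 i)
    by_cases h0 : p n = 0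
    · simp [h0]
    · rw [degreeOf_monomial_eq _ _ h0]
      change (n i).2 ≤ r i
      omega
  · refine (lOne_sum_le _ _).trans ?_
    have h4 : (((box r).card : ℕ) : ℝ) ≤ 4 ^ ∑ l, r l := by exact_mod_cast card_box_le r
    have hE0 : 0 ≤ E := (abs_nonneg _).trans (hE _ hn0)
    calc ∑ n ∈ B, lOne (monomial (e2 n) (p n)) ≤ ∑ n ∈ box r, E := by
          refine (Finset.sum_le_sum fun n hn => ?_).trans
            (Finset.sum_le_sum_of_subset_of_nonneg (filter_subset _ _) fun _ _ _ => hE0)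
          rw [lOne_monomial, Int.norm_eq_abs]
          exact hE n (mem_filter.1 hn).1
      _ = (box r).card * E := by rw [sum_const, nsmul_eq_mul]
      _ ≤ _ := by gcongr
  · let Q : (Fin m → ℕ × ℕ) → MvPolynomial (Fin m) ℝ := fun n =>
      ∏ l, (((n l).2.choose (I l) : MvPolynomial (Fin m) ℝ) *
        (C (x l) + C (t l) * X l) ^ ((n l).2 - I l))
    have hH : ∑ n ∈ box r, monomial (e1 n) (p n : ℝ) * Q n = 0 := by
      refine MvPolynomial.funext fun s => ?_
      rw [map_zero, ← hI s, blockForm, map_sum]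
      refine Finset.sum_congr rfl fun n _ => ?_
      rw [map_mul, eval_monomial, Finsupp.prod_fintype _ _ fun _ => pow_zero _, map_prod, mul_assoc,
        ← Finset.prod_mul_distrib]
      congr 1
      refine Finset.prod_congr rfl fun l _ => ?_
      simp only [map_mul, map_add, map_pow, map_natCast, eval_C, eval_X, one_pow]
      change s l ^ (n l).1 * _ = _
      ring
    have hc := congrArg (coeff e) hH
    rw [coeff_zero, coeff_sum] at hc
    have hterm : ∀ n ∈ box r, coeff e (monomial (e1 n) (p n : ℝ) * Q n) =
        if e1 n = e then (p n : ℝ) * ∏ l, (((n l).2.choose (I l) : ℝ) * x l ^ ((n l).2 - I l))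
        else 0 := by
      intro n hn
      rw [coeff_monomial_mul']
      split_ifs with hle heq heq
      · rw [heq, tsub_self]
        congr 1
        change constantCoeff (Q n) = _
        simp only [Q, map_prod, map_mul, map_pow, map_add, map_natCast, constantCoeff_C,
          constantCoeff_X, mul_zero, add_zero]
      · by_cases h0 : p n = 0
        · simp [h0]
        · exact absurd (le_antisymm hle
            (hemin.le_of_le (mem_image_of_mem _ (mem_filter.2 ⟨hn, h0⟩)) hle)) heq
      · exact absurd heq.le hle
      · rfl
    rw [Finset.sum_congr rfl hterm, ← Finset.sum_filter] at hc
    rw [map_sum, map_sum, map_sum, ← hc]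
    refine Finset.sum_congr rfl fun n _ => ?_
    rw [map_monomial, hasse_monomial, eval_monomial, Finsupp.prod_fintype _ _ fun _ => pow_zero _,
      mchoose, eq_intCast, Nat.cast_prod, mul_assoc, ← Finset.prod_mul_distrib]
    rfl

end RoyExt

namespace RoyExt

open Finset MvPolynomial
open scoped goldenRatio

/-- Two integer points, very close to the line spanned by `(1, α, β)`, whose span cuts the plane at
infinity in a rational point of large height. -/
def Block (α β K c z : ℝ) : Prop :=
  ∃ (y : Fin 2 → Fin 3 → ℤ) (A B : ℤ) (t : ℝ),
    (∀ k, |(y k 0 : ℝ)| ≤ Real.exp (φ * z + K)) ∧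
    (∀ k, |(y k 1 : ℝ) - α * y k 0| ≤ Real.exp (-z + K)) ∧
    (∀ k, |(y k 2 : ℝ) - β * y k 0| ≤ Real.exp (-z + K)) ∧
    IsCoprime A B ∧ B ≠ 0 ∧ c * z ≤ Real.log (max |(A : ℝ)| |(B : ℝ)|) ∧
    ∀ s : ℝ, ∃ u v : ℝ, u * y 0 0 + v * y 1 0 = 1 ∧ u * y 0 1 + v * y 1 1 = s ∧
      u * y 0 2 + v * y 1 2 = A / B + t * s

lemma exists_lacunary {Q : ℝ → Prop} (h : ∀ Z, ∃ z, Z ≤ z ∧ Q z) (m : ℕ) (Z W : ℝ) (hZ : 1 ≤ Z) :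
    ∃ z : Fin m → ℝ, (∀ l, Z ≤ z l) ∧ (∀ l, Q (z l)) ∧ ∀ i j, i < j → W * z j ≤ z i := by
  choose f hf hQ using h
  let ζ : ℕ → ℝ := fun k => Nat.rec (f Z) (fun _ x => f (max 1 W * x)) k
  have hs : ∀ k, max 1 W * ζ k ≤ ζ (k + 1) := fun k => hf _
  have h1 : (1 : ℝ) ≤ max 1 W := le_max_left _ _
  have hZζ : ∀ k, Z ≤ ζ k := fun k => by
    induction k with
    | zero => exact hf Z
    | succ k ih => nlinarith [hs k]
  have hmono : Monotone ζ := monotone_nat_of_le_succ fun k => by nlinarith [hs k, hZζ k]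
  refine ⟨fun l => ζ l.rev, fun l => hZζ _, fun l => ?_, fun i j hij => ?_⟩
  · rcases Nat.eq_zero_or_pos (l.rev : ℕ) with h0 | h0
    · simp only [h0]; exact hQ Z
    · obtain ⟨k, hk⟩ := Nat.exists_eq_succ_of_ne_zero h0.ne'
      simp only [hk]; exact hQ _
  · have h2 : (j.rev : ℕ) + 1 ≤ i.rev := by
      have := Fin.rev_lt_rev.2 hij
      exact this
    have h3 := hmono h2
    have h4 := hs j.rev
    have h5 := hZζ j.rev
    have h6 : W ≤ max 1 W := le_max_right _ _
    nlinarith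

set_option maxHeartbeats 1000000 in
theorem not_forall_exists_block {α β K c : ℝ} (hα : IsAlgebraic ℚ α) (hβ : IsAlgebraic ℚ β)
    (hK : 0 ≤ K) (hc : 0 < c) : ¬ ∀ Z, ∃ z, Z ≤ z ∧ Block α β K c z := by
  intro hblocks
  obtain ⟨d, E, hE, haux⟩ := exists_auxiliary hα hβ
  obtain ⟨m, hm1, hm⟩ : ∃ m : ℕ, 1 ≤ m ∧
      2 * d * Real.exp (-(m * (1 / 100 : ℝ) ^ 2 / 4)) ≤ 1 := by
    refine ⟨80000 * d + 1, by omega, ?_⟩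
    rw [Real.exp_neg, ← div_eq_mul_inv, div_le_one (Real.exp_pos _)]
    have := Real.add_one_le_exp ((80000 * d + 1 : ℕ) * (1 / 100 : ℝ) ^ 2 / 4)
    push_cast at this ⊢
    linarith
  have hm1' : (1 : ℝ) ≤ m := by exact_mod_cast hm1
  obtain ⟨ω, hω, hroth⟩ := roth m (1 / 100) (by norm_num)
  set A := max 1 (max |α| |β|) with hA
  have hA1 : 1 ≤ A := le_max_left _ _
  have hlogE : 0 ≤ Real.log E := Real.log_nonneg hE
  have hlogA : 0 ≤ Real.log (64 * A) := Real.log_nonneg (by linarith)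
  have hlog2 : 0 ≤ Real.log 2 := Real.log_nonneg (by norm_num)
  have hlog4 : 0 ≤ Real.log 4 := Real.log_nonneg (by norm_num)
  set κ := Real.log E + Real.log (64 * A) + K + Real.log 2 with hκ
  have hκ0 : 0 ≤ κ := by positivity
  set Z := 1 + 81 * κ + 2 / (ω * c) + 4 * m * (Real.log 4 + Real.log E) / (ω * c) with hZdef
  have hZa : 0 ≤ 2 / (ω * c) := by positivity
  have hZb : 0 ≤ 4 * m * (Real.log 4 + Real.log E) / (ω * c) := by positivity
  have hZ1 : 1 ≤ Z := by linarith
  obtain ⟨z, hzZ, hzQ, hzlac⟩ := exists_lacunary hblocks m Z (2 / ω) hZ1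
  choose y a b t h0 h1 h2 hcop hb hht hplane using hzQ
  have hz0 : ∀ l, 0 < z l := fun l => by linarith [hzZ l]
  obtain ⟨Λ, hΛ⟩ : ∃ Λ, Λ = 100 * ∑ l, z l := ⟨_, rfl⟩
  have hzΛ : ∀ l, z l ≤ Λ / 100 := fun l => by
    have := Finset.single_le_sum (f := z) (fun i _ => (hz0 i).le) (Finset.mem_univ l)
    linarith
  have hΛ0 : 0 < Λ := by
    have := hz0 ⟨0, hm1⟩
    linarith [hzΛ ⟨0, hm1⟩]
  set r : Fin m → ℕ := fun l => ⌈Λ / z l⌉₊ with hr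
  have hr0 : ∀ l, 0 < r l := fun l => Nat.ceil_pos.2 (div_pos hΛ0 (hz0 l))
  have hr0' : ∀ l, (0 : ℝ) < r l := fun l => by exact_mod_cast hr0 l
  have hrz : ∀ l, Λ ≤ r l * z l := fun l => (div_le_iff₀ (hz0 l)).1 (Nat.le_ceil _)
  have hrz' : ∀ l, r l * z l ≤ (1 + 1 / 100) * Λ := fun l => by
    have h3 : (r l : ℝ) < Λ / z l + 1 := Nat.ceil_lt_add_one (div_pos hΛ0 (hz0 l)).le
    have h4 : r l * z l < (Λ / z l + 1) * z l := mul_lt_mul_of_pos_right h3 (hz0 l)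
    rw [add_mul, div_mul_cancel₀ _ (hz0 l).ne', one_mul] at h4
    linarith [hzΛ l]
  have hrZ : ∀ l, (r l : ℝ) * Z ≤ 2 * Λ := fun l => by
    have := mul_le_mul_of_nonneg_left (hzZ l) (hr0' l).le
    linarith [hrz' l]
  set S := ∑ l, r l with hS
  have hSZ : (S : ℝ) * Z ≤ 2 * m * Λ := by
    rw [hS, Nat.cast_sum, Finset.sum_mul]
    refine (Finset.sum_le_sum fun l _ => hrZ l).trans (le_of_eq ?_)
    simp
    ring
  have hS1 : (1 : ℝ) ≤ S := by
    have h3 : 1 ≤ S := (hr0 ⟨0, hm1⟩).trans_le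
      (Finset.single_le_sum (f := r) (fun _ _ => Nat.zero_le _) (Finset.mem_univ _))
    exact_mod_cast h3
  obtain ⟨p, hp0, hpE, hpbad⟩ := haux m (1 / 100) r hr0 (by norm_num) (by norm_num) hm
  obtain ⟨P, hP0, hPdeg, hPl, hPeval⟩ :=
    exists_polynomial_of_blockForm hp0 hpE (fun l => (a l : ℝ) / b l) t
  rw [← hS] at hPl
  have hωc : 0 < ω * c := mul_pos hω hc
  have hlP : 0 < lOne P := lt_of_not_ge fun hle => hP0 <| by
    ext i
    have := (norm_coeff_le_lOne P i).trans hle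
    simpa using norm_le_zero_iff.1 this
  obtain ⟨μ, hμ, hne⟩ := hroth r a b (c * Λ) P hr0
    (fun i j hij => by
      have e1 := hzlac i j hij
      rw [div_mul_eq_mul_div, div_le_iff₀ hω] at e1
      have e2 := hrz j
      have e3 := hrz' i
      have e4 : (r i : ℝ) * (2 * z j) ≤ r i * (z i * ω) := mul_le_mul_of_nonneg_left e1 (hr0' i).le
      have e5 : (r i : ℝ) * z j ≤ ω * r j * z j := by nlinarith
      exact le_of_mul_le_mul_right e5 (hz0 j))
    hcop hb (mul_pos hc hΛ0)
    (fun i => by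
      have e1 := mul_le_mul_of_nonneg_left (hht i) (hr0' i).le
      have e2 := mul_le_mul_of_nonneg_left (hrz i) hc.le
      linarith)
    (fun i => by
      have e1 : 2 ≤ Z * (ω * c) := by
        rw [← div_le_iff₀ hωc]
        linarith
      have e2 := mul_le_mul_of_nonneg_left e1 (hr0' i).le
      have e3 := mul_le_mul_of_nonneg_right (hrZ i) hωc.le
      nlinarith)
    hP0 hPdeg
    (by
      have e1 : Real.log (lOne P) ≤ S * Real.log 4 + (S + 1) * Real.log E := by
        refine (Real.log_le_log hlP hPl).trans (le_of_eq ?_)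
        rw [Real.log_mul (by positivity) (by positivity), Real.log_pow, Real.log_pow]
        push_cast
        ring
      have e2 : 4 * m * (Real.log 4 + Real.log E) ≤ Z * (ω * c) := by
        rw [← div_le_iff₀ hωc]
        linarith
      have e3 := mul_le_mul_of_nonneg_right e2 hΛ0.le
      have e4 : S * Real.log 4 + (S + 1) * Real.log E ≤ 2 * S * (Real.log 4 + Real.log E) := by
        have g1 := mul_nonneg (sub_nonneg.2 hS1) hlogE
        have g2 := mul_nonneg (by linarith : (0 : ℝ) ≤ S) hlog4
        linarith
      have e5 := mul_le_mul_of_nonneg_right hSZ (add_nonneg hlog4 hlogE)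
      have e6 : Z * (2 * S * (Real.log 4 + Real.log E)) ≤ Z * (ω * (c * Λ)) := by linarith
      have e7 := le_of_mul_le_mul_left e6 (by linarith)
      linarith)
  refine hne (hPeval μ fun s => ?_)
  choose u v hu1 hu2 hu3 using fun l => hplane l (s l)
  have hφ1 : φ < 1.62 := by nlinarith [Real.goldenRatio_sq, Real.one_lt_goldenRatio]
  have hφ0 := Real.one_lt_goldenRatio
  have key := blockForm_eq_zero (α := α) (β := β) (A := A) (E := E ^ (S + 1)) (K := K)
    (T := -(m * Λ / 20)) (w0 := (2 / 3 - 1 / 100) * m) (r := r) (I := μ) (p := p) (z := z)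
    (y := fun k j l => y l k j) hA1 ((le_max_left _ _).trans (le_max_right _ _))
    ((le_max_right _ _).trans (le_max_right _ _)) hK (by positivity) hpE hpbad
    (fun k l => h0 l k) (fun k l => h1 l k) (fun k l => h2 l k)
    (by
      intro g hg hwt
      have e1 : ∀ l, z l * (φ * r l - (φ + 1) * ((g l).1 + (g l).2 : ℕ) + μ l) ≤
          φ * ((1 + 1 / 100) * Λ) - (φ + 1) * (Λ * ((((g l).1 + (g l).2 : ℕ) : ℝ) / r l)) +
            (1 + 1 / 100) * Λ * (1 / (r l : ℝ) * μ l) := fun l => by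
        have f1 := mul_le_mul_of_nonneg_left (hrz' l) (by linarith : (0 : ℝ) ≤ φ)
        have f2 : Λ * ((((g l).1 + (g l).2 : ℕ) : ℝ) / r l) ≤ z l * ((g l).1 + (g l).2 : ℕ) := by
          rw [← mul_div_assoc, div_le_iff₀ (hr0' l)]
          have := mul_le_mul_of_nonneg_right (hrz l) (Nat.cast_nonneg ((g l).1 + (g l).2))
          linarith
        have f3 : z l * μ l ≤ (1 + 1 / 100) * Λ * (1 / (r l : ℝ) * μ l) := by
          rw [one_div_mul_eq_div, ← mul_div_assoc, le_div_iff₀ (hr0' l)]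
          have := mul_le_mul_of_nonneg_right (hrz' l) (Nat.cast_nonneg (μ l))
          linarith
        have f4 := mul_le_mul_of_nonneg_left f2 (by linarith : (0 : ℝ) ≤ φ + 1)
        linarith
      refine (Finset.sum_le_sum fun l _ => e1 l).trans ?_
      have hwt' : ∑ l, ((((g l).1 + (g l).2 : ℕ) : ℝ) / r l) = wt r g := rfl
      simp only [Finset.sum_add_distrib, Finset.sum_sub_distrib, ← Finset.mul_sum]
      rw [hwt', sum_const, card_univ, Fintype.card_fin, nsmul_eq_mul]
      have f1 : (φ + 1) * (Λ * ((2 / 3 - 1 / 100) * m)) ≤ (φ + 1) * (Λ * wt r g) := by gcongr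
      have f2 : (1 + 1 / 100) * Λ * ∑ l, (1 / (r l : ℝ) * μ l) ≤
          (1 + 1 / 100) * Λ * (1 / 100) := by gcongr
      have f3 : φ * (m * Λ) ≤ 1.62 * (m * Λ) := by gcongr
      have f4 : Λ ≤ m * Λ := le_mul_of_one_le_left hΛ0.le hm1'
      nlinarith)
    (by
      have hpos : 0 < E ^ (S + 1) * (64 * A * Real.exp (K + Real.log 2)) ^ S *
          Real.exp (-(m * Λ / 20)) := by positivity
      rw [← Real.log_neg_iff hpos, Real.log_mul (by positivity) (by positivity),
        Real.log_mul (by positivity) (by positivity), Real.log_exp, Real.log_pow, Real.log_pow,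
        Real.log_mul (by positivity) (by positivity), Real.log_exp]
      push_cast
      have e1 : (S + 1) * Real.log E + S * (Real.log (64 * A) + (K + Real.log 2)) ≤ 2 * S * κ := by
        have g1 := mul_nonneg (sub_nonneg.2 hS1) hlogE
        have g2 := mul_nonneg (by linarith : (0 : ℝ) ≤ S) (add_nonneg hlogA (add_nonneg hK hlog2))
        rw [hκ]
        linarith
      have e2 := mul_le_mul_of_nonneg_right hSZ hκ0
      have hmΛ : 0 < m * Λ := mul_pos (by linarith) hΛ0
      have e3 : 81 * κ < Z := by linarith
      have e4 := mul_lt_mul_of_pos_right e3 hmΛ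
      have e5 : Z * (2 * S * κ) < Z * (m * Λ / 20) := by
        have g1 := mul_nonneg hκ0 hmΛ.le
        linarith
      have e6 := lt_of_mul_lt_mul_left e5 (by linarith)
      linarith)
    u v
  simpa only [hu1, hu2, hu3] using key

end RoyExt

namespace RoyExt

/-- The value at `ξ` of the quadratic polynomial with coefficients `x`. -/
def val (ξ : ℝ) (x : Fin 3 → ℤ) : ℝ := x 0 + x 1 * ξ + x 2 * ξ ^ 2

/-- The maximum norm. -/
def ht (x : Fin 3 → ℤ) : ℕ := max (x 0).natAbs (max (x 1).natAbs (x 2).natAbs)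

/-- The cross product. -/
def cr {R : Type*} [CommRing R] (x y : Fin 3 → R) : Fin 3 → R :=
  ![x 1 * y 2 - x 2 * y 1, x 2 * y 0 - x 0 * y 2, x 0 * y 1 - x 1 * y 0]

/-- The dot product. -/
def dt (x y : Fin 3 → ℤ) : ℤ := x 0 * y 0 + x 1 * y 1 + x 2 * y 2

/-- The determinant of the symmetric matrix with entries `y`. -/
def sdet (y : Fin 3 → ℤ) : ℤ := y 0 * y 2 - y 1 ^ 2

/-- The point `y` is within `b` of a multiple of `(1, ξ, ξ ^ 2)`. -/
def Near (ξ b : ℝ) (y : Fin 3 → ℤ) : Prop :=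
  |(y 1 : ℝ) - ξ * y 0| ≤ b ∧ |(y 2 : ℝ) - ξ ^ 2 * y 0| ≤ b

/-- The coordinates generate the unit ideal. -/
def Prim (w : Fin 3 → ℤ) : Prop := ∃ c, dt c w = 1

lemma cr_zero {R : Type*} [CommRing R] (x y : Fin 3 → R) : cr x y 0 = x 1 * y 2 - x 2 * y 1 := rfl
lemma cr_one {R : Type*} [CommRing R] (x y : Fin 3 → R) : cr x y 1 = x 2 * y 0 - x 0 * y 2 := rfl
lemma cr_two {R : Type*} [CommRing R] (x y : Fin 3 → R) : cr x y 2 = x 0 * y 1 - x 1 * y 0 := rfl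

lemma ext3 {x y : Fin 3 → ℤ} (h0 : x 0 = y 0) (h1 : x 1 = y 1) (h2 : x 2 = y 2) : x = y := by
  funext j
  fin_cases j <;> assumption

lemma natAbs_le_ht (x : Fin 3 → ℤ) (j : Fin 3) : (x j).natAbs ≤ ht x := by
  fin_cases j <;> simp [ht]

lemma abs_le_ht (x : Fin 3 → ℤ) (j : Fin 3) : |(x j : ℝ)| ≤ ht x := by
  rw [← Int.cast_abs, Int.abs_eq_natAbs, Int.cast_natCast]
  exact_mod_cast natAbs_le_ht x j

lemma ht_le {x : Fin 3 → ℤ} {B : ℝ} (h : ∀ j, |(x j : ℝ)| ≤ B) : (ht x : ℝ) ≤ B := by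
  have h' : ∀ j, ((x j).natAbs : ℝ) ≤ B := fun j => by
    have := h j
    rwa [← Int.cast_abs, Int.abs_eq_natAbs, Int.cast_natCast] at this
  simp only [ht, Nat.cast_max]
  exact max_le (h' 0) (max_le (h' 1) (h' 2))

lemma ht_smul (a : ℤ) (x : Fin 3 → ℤ) : ht (a • x) = a.natAbs * ht x := by
  simp only [ht, Pi.smul_apply, smul_eq_mul, Int.natAbs_mul, Nat.mul_max_mul_left]

lemma ht_eq_zero {x : Fin 3 → ℤ} (h : ht x = 0) : x = 0 := by
  refine funext fun j => ?_
  have := natAbs_le_ht x j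
  rw [h] at this
  exact Int.natAbs_eq_zero.1 (Nat.le_zero.1 this)

lemma one_le_ht {x : Fin 3 → ℤ} (h : x ≠ 0) : 1 ≤ ht x :=
  Nat.one_le_iff_ne_zero.2 fun h0 => h (ht_eq_zero h0)

lemma val_smul (ξ : ℝ) (a : ℤ) (x : Fin 3 → ℤ) : val ξ (a • x) = a * val ξ x := by
  simp only [val, Pi.smul_apply, smul_eq_mul]
  push_cast
  ring

lemma abs_cr_le (x y : Fin 3 → ℤ) (j : Fin 3) : |((cr x y j : ℤ) : ℝ)| ≤ 2 * (ht x * ht y) := by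
  have key : ∀ a b c d : Fin 3, |(((x a * y b - x c * y d : ℤ)) : ℝ)| ≤ 2 * (ht x * ht y) := by
    intro a b c d
    push_cast
    have h1 : |(x a : ℝ) * y b| ≤ ht x * ht y := by
      rw [abs_mul]
      exact mul_le_mul (abs_le_ht x a) (abs_le_ht y b) (abs_nonneg _) (by positivity)
    have h2 : |(x c : ℝ) * y d| ≤ ht x * ht y := by
      rw [abs_mul]
      exact mul_le_mul (abs_le_ht x c) (abs_le_ht y d) (abs_nonneg _) (by positivity)
    have := abs_sub (x a * y b : ℝ) (x c * y d)
    linarith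
  fin_cases j
  · exact key 1 2 2 1
  · exact key 2 0 0 2
  · exact key 0 1 1 0

lemma near_cr (ξ : ℝ) (x y : Fin 3 → ℤ) :
    Near ξ (ht x * |val ξ y| + ht y * |val ξ x|) (cr x y) := by
  have key : ∀ j : Fin 3, |(x j : ℝ) * val ξ y - y j * val ξ x| ≤
      ht x * |val ξ y| + ht y * |val ξ x| := by
    intro j
    refine (abs_sub _ _).trans ?_
    rw [abs_mul, abs_mul]
    gcongr
    · exact abs_le_ht x j
    · exact abs_le_ht y j
  constructor
  · refine le_of_eq_of_le ?_ (key 2)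
    rw [cr_zero, cr_one, val, val]
    push_cast
    congr 1
    ring
  · refine le_of_eq_of_le ?_ (key 1)
    rw [cr_zero, cr_two, val, val, ← abs_neg]
    push_cast
    congr 1
    ring

lemma Near.of_smul {ξ b : ℝ} {a : ℤ} {y : Fin 3 → ℤ} (h : Near ξ b (a • y)) (ha : a ≠ 0) :
    Near ξ b y := by
  have ha1 : (1 : ℝ) ≤ |(a : ℝ)| := by exact_mod_cast Int.one_le_abs ha
  have key : ∀ t : ℝ, |a * t| ≤ b → |t| ≤ b := fun t ht => by
    rw [abs_mul] at ht
    nlinarith [abs_nonneg t]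
  constructor
  · refine key _ (le_of_eq_of_le ?_ h.1)
    simp only [Pi.smul_apply, smul_eq_mul]
    push_cast
    congr 1
    ring
  · refine key _ (le_of_eq_of_le ?_ h.2)
    simp only [Pi.smul_apply, smul_eq_mul]
    push_cast
    congr 1
    ring

lemma Near.mono {ξ b b' : ℝ} {y : Fin 3 → ℤ} (h : Near ξ b y) (hb : b ≤ b') : Near ξ b' y :=
  ⟨h.1.trans hb, h.2.trans hb⟩

lemma Near.abs_sdet_le {ξ b : ℝ} {y : Fin 3 → ℤ} (h : Near ξ b y) :
    |(sdet y : ℝ)| ≤ b * ((1 + 2 * |ξ|) * |(y 0 : ℝ)| + b) := by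
  have hb : 0 ≤ b := (abs_nonneg _).trans h.1
  have e : (sdet y : ℝ) = y 0 * (y 2 - ξ ^ 2 * y 0) -
      (y 1 - ξ * y 0) * ((y 1 - ξ * y 0) + 2 * ξ * y 0) := by
    rw [sdet]
    push_cast
    ring
  have h1 : |(y 0 : ℝ) * (y 2 - ξ ^ 2 * y 0)| ≤ |(y 0 : ℝ)| * b := by
    rw [abs_mul]
    exact mul_le_mul_of_nonneg_left h.2 (abs_nonneg _)
  have h2 : |((y 1 : ℝ) - ξ * y 0) + 2 * ξ * y 0| ≤ b + 2 * |ξ| * |(y 0 : ℝ)| := by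
    refine (abs_add_le _ _).trans (add_le_add h.1 (le_of_eq ?_))
    rw [abs_mul, abs_mul, abs_two]
  have h3 : |((y 1 : ℝ) - ξ * y 0) * ((y 1 - ξ * y 0) + 2 * ξ * y 0)| ≤
      b * (b + 2 * |ξ| * |(y 0 : ℝ)|) := by
    rw [abs_mul]
    exact mul_le_mul h.1 h2 (abs_nonneg _) hb
  rw [e]
  refine (abs_sub _ _).trans ((add_le_add h1 h3).trans (le_of_eq ?_))
  ring

lemma Near.abs_dt_le {ξ b : ℝ} {y : Fin 3 → ℤ} (h : Near ξ b y) (x : Fin 3 → ℤ) :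
    |(dt x y : ℝ)| ≤ |(y 0 : ℝ)| * |val ξ x| + 2 * (ht x * b) := by
  have hb : 0 ≤ b := (abs_nonneg _).trans h.1
  have e : (dt x y : ℝ) = y 0 * val ξ x + (x 1 * (y 1 - ξ * y 0) + x 2 * (y 2 - ξ ^ 2 * y 0)) := by
    rw [dt, val]
    push_cast
    ring
  rw [e]
  refine (abs_add_le _ _).trans ?_
  rw [abs_mul, two_mul]
  gcongr
  refine (abs_add_le _ _).trans ?_
  rw [abs_mul, abs_mul]
  exact add_le_add (mul_le_mul (abs_le_ht x 1) h.1 (abs_nonneg _) (by positivity))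
    (mul_le_mul (abs_le_ht x 2) h.2 (abs_nonneg _) (by positivity))

lemma abs_dt_cr_le (ξ : ℝ) (x y z : Fin 3 → ℤ) :
    |(dt x (cr y z) : ℝ)| ≤ 2 * (|val ξ x| * (ht y * ht z) + |val ξ y| * (ht z * ht x) +
      |val ξ z| * (ht x * ht y)) := by
  have e : (dt x (cr y z) : ℝ) = val ξ x * (cr y z 0 : ℤ) + val ξ y * (cr z x 0 : ℤ) +
      val ξ z * (cr x y 0 : ℤ) := by
    simp only [dt, val, cr_zero, cr_one, cr_two]
    push_cast
    ring
  have key : ∀ x y z : Fin 3 → ℤ, |val ξ x * (cr y z 0 : ℤ)| ≤ |val ξ x| * (2 * (ht y * ht z)) := by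
    intro x y z
    rw [abs_mul]
    exact mul_le_mul_of_nonneg_left (abs_cr_le y z 0) (abs_nonneg _)
  rw [e]
  refine (abs_add_le _ _).trans ?_
  refine (add_le_add_left (abs_add_le _ _) _).trans ?_
  linarith [key x y z, key y z x, key z x y]

lemma exists_prim {x : Fin 3 → ℤ} (hx : x ≠ 0) : ∃ (g : ℤ) (w : Fin 3 → ℤ), g ≠ 0 ∧ x = g • w ∧
    Prim w := by
  obtain ⟨g, hg⟩ := IsPrincipalIdealRing.principal (Ideal.span (Set.range x))
  have hdvd : ∀ j, g ∣ x j := fun j => by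
    have : x j ∈ Ideal.span (Set.range x) := Ideal.subset_span ⟨j, rfl⟩
    rw [hg] at this
    exact Ideal.mem_span_singleton.1 this
  choose w hw using hdvd
  have hxw : x = g • w := funext hw
  have hg0 : g ≠ 0 := by
    rintro rfl
    exact hx (by rw [hxw, zero_smul])
  refine ⟨g, w, hg0, hxw, ?_⟩
  have hmem : g ∈ Ideal.span (Set.range x) := by
    rw [hg]
    exact Ideal.mem_span_singleton_self g
  obtain ⟨c, hc⟩ := Ideal.mem_span_range_iff_exists_fun.1 hmem
  refine ⟨c, mul_left_cancel₀ hg0 ?_⟩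
  rw [Fin.sum_univ_three, hw 0, hw 1, hw 2] at hc
  rw [dt]
  linear_combination hc

lemma Prim.eq_smul {w y : Fin 3 → ℤ} {c : Fin 3 → ℤ} (hc : dt c w = 1) (h : cr w y = 0) :
    y = dt c y • w := by
  have h0 := congrFun h 0
  have h1 := congrFun h 1
  have h2 := congrFun h 2
  rw [cr_zero, Pi.zero_apply] at h0
  rw [cr_one, Pi.zero_apply] at h1
  rw [cr_two, Pi.zero_apply] at h2
  rw [dt] at hc
  refine ext3 ?_ ?_ ?_ <;> simp only [Pi.smul_apply, smul_eq_mul, dt]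
  · linear_combination -(y 0) * hc + c 2 * h1 - c 1 * h2
  · linear_combination -(y 1) * hc + c 0 * h2 - c 2 * h0
  · linear_combination -(y 2) * hc + c 1 * h0 - c 0 * h1

lemma Prim.exists_smul {w y : Fin 3 → ℤ} (hw : Prim w) (h : cr w y = 0) : ∃ a : ℤ, y = a • w := by
  obtain ⟨c, hc⟩ := hw
  exact ⟨_, Prim.eq_smul hc h⟩

lemma Prim.ne_zero {w : Fin 3 → ℤ} (hw : Prim w) : w ≠ 0 := by
  rintro rfl
  obtain ⟨c, hc⟩ := hw
  simp [dt] at hc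

lemma cr_smul_right (a : ℤ) (x y : Fin 3 → ℤ) : cr x (a • y) = a • cr x y := by
  refine ext3 ?_ ?_ ?_ <;> simp only [cr_zero, cr_one, cr_two, Pi.smul_apply, smul_eq_mul] <;> ring

lemma cr_smul_left (a : ℤ) (x y : Fin 3 → ℤ) : cr (a • x) y = a • cr x y := by
  refine ext3 ?_ ?_ ?_ <;> simp only [cr_zero, cr_one, cr_two, Pi.smul_apply, smul_eq_mul] <;> ring

lemma cr_cr (x y z : Fin 3 → ℤ) : cr (cr x y) (cr y z) = dt x (cr y z) • y := by
  refine ext3 ?_ ?_ ?_ <;>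
    simp only [cr_zero, cr_one, cr_two, Pi.smul_apply, smul_eq_mul, dt] <;> ring

lemma dt_smul_left (a : ℤ) (x y : Fin 3 → ℤ) : dt (a • x) y = a * dt x y := by
  simp only [dt, Pi.smul_apply, smul_eq_mul]
  ring

lemma dt_smul_right (a : ℤ) (x y : Fin 3 → ℤ) : dt x (a • y) = a * dt x y := by
  simp only [dt, Pi.smul_apply, smul_eq_mul]
  ring

lemma dt_cr_self_left (x y : Fin 3 → ℤ) : dt x (cr x y) = 0 := by
  simp only [dt, cr_zero, cr_one, cr_two]
  ring

lemma dt_cr_self_right (x y : Fin 3 → ℤ) : dt y (cr x y) = 0 := by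
  simp only [dt, cr_zero, cr_one, cr_two]
  ring

lemma sdet_smul (a : ℤ) (y : Fin 3 → ℤ) : sdet (a • y) = a ^ 2 * sdet y := by
  simp only [sdet, Pi.smul_apply, smul_eq_mul]
  ring

/-- A primitive point on the conic orthogonal to a nonzero `x` has first coordinate at most
the square of the height of `x`. -/
lemma abs_le_ht_sq {x y : Fin 3 → ℤ} (hy : Prim y) (hdet : sdet y = 0) (h0 : y 0 ≠ 0) (hx : x ≠ 0)
    (hxy : dt x y = 0) : |(y 0 : ℝ)| ≤ (ht x : ℝ) ^ 2 := by
  obtain ⟨c, hc⟩ := hy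
  obtain ⟨g, a, b, hg0, ha, hb, hab⟩ : ∃ g a b : ℤ, g ≠ 0 ∧ y 0 = g * a ∧ y 1 = g * b ∧
      IsCoprime a b := by
    have hg0 : ((Int.gcd (y 0) (y 1) : ℕ) : ℤ) ≠ 0 := by
      rw [Ne, Int.natCast_eq_zero, Int.gcd_eq_zero_iff]
      exact fun h => h0 h.1
    obtain ⟨a, ha⟩ := Int.gcd_dvd_left (y 0) (y 1)
    obtain ⟨b, hb⟩ := Int.gcd_dvd_right (y 0) (y 1)
    refine ⟨_, a, b, hg0, ha, hb, Int.gcdA (y 0) (y 1), Int.gcdB (y 0) (y 1),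
      mul_left_cancel₀ hg0 ?_⟩
    linear_combination -(Int.gcd_eq_gcd_ab (y 0) (y 1)) - (Int.gcdA (y 0) (y 1)) * ha -
      (Int.gcdB (y 0) (y 1)) * hb
  have ha0 : a ≠ 0 := by
    rintro rfl
    exact h0 (by rw [ha, mul_zero])
  have e1 : a * y 2 = g * b ^ 2 := by
    refine mul_left_cancel₀ hg0 ?_
    rw [sdet, ha, hb] at hdet
    linear_combination hdet
  obtain ⟨k, hk⟩ : a ∣ g := (hab.pow_right (n := 2)).dvd_of_dvd_mul_right ⟨y 2, e1.symm⟩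
  have e2 : y 2 = k * b ^ 2 := by
    refine mul_left_cancel₀ ha0 ?_
    rw [e1, hk]
    ring
  have e0 : y 0 = k * a ^ 2 := by rw [ha, hk]; ring
  have e1' : y 1 = k * (a * b) := by rw [hb, hk]; ring
  have hku : |k| = 1 := by
    have : k ∣ 1 := ⟨c 0 * a ^ 2 + c 1 * (a * b) + c 2 * b ^ 2, by
      rw [dt, e0, e1', e2] at hc
      linear_combination -hc⟩
    exact Int.isUnit_iff_abs_eq.1 (isUnit_of_dvd_one this)
  have hk0 : k ≠ 0 := by
    rintro rfl
    simp at hku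
  have hq : x 0 * a ^ 2 + x 1 * (a * b) + x 2 * b ^ 2 = 0 := by
    refine mul_left_cancel₀ hk0 ?_
    rw [dt, e0, e1', e2] at hxy
    linear_combination hxy
  have hale : a.natAbs ≤ ht x := by
    by_cases hx2 : x 2 = 0
    · have h3 : x 0 * a + x 1 * b = 0 := by
        refine mul_left_cancel₀ ha0 ?_
        rw [hx2] at hq
        linear_combination hq
      have h4 : a ∣ x 1 := hab.dvd_of_dvd_mul_right ⟨-x 0, by linear_combination h3⟩
      have hx1 : x 1 ≠ 0 := by
        intro hx1
        rw [hx1, zero_mul, add_zero] at h3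
        exact hx (ext3 ((mul_eq_zero.1 h3).resolve_right ha0) hx1 hx2)
      exact (Nat.le_of_dvd (Int.natAbs_pos.2 hx1) (Int.natAbs_dvd_natAbs.2 h4)).trans
        (natAbs_le_ht x 1)
    · have h4 : a ∣ x 2 := (hab.pow_right (n := 2)).dvd_of_dvd_mul_right
        ⟨-(x 0 * a + x 1 * b), by linear_combination hq⟩
      exact (Nat.le_of_dvd (Int.natAbs_pos.2 hx2) (Int.natAbs_dvd_natAbs.2 h4)).trans
        (natAbs_le_ht x 2)
  have hkr : |(k : ℝ)| = 1 := by exact_mod_cast hku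
  have har : |(a : ℝ)| ≤ ht x := by
    rw [← Int.cast_abs, Int.abs_eq_natAbs, Int.cast_natCast]
    exact_mod_cast hale
  rw [e0]
  push_cast
  rw [abs_mul, hkr, one_mul, abs_pow]
  exact pow_le_pow_left₀ (abs_nonneg _) har 2

end RoyExt

namespace RoyExt

open scoped goldenRatio

/-- The numbers `1, ξ, ξ ^ 2` are linearly independent over the integers. -/
def Indep (ξ : ℝ) : Prop := ∀ x : Fin 3 → ℤ, val ξ x = 0 → x = 0

/-- A sequence of minimal points for `(1, ξ, ξ ^ 2)` whose values are as small as they are for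
an extremal number. -/
structure MinSeq (ξ k : ℝ) (P : ℕ → Fin 3 → ℤ) : Prop where
  ne_zero : ∀ i, P i ≠ 0
  ht_lt : ∀ i, ht (P i) < ht (P (i + 1))
  val_lt : ∀ i, |val ξ (P (i + 1))| < |val ξ (P i)|
  le_val : ∀ i y, y ≠ 0 → ht y < ht (P (i + 1)) → |val ξ (P i)| ≤ |val ξ y|
  log_val : ∀ i, Real.log |val ξ (P i)| ≤ -(φ + 1) * Real.log (ht (P (i + 1))) + k

lemma finite_setOf_ht_le (h : ℕ) : {y : Fin 3 → ℤ | ht y ≤ h}.Finite := by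
  refine (Set.Finite.pi' (t := fun _ : Fin 3 => Set.Icc (-(h : ℤ)) h)
    fun _ => Set.finite_Icc _ _).subset fun y hy j => ?_
  have h1 := (natAbs_le_ht y j).trans hy
  rw [Set.mem_Icc]
  omega

lemma exists_next_min {ξ ε : ℝ} (h : ∃ y, y ≠ 0 ∧ |val ξ y| < ε) : ∃ P, P ≠ 0 ∧ |val ξ P| < ε ∧
    (∀ y, y ≠ 0 → ht y < ht P → ε ≤ |val ξ y|) ∧
    ∀ y, y ≠ 0 → ht y ≤ ht P → |val ξ P| ≤ |val ξ y| := by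
  classical
  have hex : ∃ n, ∃ y, (y ≠ 0 ∧ |val ξ y| < ε) ∧ ht y = n := by
    obtain ⟨y, hy⟩ := h
    exact ⟨_, y, hy, rfl⟩
  obtain ⟨y₁, hy₁, hn⟩ := Nat.find_spec hex
  have hmin : ∀ y, y ≠ 0 → |val ξ y| < ε → ht y₁ ≤ ht y := fun y h0 h1 => by
    rw [hn]
    exact Nat.find_min' hex ⟨y, ⟨h0, h1⟩, rfl⟩
  have hfin : {y : Fin 3 → ℤ | (y ≠ 0 ∧ |val ξ y| < ε) ∧ ht y ≤ ht y₁}.Finite :=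
    (finite_setOf_ht_le (ht y₁)).subset fun y hy => hy.2
  obtain ⟨P, ⟨⟨hP0, hPε⟩, hPh⟩, hP⟩ := Set.exists_min_image _ (fun y => |val ξ y|) hfin
    ⟨y₁, hy₁, le_rfl⟩
  have hPe : ht P = ht y₁ := le_antisymm hPh (hmin P hP0 hPε)
  refine ⟨P, hP0, hPε, fun y hy0 hy => ?_, fun y hy0 hy => ?_⟩
  · by_contra hlt
    push Not at hlt
    have := hmin y hy0 hlt
    omega
  · rcases lt_or_ge |val ξ y| ε with hlt | hge
    · exact hP y ⟨⟨hy0, hlt⟩, hPe ▸ hy⟩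
    · exact hPε.le.trans hge

lemma exists_minSeq {ξ k : ℝ} (hξ : Indep ξ) {N₁ : ℕ}
    (h : ∀ N : ℕ, N₁ ≤ N → ∃ x, x ≠ 0 ∧ ht x ≤ N ∧
      Real.log |val ξ x| ≤ -(φ + 1) * Real.log N + k) :
    ∃ P, MinSeq ξ (k + (φ + 1) * Real.log 2) P := by
  have hφ : 0 < φ + 1 := by linarith [Real.one_lt_goldenRatio]
  have hpos : ∀ x, x ≠ 0 → 0 < |val ξ x| := fun x hx => abs_pos.2 fun h0 => hx (hξ x h0)
  have hsmall : ∀ ε : ℝ, 0 < ε → ∃ y, y ≠ 0 ∧ |val ξ y| < ε := by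
    intro ε hε
    have ht : Filter.Tendsto (fun N : ℕ => -(φ + 1) * Real.log N + k) Filter.atTop
        Filter.atBot := by
      refine Filter.tendsto_atBot_add_const_right _ _ ?_
      exact (Real.tendsto_log_atTop.comp tendsto_natCast_atTop_atTop).const_mul_atTop_of_neg
        (by linarith)
    obtain ⟨N, hN1, hN2⟩ :=
      ((ht.eventually (Filter.eventually_lt_atBot (Real.log ε))).and
        (Filter.eventually_ge_atTop N₁)).exists
    obtain ⟨x, hx0, -, hx⟩ := h N hN2
    exact ⟨x, hx0, (Real.log_lt_log_iff (hpos x hx0) hε).1 (hx.trans_lt hN1)⟩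
  choose! F hF0 hFε hFlt hFmin using fun (ε : ℝ) (hε : 0 < ε) =>
    exists_next_min (hsmall ε hε)
  obtain ⟨Q, hQz, hQs⟩ : ∃ Q : ℕ → Fin 3 → ℤ, Q 0 = F 1 ∧ ∀ n, Q (n + 1) = F |val ξ (Q n)| :=
    ⟨fun n => Nat.rec (F 1) (fun _ P => F |val ξ P|) n, rfl, fun _ => rfl⟩
  have hQ0 : ∀ n, Q n ≠ 0 := by
    intro n
    induction n with
    | zero => exact hQz ▸ hF0 1 one_pos
    | succ n ih => exact hQs n ▸ hF0 _ (hpos _ ih)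
  have hQmin : ∀ n y, y ≠ 0 → ht y ≤ ht (Q n) → |val ξ (Q n)| ≤ |val ξ y| := by
    intro n
    cases n with
    | zero => exact hQz ▸ hFmin 1 one_pos
    | succ n => exact hQs n ▸ hFmin _ (hpos _ (hQ0 n))
  have hQv : ∀ n, |val ξ (Q (n + 1))| < |val ξ (Q n)| := fun n =>
    hQs n ▸ hFε _ (hpos _ (hQ0 n))
  have hQl : ∀ n y, y ≠ 0 → ht y < ht (Q (n + 1)) → |val ξ (Q n)| ≤ |val ξ y| :=
    fun n => hQs n ▸ hFlt _ (hpos _ (hQ0 n))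
  have hQh : ∀ n, ht (Q n) < ht (Q (n + 1)) := by
    intro n
    by_contra hle
    push Not at hle
    exact absurd (hQmin n _ (hQ0 (n + 1)) hle) (not_le.2 (hQv n))
  have hmono : StrictMono fun n => ht (Q n) := strictMono_nat_of_lt_succ hQh
  refine ⟨fun n => Q (n + (N₁ + 1)), fun i => hQ0 (i + (N₁ + 1)), fun i => ?_, fun i => ?_, fun i y => ?_,
    fun i => ?_⟩
  · rw [show i + 1 + (N₁ + 1) = i + (N₁ + 1) + 1 by ring]
    exact hQh _
  · rw [show i + 1 + (N₁ + 1) = i + (N₁ + 1) + 1 by ring]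
    exact hQv _
  · rw [show i + 1 + (N₁ + 1) = i + (N₁ + 1) + 1 by ring]
    exact hQl _ y
  · rw [show i + 1 + (N₁ + 1) = i + (N₁ + 1) + 1 by ring]
    set m := i + (N₁ + 1) with hm
    have hbig : m + 1 ≤ ht (Q (m + 1)) := hmono.id_le (m + 1)
    obtain ⟨N, hN⟩ : ∃ N, ht (Q (m + 1)) = N + 1 := ⟨ht (Q (m + 1)) - 1, by omega⟩
    obtain ⟨x, hx0, hxN, hx⟩ := h N (by omega)
    have h1 : Real.log |val ξ (Q m)| ≤ Real.log |val ξ x| :=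
      Real.log_le_log (hpos _ (hQ0 _)) (hQl m x hx0 (by omega))
    have hN1 : (1 : ℝ) ≤ N := by exact_mod_cast (by omega : 1 ≤ N)
    have h2 : Real.log (ht (Q (m + 1))) ≤ Real.log 2 + Real.log N := by
      rw [← Real.log_mul two_ne_zero (by positivity), hN]
      refine Real.log_le_log (by positivity) ?_
      push_cast
      linarith
    nlinarith

namespace MinSeq

variable {ξ k : ℝ} {P : ℕ → Fin 3 → ℤ}

lemma shift (h : MinSeq ξ k P) (s : ℕ) : MinSeq ξ k fun i => P (i + s) where
  ne_zero i := h.ne_zero _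
  ht_lt i := by
    rw [show i + 1 + s = i + s + 1 by ring]
    exact h.ht_lt _
  val_lt i := by
    rw [show i + 1 + s = i + s + 1 by ring]
    exact h.val_lt _
  le_val i := by
    rw [show i + 1 + s = i + s + 1 by ring]
    exact h.le_val _
  log_val i := by
    rw [show i + 1 + s = i + s + 1 by ring]
    exact h.log_val _

lemma ht_pos (h : MinSeq ξ k P) (i : ℕ) : (0 : ℝ) < ht (P i) := by
  exact_mod_cast one_le_ht (h.ne_zero i)

lemma val_pos (h : MinSeq ξ k P) (i : ℕ) : 0 < |val ξ (P i)| :=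
  (abs_nonneg _).trans_lt (h.val_lt i)

lemma exp_log_ht (h : MinSeq ξ k P) (i : ℕ) : Real.exp (Real.log (ht (P i))) = ht (P i) :=
  Real.exp_log (h.ht_pos i)

lemma exp_log_val (h : MinSeq ξ k P) (i : ℕ) :
    Real.exp (Real.log |val ξ (P i)|) = |val ξ (P i)| :=
  Real.exp_log (h.val_pos i)

lemma succ_le_ht (h : MinSeq ξ k P) (i : ℕ) : i + 1 ≤ ht (P i) := by
  induction i with
  | zero => exact one_le_ht (h.ne_zero 0)
  | succ i ih =>
    have := h.ht_lt i
    omega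

lemma log_ht_lt (h : MinSeq ξ k P) (i : ℕ) :
    Real.log (ht (P i)) < Real.log (ht (P (i + 1))) :=
  Real.log_lt_log (h.ht_pos i) (by exact_mod_cast h.ht_lt i)

lemma strictMono_log_ht (h : MinSeq ξ k P) : StrictMono fun i => Real.log (ht (P i)) :=
  strictMono_nat_of_lt_succ h.log_ht_lt

lemma log_ht_nonneg (h : MinSeq ξ k P) (i : ℕ) : 0 ≤ Real.log (ht (P i)) :=
  Real.log_nonneg (by exact_mod_cast one_le_ht (h.ne_zero i))

lemma tendsto_log_ht (h : MinSeq ξ k P) :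
    Filter.Tendsto (fun i => Real.log (ht (P i))) Filter.atTop Filter.atTop := by
  refine Real.tendsto_log_atTop.comp (Filter.tendsto_atTop_mono (f := fun i : ℕ => (i : ℝ))
    (fun i => ?_) tendsto_natCast_atTop_atTop)
  exact_mod_cast (Nat.le_succ i).trans (h.succ_le_ht i)

lemma exists_log_ht_ge (h : MinSeq ξ k P) (C : ℝ) (n : ℕ) :
    ∃ m, n ≤ m ∧ ∀ i, m ≤ i → C ≤ Real.log (ht (P i)) := by
  obtain ⟨m, hm⟩ := Filter.eventually_atTop.1 (h.tendsto_log_ht.eventually_ge_atTop C)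
  exact ⟨max m n, le_max_right _ _, fun i hi => hm i ((le_max_left _ _).trans hi)⟩

lemma prim (h : MinSeq ξ k P) (i : ℕ) : Prim (P i) := by
  obtain ⟨g, w, hg, hw, hp⟩ := exists_prim (h.ne_zero i)
  have h1 : 1 ≤ g.natAbs := Int.natAbs_pos.2 hg
  have h2 : ht (P i) = g.natAbs * ht w := by rw [hw, ht_smul]
  have h3 := h.le_val i w hp.ne_zero (by nlinarith [h.ht_lt i])
  have h4 := h.val_pos i
  rw [hw, val_smul, abs_mul] at h3 h4
  have h5 : 0 < |val ξ w| := pos_of_mul_pos_right h4 (abs_nonneg _)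
  have h6 : |(g : ℝ)| ≤ 1 := by
    by_contra hlt
    push Not at hlt
    nlinarith
  have h7 : |g| ≤ 1 := by exact_mod_cast h6
  have h8 : |g| = 1 := le_antisymm h7 (Int.one_le_abs hg)
  obtain ⟨c, hc⟩ := hp
  refine ⟨g • c, ?_⟩
  rw [hw, dt_smul_left, dt_smul_right, hc, mul_one, ← sq, ← sq_abs, h8, one_pow]

lemma cr_ne_zero (h : MinSeq ξ k P) {i j : ℕ} (hij : i < j) : cr (P i) (P j) ≠ 0 := by
  intro h0
  obtain ⟨a, ha⟩ := (h.prim i).exists_smul h0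
  have ha0 : a ≠ 0 := by
    rintro rfl
    exact h.ne_zero j (by rw [ha, zero_smul])
  have h1 : |val ξ (P j)| < |val ξ (P i)| :=
    (strictAnti_nat_of_succ_lt (f := fun i => |val ξ (P i)|) h.val_lt) hij
  have h2 : (1 : ℝ) ≤ |(a : ℝ)| := by exact_mod_cast Int.one_le_abs ha0
  rw [ha, val_smul, abs_mul] at h1
  nlinarith [h.val_pos i]

/-- The cross product of two successive minimal points. -/
lemma abs_cr_succ_le (h : MinSeq ξ k P) (i : ℕ) (j : Fin 3) :
    |((cr (P i) (P (i + 1)) j : ℤ) : ℝ)| ≤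
      2 * Real.exp (Real.log (ht (P i)) + Real.log (ht (P (i + 1)))) := by
  rw [Real.exp_add, h.exp_log_ht, h.exp_log_ht]
  exact abs_cr_le _ _ j

lemma near_cr_succ (h : MinSeq ξ k P) (i : ℕ) :
    Near ξ (2 * Real.exp (-φ * Real.log (ht (P (i + 1))) + k)) (cr (P i) (P (i + 1))) := by
  refine (near_cr ξ (P i) (P (i + 1))).mono ?_
  have h1 : (ht (P (i + 1)) : ℝ) * |val ξ (P i)| ≤
      Real.exp (-φ * Real.log (ht (P (i + 1))) + k) := by
    rw [← h.exp_log_ht, ← h.exp_log_val, ← Real.exp_add, Real.log_exp]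
    exact Real.exp_le_exp.2 (by linarith [h.log_val i])
  have h2 : (ht (P i) : ℝ) * |val ξ (P (i + 1))| ≤ ht (P (i + 1)) * |val ξ (P i)| :=
    mul_le_mul (by exact_mod_cast (h.ht_lt i).le) (h.val_lt i).le (abs_nonneg _) (by positivity)
  linarith

lemma log_ht_bound (h : MinSeq ξ k P) : ∃ C, ∀ (y : Fin 3 → ℤ) (i j : ℕ), sdet y ≠ 0 →
    Near ξ (2 * Real.exp (-φ * Real.log (ht (P j)) + k)) y →
    |(y 0 : ℝ)| ≤ 2 * Real.exp (Real.log (ht (P i)) + Real.log (ht (P (i + 1)))) →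
    φ * Real.log (ht (P j)) ≤ Real.log (ht (P i)) + Real.log (ht (P (i + 1))) + C := by
  have hφ := Real.goldenRatio_pos
  set D : ℝ := 2 * Real.exp k * ((1 + 2 * |ξ|) * 2 + 2 * Real.exp k) with hD
  have hDpos : 0 < D := by positivity
  refine ⟨Real.log D, fun y i j hy hn h0 => ?_⟩
  set s := Real.log (ht (P i)) + Real.log (ht (P (i + 1))) with hs
  have hs0 : 0 ≤ s := add_nonneg (h.log_ht_nonneg _) (h.log_ht_nonneg _)
  set l := Real.log (ht (P j)) with hl
  have hl0 : 0 ≤ l := h.log_ht_nonneg _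
  have h1 : (1 : ℝ) ≤ |(sdet y : ℝ)| := by exact_mod_cast Int.one_le_abs hy
  have h2 := h1.trans hn.abs_sdet_le
  have e1 : Real.exp (-φ * l + k) = Real.exp k * Real.exp (-φ * l) := by
    rw [add_comm, Real.exp_add]
  have e2 : Real.exp (-φ * l) ≤ 1 := Real.exp_le_one_iff.2 (by nlinarith)
  have e3 : 1 ≤ Real.exp s := Real.one_le_exp hs0
  have h3 : (1 + 2 * |ξ|) * |(y 0 : ℝ)| + 2 * Real.exp (-φ * l + k) ≤
      ((1 + 2 * |ξ|) * 2 + 2 * Real.exp k) * Real.exp s := by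
    rw [e1]
    have : (1 + 2 * |ξ|) * |(y 0 : ℝ)| ≤ (1 + 2 * |ξ|) * (2 * Real.exp s) :=
      mul_le_mul_of_nonneg_left h0 (by positivity)
    have : Real.exp k * Real.exp (-φ * l) ≤ Real.exp k * Real.exp s :=
      mul_le_mul_of_nonneg_left (e2.trans e3) (Real.exp_pos _).le
    nlinarith
  have h4 : 1 ≤ D * Real.exp (s - φ * l) := by
    refine (h2.trans (mul_le_mul_of_nonneg_left h3 (by positivity))).trans (le_of_eq ?_)
    rw [e1, sub_eq_add_neg, Real.exp_add s, hD, neg_mul]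
    ring
  have h5 := Real.log_le_log one_pos h4
  rw [Real.log_one, Real.log_mul hDpos.ne' (Real.exp_pos _).ne', Real.log_exp] at h5
  linarith

lemma le_log_ht (h : MinSeq ξ k P) : ∃ C, ∀ i, dt (P i) (cr (P (i + 1)) (P (i + 2))) ≠ 0 →
    φ * Real.log (ht (P (i + 1))) ≤ Real.log (ht (P (i + 2))) + C := by
  refine ⟨Real.log 6 + k, fun i hi => ?_⟩
  have h1 : (1 : ℝ) ≤ |(dt (P i) (cr (P (i + 1)) (P (i + 2))) : ℝ)| := by
    exact_mod_cast Int.one_le_abs hi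
  have h2 := h1.trans (abs_dt_cr_le ξ _ _ _)
  have a0 := h.ht_pos i
  have v0 := h.val_pos (i + 2)
  have a1 : (ht (P i) : ℝ) ≤ ht (P (i + 1)) := by exact_mod_cast (h.ht_lt i).le
  have a2 : (ht (P (i + 1)) : ℝ) ≤ ht (P (i + 2)) := by exact_mod_cast (h.ht_lt (i + 1)).le
  have v1 := (h.val_lt i).le
  have v2 := (h.val_lt (i + 1)).le
  have b1 : |val ξ (P (i + 1))| * (ht (P (i + 2)) * ht (P i)) ≤
      |val ξ (P i)| * (ht (P (i + 1)) * ht (P (i + 2))) := by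
    rw [mul_comm (ht (P (i + 1)) : ℝ)]
    gcongr
  have b2 : |val ξ (P (i + 2))| * (ht (P i) * ht (P (i + 1))) ≤
      |val ξ (P i)| * (ht (P (i + 1)) * ht (P (i + 2))) := by
    rw [mul_comm (ht (P i) : ℝ)]
    exact mul_le_mul (v2.trans v1) (mul_le_mul_of_nonneg_left (a1.trans a2) (by positivity))
      (by positivity) (abs_nonneg _)
  have h3 : 1 ≤ 6 * Real.exp (Real.log |val ξ (P i)| + (Real.log (ht (P (i + 1))) +
      Real.log (ht (P (i + 2))))) := by
    rw [Real.exp_add, Real.exp_add, h.exp_log_val, h.exp_log_ht, h.exp_log_ht]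
    linarith
  have h5 := Real.log_le_log one_pos h3
  rw [Real.log_one, Real.log_mul (by norm_num) (Real.exp_pos _).ne', Real.log_exp] at h5
  linarith [h.log_val i]

lemma exists_smul_of_dt_eq_zero (h : MinSeq ξ k P) {s t : ℕ} (hst : s ≤ t) {w : Fin 3 → ℤ}
    (hw : Prim w) {g : ℤ} (hg : cr (P s) (P (s + 1)) = g • w)
    (hdt : ∀ i, s ≤ i → i < t → dt (P i) (cr (P (i + 1)) (P (i + 2))) = 0) :
    ∃ a : ℤ, a ≠ 0 ∧ cr (P t) (P (t + 1)) = a • w := by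
  have hne : ∀ i (a : ℤ), cr (P i) (P (i + 1)) = a • w → a ≠ 0 := by
    rintro i a ha rfl
    exact h.cr_ne_zero (Nat.lt_succ_self i) (by rw [ha, zero_smul])
  induction t, hst using Nat.le_induction with
  | base => exact ⟨g, hne s g hg, hg⟩
  | succ t hst ih =>
    obtain ⟨a, ha0, ha⟩ := ih fun i h1 h2 => hdt i h1 (by omega)
    have h1 := cr_cr (P t) (P (t + 1)) (P (t + 2))
    rw [hdt t hst (Nat.lt_succ_self t), zero_smul, ha, cr_smul_left] at h1
    obtain ⟨b, hb⟩ := hw.exists_smul ((smul_eq_zero.1 h1).resolve_left ha0)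
    exact ⟨b, hne _ b hb, hb⟩

lemma exists_dt_ne_zero (h : MinSeq ξ k P) (hξ : Indep ξ) (n : ℕ) :
    ∃ m, n ≤ m ∧ dt (P m) (cr (P (m + 1)) (P (m + 2))) ≠ 0 := by
  by_contra hcon
  push Not at hcon
  obtain ⟨g, w, -, hgw, hw⟩ := exists_prim (h.cr_ne_zero (Nat.lt_succ_self n))
  have hnear : ∀ m, n ≤ m → Near ξ (2 * Real.exp (-φ * Real.log (ht (P (m + 1))) + k)) w := by
    intro m hm
    obtain ⟨a, ha0, ha⟩ := h.exists_smul_of_dt_eq_zero hm hw hgw fun i hi _ => hcon i hi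
    have := h.near_cr_succ m
    rw [ha] at this
    exact this.of_smul ha0
  have hlim : Filter.Tendsto
      (fun m => 2 * Real.exp (-φ * Real.log (ht (P (m + 1))) + k)) Filter.atTop (nhds (2 * 0)) := by
    refine (Real.tendsto_exp_atBot.comp (Filter.tendsto_atBot_add_const_right _ _ ?_)).const_mul 2
    exact (h.tendsto_log_ht.comp (Filter.tendsto_add_atTop_nat 1)).const_mul_atTop_of_neg
      (by linarith [Real.goldenRatio_pos])
  rw [mul_zero] at hlim
  have h1 : |(w 1 : ℝ) - ξ * w 0| ≤ 0 := ge_of_tendsto hlim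
    (Filter.eventually_atTop.2 ⟨n, fun m hm => (hnear m hm).1⟩)
  have h2 : |(w 2 : ℝ) - ξ ^ 2 * w 0| ≤ 0 := ge_of_tendsto hlim
    (Filter.eventually_atTop.2 ⟨n, fun m hm => (hnear m hm).2⟩)
  have h3 := abs_nonpos_iff.1 h1
  have h4 := abs_nonpos_iff.1 h2
  have h5 := hξ ![w 1, -w 0, 0] (by simp [val]; linarith)
  have e1 : w 1 = 0 := congrFun h5 0
  have e0 : w 0 = 0 := neg_eq_zero.1 (congrFun h5 1)
  rw [e0, Int.cast_zero, mul_zero, sub_zero] at h4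
  exact hw.ne_zero (ext3 e0 e1 (by exact_mod_cast h4))

end MinSeq

end RoyExt

namespace RoyExt

open scoped goldenRatio

lemma three_halves_le_goldenRatio : 3 / 2 ≤ φ := by
  nlinarith [Real.goldenRatio_sq, Real.one_lt_goldenRatio]

lemma eight_le_exp_three : (8 : ℝ) ≤ Real.exp 3 := by
  have h1 : (2 : ℝ) ≤ Real.exp 1 := by linarith [Real.add_one_le_exp (1 : ℝ)]
  have h2 : Real.exp 3 = Real.exp 1 ^ 3 := by rw [← Real.exp_nat_mul]; norm_num
  rw [h2]
  calc (8 : ℝ) = 2 ^ 3 := by norm_num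
    _ ≤ _ := pow_le_pow_left₀ (by norm_num) h1 3

lemma exp_le_eighth {t : ℝ} (ht : t ≤ -3) : Real.exp t ≤ 1 / 8 := by
  refine (Real.exp_le_exp.2 ht).trans ?_
  rw [Real.exp_neg, ← one_div]
  exact one_div_le_one_div_of_le (by norm_num) eight_le_exp_three

lemma dt_cr_eq_zero {x y z w : Fin 3 → ℤ} (hw : w ≠ 0) (hx : dt x w = 0) (hy : dt y w = 0)
    (hz : dt z w = 0) : dt x (cr y z) = 0 := by
  have key : ∀ j, dt x (cr y z) * w j = 0 := by
    intro j
    rw [dt] at hx hy hz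
    simp only [dt, cr_zero, cr_one, cr_two]
    fin_cases j
    · change _ * w 0 = 0
      linear_combination (y 1 * z 2 - y 2 * z 1) * hx + (z 1 * x 2 - z 2 * x 1) * hy + (x 1 * y 2 - x 2 * y 1) * hz
    · change _ * w 1 = 0
      linear_combination (y 2 * z 0 - y 0 * z 2) * hx + (z 2 * x 0 - z 0 * x 2) * hy + (x 2 * y 0 - x 0 * y 2) * hz
    · change _ * w 2 = 0
      linear_combination (y 0 * z 1 - y 1 * z 0) * hx + (z 0 * x 1 - z 1 * x 0) * hy + (x 0 * y 1 - x 1 * y 0) * hz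
  by_contra h
  exact hw (funext fun j => (mul_eq_zero.1 (key j)).resolve_left h)

namespace MinSeq

variable {ξ k : ℝ} {P : ℕ → Fin 3 → ℤ}

lemma sdet_ne_zero (h : MinSeq ξ k P) (hξ : Indep ξ) :
    ∃ m, ∀ i, m ≤ i → sdet (cr (P i) (P (i + 1))) ≠ 0 := by
  have hφ := three_halves_le_goldenRatio
  obtain ⟨n₀, -, hn₀⟩ := h.exists_log_ht_ge (2 * (|k| + 3)) 0
  obtain ⟨m, hm, hdet⟩ := h.exists_dt_ne_zero hξ n₀
  have hk := le_abs_self k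
  refine ⟨m + 3, fun i hi h0 => ?_⟩
  obtain ⟨g, w, hg0, hgw, hw⟩ := exists_prim (h.cr_ne_zero (Nat.lt_succ_self i))
  have hw0 : sdet w = 0 := by
    rw [hgw, sdet_smul] at h0
    exact (mul_eq_zero.1 h0).resolve_left (pow_ne_zero 2 hg0)
  have hnear := h.near_cr_succ i
  rw [hgw] at hnear
  replace hnear := hnear.of_smul hg0
  have hPi : dt (P i) w = 0 := by
    have := dt_cr_self_left (P i) (P (i + 1))
    rw [hgw, dt_smul_right] at this
    exact (mul_eq_zero.1 this).resolve_left hg0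
  obtain ⟨n, hn1, hn2, hn3, hn4⟩ : ∃ n, n₀ ≤ n ∧ n < i ∧ dt (P n) w ≠ 0 ∧
      dt (P (n + 1)) w = 0 := by
    by_contra hcon
    push Not at hcon
    have hall : ∀ s, n₀ ≤ s → dt (P s) w ≠ 0 → ∀ t, s ≤ t → t ≤ i → dt (P t) w ≠ 0 := by
      intro s hs hsw t hst
      induction t, hst using Nat.le_induction with
      | base => exact fun _ => hsw
      | succ t hst ih => exact fun hti => hcon t (hs.trans hst) (by omega) (ih (by omega))
    have hz : ∀ s, n₀ ≤ s → s ≤ i → dt (P s) w = 0 := by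
      intro s hs hsi
      by_contra hne
      exact hall s hs hne i hsi le_rfl hPi
    exact hdet (dt_cr_eq_zero hw.ne_zero (hz m hm (by omega)) (hz (m + 1) (by omega) (by omega))
      (hz (m + 2) (by omega) (by omega)))
  have h1 : (1 : ℝ) ≤ |(dt (P n) w : ℝ)| := by exact_mod_cast Int.one_le_abs hn3
  have h2 := h1.trans (hnear.abs_dt_le (P n))
  have hln := hn₀ n hn1
  have hln1 := hn₀ (n + 1) (by omega)
  have hlni : Real.log (ht (P n)) ≤ Real.log (ht (P (i + 1))) :=
    h.strictMono_log_ht.monotone (by omega)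
  have h3 : (ht (P n) : ℝ) * Real.exp (-φ * Real.log (ht (P (i + 1))) + k) ≤ 1 / 8 := by
    rw [← h.exp_log_ht n, ← Real.exp_add]
    refine exp_le_eighth ?_
    nlinarith [mul_nonneg (sub_nonneg.2 hφ) (h.log_ht_nonneg (i + 1))]
  have h4 : 1 / 2 ≤ |(w 0 : ℝ)| * |val ξ (P n)| := by linarith
  have hw00 : w 0 ≠ 0 := by
    intro h5
    rw [h5, Int.cast_zero, abs_zero, zero_mul] at h4
    norm_num at h4
  have h5 := abs_le_ht_sq hw hw0 hw00 (h.ne_zero (n + 1)) hn4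
  have h6 : (ht (P (n + 1)) : ℝ) ^ 2 * |val ξ (P n)| ≤ 1 / 8 := by
    rw [← h.exp_log_ht (n + 1), ← h.exp_log_val n, sq, ← Real.exp_add, ← Real.exp_add]
    refine exp_le_eighth ?_
    nlinarith [h.log_val n, mul_nonneg (sub_nonneg.2 hφ) (h.log_ht_nonneg (n + 1))]
  have h7 := mul_le_mul_of_nonneg_right h5 (h.val_pos n).le
  linarith

end MinSeq

/-- A sequence of minimal points together with the consequences of the nonvanishing of the
determinants of the cross products of successive points. -/
structure Good (ξ k C : ℝ) (P : ℕ → Fin 3 → ℤ) : Prop extends MinSeq ξ k P where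
  sdet_ne : ∀ i, sdet (cr (P i) (P (i + 1))) ≠ 0
  bound : ∀ (y : Fin 3 → ℤ) (i j : ℕ), sdet y ≠ 0 →
    Near ξ (2 * Real.exp (-φ * Real.log (ht (P j)) + k)) y →
    |(y 0 : ℝ)| ≤ 2 * Real.exp (Real.log (ht (P i)) + Real.log (ht (P (i + 1)))) →
    φ * Real.log (ht (P j)) ≤ Real.log (ht (P i)) + Real.log (ht (P (i + 1))) + C
  le_succ : ∀ i, dt (P i) (cr (P (i + 1)) (P (i + 2))) ≠ 0 →
    φ * Real.log (ht (P (i + 1))) ≤ Real.log (ht (P (i + 2))) + C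
  nonneg_k : 0 ≤ k
  nonneg_C : 0 ≤ C
  val_le_one : ∀ i, |val ξ (P i)| ≤ 1

lemma MinSeq.exists_good {ξ k : ℝ} {P : ℕ → Fin 3 → ℤ} (h : MinSeq ξ k P) (hξ : Indep ξ)
    (hk : 0 ≤ k) : ∃ C Q, Good ξ k C Q := by
  obtain ⟨m₁, hm₁⟩ := h.sdet_ne_zero hξ
  obtain ⟨m, hm, hlog⟩ := h.exists_log_ht_ge k m₁
  have hs := h.shift m
  obtain ⟨C₁, hC₁⟩ := hs.log_ht_bound
  obtain ⟨C₂, hC₂⟩ := hs.le_log_ht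
  refine ⟨max 0 (max C₁ C₂), _, hs, fun i => ?_, fun y i j hy hn h0 => ?_, fun i hi => ?_, hk,
    le_max_left _ _, fun i => ?_⟩
  · rw [show i + 1 + m = i + m + 1 by ring]
    exact hm₁ _ (by omega)
  · linarith [hC₁ y i j hy hn h0, (le_max_left C₁ C₂).trans (le_max_right 0 _)]
  · linarith [hC₂ i hi, (le_max_right C₁ C₂).trans (le_max_right 0 _)]
  · have h1 := hs.log_val i
    have h2 := hlog (i + 1 + m) (by omega)
    have h3 := hs.exp_log_val i
    rw [← h3]
    refine Real.exp_le_one_iff.2 ?_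
    nlinarith [Real.goldenRatio_pos]

namespace Good

variable {ξ k C : ℝ} {P : ℕ → Fin 3 → ℤ}

lemma succ_le (h : Good ξ k C P) (i : ℕ) :
    Real.log (ht (P (i + 1))) ≤ φ * Real.log (ht (P i)) + φ * C := by
  have h1 := h.bound _ i (i + 1) (h.sdet_ne i) (h.near_cr_succ i) (h.abs_cr_succ_le i 0)
  have h2 := Real.goldenRatio_sq
  have h3 := mul_le_mul_of_nonneg_left h1 Real.goldenRatio_pos.le
  linear_combination h3 - Real.log (ht (P (i + 1))) * h2

end Good

end RoyExt

namespace RoyExt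

open scoped goldenRatio

lemma cr_self (x : Fin 3 → ℤ) : cr x x = 0 := by
  refine ext3 ?_ ?_ ?_ <;> simp only [cr_zero, cr_one, cr_two, Pi.zero_apply] <;> ring

lemma cr_eq_zero_of_dt {p q u v : Fin 3 → ℤ} (hpq : cr p q ≠ 0) (hup : dt p u = 0)
    (huq : dt q u = 0) (hvp : dt p v = 0) (hvq : dt q v = 0) : cr u v = 0 := by
  obtain ⟨g, w, hg, hgw, hw⟩ := exists_prim hpq
  have key : ∀ x, dt p x = 0 → dt q x = 0 → ∃ a : ℤ, x = a • w := by
    intro x hp hq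
    refine hw.exists_smul ((smul_eq_zero.1 (?_ : g • cr w x = 0)).resolve_left hg)
    rw [← cr_smul_left, ← hgw]
    rw [dt] at hp hq
    refine ext3 ?_ ?_ ?_ <;> simp only [cr_zero, cr_one, cr_two, Pi.zero_apply]
    · linear_combination q 0 * hp - p 0 * hq
    · linear_combination q 1 * hp - p 1 * hq
    · linear_combination q 2 * hp - p 2 * hq
  obtain ⟨a, rfl⟩ := key u hup huq
  obtain ⟨b, rfl⟩ := key v hvp hvq
  rw [cr_smul_left, cr_smul_right, cr_self, smul_zero, smul_zero]

/-- A sequence of integer points approximating `(1, ξ, ξ ^ 2)` whose logarithmic sizes grow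
geometrically with ratio the golden ratio. -/
structure ExtSeq (ξ K : ℝ) (y : ℕ → Fin 3 → ℤ) (Λ : ℕ → ℝ) : Prop where
  prim : ∀ k, Prim (y k)
  abs_le : ∀ k, |(y k 0 : ℝ)| ≤ Real.exp (Λ k + K)
  near : ∀ k, Near ξ (Real.exp (-Λ k + K)) (y k)
  growth : ∀ k, |Λ (k + 1) - φ * Λ k| ≤ K
  tendsto : Filter.Tendsto Λ Filter.atTop Filter.atTop
  sdet_ne : ∀ k, sdet (y k) ≠ 0
  dt_ne : ∀ k, dt (y k) (cr (y (k + 1)) (y (k + 2))) ≠ 0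

namespace Good

variable {ξ k C : ℝ} {P : ℕ → Fin 3 → ℤ}

lemma exists_extSeq (h : Good ξ k C P) (hξ : Indep ξ) : ∃ K y Λ, ExtSeq ξ K y Λ := by
  classical
  set p : ℕ → Prop := fun i => dt (P i) (cr (P (i + 1)) (P (i + 2))) ≠ 0 with hp
  have hinf : {i | p i}.Infinite := by
    refine Set.infinite_of_not_bddAbove fun ⟨B, hB⟩ => ?_
    obtain ⟨m, hm, hpm⟩ := h.exists_dt_ne_zero hξ (B + 1)
    have := hB hpm
    omega
  set ι : ℕ → ℕ := Nat.nth p with hι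
  have hιp : ∀ n, p (ι n) := Nat.nth_mem_of_infinite hinf
  have hmono : StrictMono ι := Nat.nth_strictMono hinf
  have hgap : ∀ n i, ι n + 1 ≤ i → i < ι (n + 1) → dt (P i) (cr (P (i + 1)) (P (i + 2))) = 0 := by
    intro n i h1 h2
    by_contra hne
    have h3 : ι (Nat.count p i) = i := Nat.nth_count hne
    have h4 : n < Nat.count p i := hmono.lt_iff_lt.1 (by omega)
    have h5 : Nat.count p i < n + 1 := hmono.lt_iff_lt.1 (by omega)
    omega
  have hlt : ∀ n, ι n + 1 ≤ ι (n + 1) := fun n => hmono (Nat.lt_succ_self n)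
  have hex : ∀ n, ∃ (g : ℤ) (w : Fin 3 → ℤ), g ≠ 0 ∧
      cr (P (ι n + 1)) (P (ι n + 2)) = g • w ∧ Prim w :=
    fun n => exists_prim (h.cr_ne_zero (Nat.lt_succ_self _))
  choose g w hg hgw hw using hex
  have hex' : ∀ n, ∃ a : ℤ, a ≠ 0 ∧ cr (P (ι (n + 1))) (P (ι (n + 1) + 1)) = a • w n :=
    fun n => h.exists_smul_of_dt_eq_zero (hlt n) (hw n) (hgw n) (hgap n)
  choose a ha haw using hex'
  set l : ℕ → ℝ := fun i => Real.log (ht (P i)) with hl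
  have hsd : ∀ n, sdet (w n) ≠ 0 := by
    intro n h0
    apply h.sdet_ne (ι n + 1)
    rw [hgw n, sdet_smul, h0, mul_zero]
  have hn0 : ∀ n, |(w n 0 : ℝ)| ≤ 2 * Real.exp (l (ι n + 1) + l (ι n + 2)) := by
    intro n
    have h1 := h.abs_cr_succ_le (ι n + 1) 0
    rw [show ι n + 1 + 1 = ι n + 2 from rfl, hgw n, Pi.smul_apply, smul_eq_mul, Int.cast_mul,
      abs_mul] at h1
    have h2 : (1 : ℝ) ≤ |(g n : ℝ)| := by exact_mod_cast Int.one_le_abs (hg n)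
    have h3 := abs_nonneg (w n 0 : ℝ)
    calc |(w n 0 : ℝ)| ≤ |(g n : ℝ)| * |(w n 0 : ℝ)| := by nlinarith
      _ ≤ _ := h1
  have hnear : ∀ n, Near ξ (2 * Real.exp (-φ * l (ι (n + 1) + 1) + k)) (w n) := by
    intro n
    have h1 := h.near_cr_succ (ι (n + 1))
    rw [haw n] at h1
    exact h1.of_smul (ha n)
  have hφ := Real.goldenRatio_pos
  have hφ2 := Real.goldenRatio_sq
  have hub : ∀ n, φ * l (ι (n + 1) + 1) ≤ φ ^ 2 * l (ι n + 1) + φ ^ 2 * C := by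
    intro n
    have h1 := h.bound (w n) (ι n + 1) (ι (n + 1) + 1) (hsd n) (hnear n) (hn0 n)
    have h2 := h.succ_le (ι n + 1)
    change φ * l (ι (n + 1) + 1) ≤ l (ι n + 1) + l (ι n + 2) + C at h1
    change l (ι n + 2) ≤ φ * l (ι n + 1) + φ * C at h2
    rw [hφ2]
    linarith
  have hlb : ∀ n, φ * l (ι n + 1) - C ≤ l (ι (n + 1) + 1) := by
    intro n
    have h1 := h.le_succ (ι n) (hιp n)
    have h2 : l (ι n + 2) ≤ l (ι (n + 1) + 1) := h.strictMono_log_ht.monotone (by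
      have := hlt n
      omega)
    change φ * l (ι n + 1) ≤ l (ι n + 2) + C at h1
    linarith
  have hC := h.nonneg_C
  have hk := h.nonneg_k
  have hlog2 : Real.log 2 ≤ 1 := by linarith [Real.log_le_sub_one_of_pos (zero_lt_two' ℝ)]
  have h2e : ∀ t, 2 * Real.exp t ≤ Real.exp (1 + t) := fun t => by
    rw [Real.exp_add]
    exact mul_le_mul_of_nonneg_right (by linarith [Real.add_one_le_exp (1 : ℝ)])
      (Real.exp_pos _).le
  refine ⟨φ ^ 3 * C + φ ^ 2 * C + φ * C + k + 1, w, fun n => φ ^ 2 * l (ι n + 1), hw, fun n => ?_,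
    fun n => ?_, fun n => ?_, ?_, hsd, fun n => ?_⟩
  · refine (hn0 n).trans ((h2e _).trans (Real.exp_le_exp.2 ?_))
    have h2 := h.succ_le (ι n + 1)
    change l (ι n + 2) ≤ φ * l (ι n + 1) + φ * C at h2
    have : 0 ≤ φ ^ 3 * C + φ ^ 2 * C := by positivity
    rw [hφ2] at this ⊢
    linarith
  · refine (hnear n).mono ((h2e _).trans (Real.exp_le_exp.2 ?_))
    have h2 := mul_le_mul_of_nonneg_left (hlb n) hφ.le
    have : 0 ≤ φ ^ 3 * C + φ ^ 2 * C := by positivity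
    linarith [this]
  · have h1 := mul_le_mul_of_nonneg_left (hub n) hφ.le
    have h2 := mul_le_mul_of_nonneg_left (hlb n) (sq_nonneg φ)
    have : 0 ≤ φ * C := by positivity
    have : 0 ≤ φ ^ 2 * C := by positivity
    have : 0 ≤ φ ^ 3 * C := by positivity
    rw [abs_le]
    constructor <;> linarith
  · refine Filter.Tendsto.const_mul_atTop (by positivity) (h.tendsto_log_ht.comp ?_)
    exact (Filter.tendsto_add_atTop_nat 1).comp hmono.tendsto_atTop
  · intro h0
    obtain ⟨b, hb, c, hbc⟩ : ∃ b : ℤ, b ≠ 0 ∧ ∃ c : ℤ,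
        c • cr (w (n + 1)) (w (n + 2)) = b • P (ι (n + 2) + 1) := by
      refine ⟨_, hιp (n + 2), a (n + 1) * g (n + 2), ?_⟩
      rw [← cr_cr, haw (n + 1), hgw (n + 2), cr_smul_left, cr_smul_right, smul_smul]
    have e2 : dt (P (ι (n + 2) + 1)) (w n) = 0 := by
      have h1 : dt (c • cr (w (n + 1)) (w (n + 2))) (w n) = 0 := by
        rw [dt_smul_left, show dt (cr (w (n + 1)) (w (n + 2))) (w n) =
          dt (w n) (cr (w (n + 1)) (w (n + 2))) by simp only [dt]; ring, h0, mul_zero]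
      rw [hbc, dt_smul_left] at h1
      exact (mul_eq_zero.1 h1).resolve_left hb
    have f1 : ∀ m, dt (P (ι (m + 1) + 1)) (w m) = 0 := fun m => by
      have h1 := dt_cr_self_right (P (ι (m + 1))) (P (ι (m + 1) + 1))
      rw [haw m, dt_smul_right] at h1
      exact (mul_eq_zero.1 h1).resolve_left (ha m)
    have f2 : dt (P (ι (n + 1) + 1)) (w (n + 1)) = 0 := by
      have h1 := dt_cr_self_left (P (ι (n + 1) + 1)) (P (ι (n + 1) + 2))
      rw [hgw (n + 1), dt_smul_right] at h1
      exact (mul_eq_zero.1 h1).resolve_left (hg (n + 1))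
    have h5 : cr (w n) (w (n + 1)) = 0 :=
      cr_eq_zero_of_dt (h.cr_ne_zero (show ι (n + 1) + 1 < ι (n + 2) + 1 by
        have := hlt (n + 1)
        rw [show n + 1 + 1 = n + 2 from rfl] at this
        omega)) (f1 n) e2 f2 (f1 (n + 1))
    have h1 : dt (P (ι (n + 1))) (cr (P (ι (n + 1) + 1)) (P (ι (n + 1) + 2))) •
        P (ι (n + 1) + 1) = 0 := by
      rw [← cr_cr, haw n, hgw (n + 1), cr_smul_left, cr_smul_right, h5, smul_zero, smul_zero]
    rcases smul_eq_zero.1 h1 with h4 | h4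
    · exact hιp (n + 1) h4
    · exact h.ne_zero _ h4

end Good

end RoyExt

namespace RoyExt

open scoped goldenRatio

lemma block_of_cross {α β K c z : ℝ} (Y : Fin 2 → Fin 3 → ℤ) {q₀ q₁ q₂ G a b : ℤ} (hG : 0 < G)
    (ha : q₀ = G * a) (hb : q₂ = G * b) (hab : IsCoprime a b) (hq₂ : q₂ ≠ 0)
    (hdet : Y 0 0 * Y 1 1 - Y 0 1 * Y 1 0 ≠ 0)
    (hq : ∀ k, q₀ * Y k 0 + q₁ * Y k 1 + q₂ * Y k 2 = 0)
    (h0 : ∀ k, |(Y k 0 : ℝ)| ≤ Real.exp (φ * z + K))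
    (h1 : ∀ k, |(Y k 1 : ℝ) - α * Y k 0| ≤ Real.exp (-z + K))
    (h2 : ∀ k, |(Y k 2 : ℝ) - β * Y k 0| ≤ Real.exp (-z + K))
    (hc : Real.exp (c * z) ≤ max |(a : ℝ)| |(b : ℝ)|) :
    Block α β K c z := by
  have hb0 : b ≠ 0 := by
    rintro rfl
    exact hq₂ (by rw [hb, mul_zero])
  have hbr : (b : ℝ) ≠ 0 := by exact_mod_cast hb0
  have hqr : (q₂ : ℝ) ≠ 0 := by exact_mod_cast hq₂
  have hGr : (G : ℝ) ≠ 0 := by exact_mod_cast hG.ne'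
  have hdr : (Y 0 0 * Y 1 1 - Y 0 1 * Y 1 0 : ℝ) ≠ 0 := by exact_mod_cast hdet
  have hqk : ∀ k, (q₀ * Y k 0 + q₁ * Y k 1 + q₂ * Y k 2 : ℝ) = 0 := fun k => by
    exact_mod_cast hq k
  refine ⟨Y, -a, b, -q₁ / q₂, h0, h1, h2, hab.neg_left, hb0, ?_, fun s => ?_⟩
  · rw [Int.cast_neg, abs_neg]
    have := Real.log_le_log (Real.exp_pos _) hc
    rwa [Real.log_exp] at this
  · set u := (Y 1 1 - s * Y 1 0) / (Y 0 0 * Y 1 1 - Y 0 1 * Y 1 0 : ℝ) with hu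
    set v := (s * Y 0 0 - Y 0 1) / (Y 0 0 * Y 1 1 - Y 0 1 * Y 1 0 : ℝ) with hv
    have e1 : u * Y 0 0 + v * Y 1 0 = 1 := by
      rw [hu, hv, div_mul_eq_mul_div, div_mul_eq_mul_div, ← add_div, div_eq_one_iff_eq hdr]
      ring
    have e2 : u * Y 0 1 + v * Y 1 1 = s := by
      rw [hu, hv, div_mul_eq_mul_div, div_mul_eq_mul_div, ← add_div, div_eq_iff hdr]
      ring
    refine ⟨u, v, e1, e2, ?_⟩
    have e3 : ((-a : ℤ) : ℝ) / b = -q₀ / q₂ := by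
      rw [ha, hb]
      push_cast
      rw [← mul_neg, mul_div_mul_left _ _ hGr]
    rw [e3]
    refine mul_left_cancel₀ hqr ?_
    field_simp
    linear_combination u * hqk 0 + v * hqk 1 - q₀ * e1 - q₁ * e2

lemma exists_gcd (x : ℤ) {y : ℤ} (hy : y ≠ 0) :
    ∃ G a b : ℤ, 0 < G ∧ x = G * a ∧ y = G * b ∧ IsCoprime a b := by
  have hg : (0 : ℤ) < (Int.gcd x y : ℕ) := by exact_mod_cast Int.gcd_pos_of_ne_zero_right _ hy
  obtain ⟨a, ha⟩ := Int.gcd_dvd_left x y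
  obtain ⟨b, hb⟩ := Int.gcd_dvd_right x y
  refine ⟨_, a, b, hg, ha, hb, Int.gcdA x y, Int.gcdB x y, mul_left_cancel₀ hg.ne' ?_⟩
  linear_combination -(Int.gcd_eq_gcd_ab x y) - Int.gcdA x y * ha - Int.gcdB x y * hb

/-- A linear form dividing a quadratic one has height at most that of the quadratic form, unless
the latter is a constant multiple. -/
lemma ht_le_of_dt_eq_zero {p q : Fin 3 → ℤ} (hq : Prim q) (hq2 : q 2 = 0) (hq1 : 1 < ht q)
    (hpq : cr p q ≠ 0) (hE : q 1 ^ 2 * p 0 - q 0 * q 1 * p 1 + q 0 ^ 2 * p 2 = 0) :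
    ht q ≤ ht p := by
  obtain ⟨c, hc⟩ := hq
  rw [dt, hq2, mul_zero, add_zero] at hc
  have hcop : IsCoprime (q 0) (q 1) := ⟨c 0, c 1, hc⟩
  have hht : ht q = max (q 0).natAbs (q 1).natAbs := by simp [ht, hq2]
  have hq0' : q 0 ≠ 0 := by
    intro h
    rw [h, isCoprime_zero_left, Int.isUnit_iff_natAbs_eq] at hcop
    rw [hht, h, hcop] at hq1
    simp at hq1
  have hq1' : q 1 ≠ 0 := by
    intro h
    rw [h, isCoprime_zero_right, Int.isUnit_iff_natAbs_eq] at hcop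
    rw [hht, h, hcop] at hq1
    simp at hq1
  obtain ⟨r₁, hr₁⟩ : q 1 ∣ p 2 := by
    refine (hcop.symm.pow_right (n := 2)).dvd_of_dvd_mul_left ⟨q 0 * p 1 - q 1 * p 0, ?_⟩
    linear_combination hE
  obtain ⟨r₀, hr₀⟩ : q 0 ∣ p 0 := by
    refine (hcop.pow_right (n := 2)).dvd_of_dvd_mul_left ⟨q 1 * p 1 - q 0 * p 2, ?_⟩
    linear_combination hE
  have hp1 : p 1 = q 1 * r₀ + q 0 * r₁ := by
    refine mul_left_cancel₀ (mul_ne_zero hq0' hq1') ?_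
    rw [hr₁, hr₀] at hE
    linear_combination -hE
  have hr1 : r₁ ≠ 0 := by
    rintro rfl
    refine hpq ?_
    rw [mul_zero] at hr₁
    rw [mul_zero, add_zero] at hp1
    refine ext3 ?_ ?_ ?_ <;> simp only [cr_zero, cr_one, cr_two, Pi.zero_apply, hr₁, hr₀, hp1, hq2]
      <;> ring
  have key : ∀ (a b r : ℤ), r ≠ 0 → b = a * r → a.natAbs ≤ b.natAbs := by
    rintro a b r hr rfl
    rw [Int.natAbs_mul]
    exact Nat.le_mul_of_pos_right _ (Int.natAbs_pos.2 hr)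
  rw [hht]
  refine max_le ?_ ((key _ _ _ hr1 hr₁).trans (natAbs_le_ht p 2))
  by_cases h0 : r₀ = 0
  · rw [h0, mul_zero, zero_add] at hp1
    exact (key _ _ _ hr1 hp1).trans (natAbs_le_ht p 1)
  · exact (key _ _ _ h0 hr₀).trans (natAbs_le_ht p 0)

namespace Good

variable {ξ k C : ℝ} {P : ℕ → Fin 3 → ℤ}

lemma apply_two_ne_zero (h : Good ξ k C P) : ∃ m, ∀ i, m ≤ i → P (i + 1) 2 ≠ 0 := by
  have hφ := three_halves_le_goldenRatio
  set D : ℝ := 2 * (2 + |ξ|) with hD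
  have hDpos : 0 < D := by positivity
  obtain ⟨m, -, hm⟩ := h.exists_log_ht_ge (2 * (|Real.log D| + k + 1)) 0
  refine ⟨m, fun i hi h2 => ?_⟩
  set p := P i with hp
  set q := P (i + 1) with hq
  set q' : Fin 3 → ℤ := ![0, q 0, q 1] with hq'
  have hv : val ξ q' = ξ * val ξ q := by
    simp only [val, hq', h2, Matrix.cons_val_zero, Matrix.cons_val_one, Matrix.cons_val]
    push_cast
    ring
  have hh : (ht q' : ℝ) ≤ ht q := by
    refine ht_le fun j => ?_
    fin_cases j
    · simp [hq']
    · exact abs_le_ht q 0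
    · exact abs_le_ht q 1
  have hE : dt p (cr q q') = q 1 ^ 2 * p 0 - q 0 * q 1 * p 1 + q 0 ^ 2 * p 2 := by
    have e0 : q' 0 = 0 := rfl
    have e1 : q' 1 = q 0 := rfl
    have e2 : q' 2 = q 1 := rfl
    simp only [dt, cr_zero, cr_one, cr_two, h2, e0, e1, e2]
    ring
  have hlt : ht p < ht q := h.ht_lt i
  have hpr : (ht p : ℝ) ≤ ht q := by exact_mod_cast hlt.le
  have hvl : |val ξ q| ≤ |val ξ p| := (h.val_lt i).le
  have hb := abs_dt_cr_le ξ p q q'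
  rw [hv, abs_mul] at hb
  have b1 : |val ξ p| * (ht q * ht q') ≤ |val ξ p| * (ht q * ht q) := by gcongr
  have b2 : |val ξ q| * (ht q' * ht p) ≤ |val ξ p| * (ht q * ht q) :=
    mul_le_mul hvl (mul_le_mul hh hpr (by positivity) (by positivity)) (by positivity)
      (abs_nonneg _)
  have b3 : |ξ| * |val ξ q| * (ht p * ht q) ≤ |ξ| * (|val ξ p| * (ht q * ht q)) := by
    rw [mul_assoc]
    exact mul_le_mul_of_nonneg_left (mul_le_mul hvl (mul_le_mul_of_nonneg_right hpr (by positivity))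
      (by positivity) (abs_nonneg _)) (abs_nonneg _)
  have hl := hm (i + 1) (by omega)
  have hsmall : D * (|val ξ p| * (ht q * ht q)) < 1 := by
    rw [← h.exp_log_ht (i + 1), ← h.exp_log_val i, ← Real.exp_add, ← Real.exp_add,
      ← Real.exp_log hDpos, ← Real.exp_add]
    refine (Real.exp_lt_exp.2 ?_).trans_eq Real.exp_zero
    have h3 := h.log_val i
    have h4 := le_abs_self (Real.log D)
    have h5 := mul_nonneg (sub_nonneg.2 hφ) (h.log_ht_nonneg (i + 1))
    rw [sub_mul] at h5
    linarith
  have hE0 : dt p (cr q q') = 0 := by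
    have : |(dt p (cr q q') : ℝ)| < 1 := by
      refine lt_of_le_of_lt hb (lt_of_le_of_lt ?_ hsmall)
      rw [hD]
      linarith
    exact Int.abs_lt_one_iff.1 (by exact_mod_cast this)
  have := ht_le_of_dt_eq_zero (h.prim (i + 1)) h2
    (lt_of_le_of_lt (one_le_ht (h.ne_zero i)) hlt) (h.cr_ne_zero (Nat.lt_succ_self i))
    (hE ▸ hE0)
  exact absurd hlt (not_lt.2 this)

set_option maxHeartbeats 800000 in
lemma exists_block (h : Good ξ k C P) (hξ : Indep ξ) : ∃ K, 0 ≤ K ∧ ∀ Z, ∃ z, Z ≤ z ∧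
    (Block ξ (ξ ^ 2) K (1 / 8) z ∨ Block ξ⁻¹ ξ K (1 / 8) z) := by
  have hφ := three_halves_le_goldenRatio
  have hφ0 := Real.goldenRatio_pos
  have hφ2 := Real.goldenRatio_sq
  have hφ3 := Real.goldenRatio_lt_two
  have hC := h.nonneg_C
  have hk := h.nonneg_k
  have hξ0 : ξ ≠ 0 := by
    intro h0
    have := hξ ![0, 1, 0] (by simp [val, h0])
    simpa using congrFun this 1
  have hξa : 0 < |ξ| := abs_pos.2 hξ0
  set R : ℝ := 1 + |ξ| + |ξ|⁻¹ with hR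
  have hR1 : 1 ≤ R := by
    have : 0 < |ξ|⁻¹ := by positivity
    linarith
  set κ : ℝ := 1 + |ξ| + ξ ^ 2 + (2 + ξ ^ 2) / |ξ| with hκ
  have hκ1 : 1 ≤ κ := by
    have : 0 < (2 + ξ ^ 2) / |ξ| := by positivity
    nlinarith [sq_nonneg ξ]
  have hlogR : 0 ≤ Real.log (2 * R) := Real.log_nonneg (by linarith)
  have hKR : ∀ t, 2 * Real.exp (t + k) * R ≤ Real.exp (t + (Real.log (2 * R) + k + φ * C)) := by
    intro t
    have e : 2 * Real.exp (t + k) * R = Real.exp (t + (Real.log (2 * R) + k)) := by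
      rw [show t + (Real.log (2 * R) + k) = Real.log (2 * R) + (t + k) by ring, Real.exp_add _ (t + k),
        Real.exp_log (by linarith)]
      ring
    rw [e]
    refine Real.exp_le_exp.2 ?_
    have : 0 ≤ φ * C := by positivity
    linarith
  refine ⟨Real.log (2 * R) + k + φ * C, by positivity, fun Z => ?_⟩
  obtain ⟨m₁, hm₁⟩ := h.apply_two_ne_zero
  obtain ⟨m₂, hm₂, hlog⟩ := h.exists_log_ht_ge (|Z| + 4 * Real.log κ) m₁
  obtain ⟨i, hi, hdt⟩ := h.exists_dt_ne_zero hξ m₂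
  have hlogκ : 0 ≤ Real.log κ := Real.log_nonneg hκ1
  have hq2 := hm₁ i (hm₂.trans hi)
  have hl := hlog (i + 1) (by omega)
  set q := P (i + 1) with hq
  set l := Real.log (ht q) with hldef
  have hl0 : 0 ≤ l := h.log_ht_nonneg (i + 1)
  set N : Fin 2 → Fin 3 → ℤ := fun s => cr (P (i + s)) (P (i + s + 1)) with hN
  have hcross : cr (N 0) (N 1) = dt (P i) (cr (P (i + 1)) (P (i + 2))) • q :=
    cr_cr (P i) (P (i + 1)) (P (i + 2))
  have hdot : ∀ s, q 0 * N s 0 + q 1 * N s 1 + q 2 * N s 2 = 0 := by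
    intro s
    fin_cases s
    · exact dt_cr_self_right (P i) (P (i + 1))
    · exact dt_cr_self_left (P (i + 1)) (P (i + 2))
  have hdet : N 0 0 * N 1 1 - N 0 1 * N 1 0 ≠ 0 := by
    have h1 : N 0 0 * N 1 1 - N 0 1 * N 1 0 =
      dt (P i) (cr (P (i + 1)) (P (i + 2))) * q 2 := congrFun hcross 2
    rw [h1]
    exact mul_ne_zero hdt hq2
  have hsz : ∀ s j, |(N s j : ℝ)| ≤ Real.exp (φ * (φ * l) + (Real.log (2 * R) + k + φ * C)) := by
    intro s j
    have h1 : |(N s j : ℝ)| ≤ 2 * Real.exp (φ * (φ * l) + φ * C) := by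
      have hCC : 0 ≤ φ * C := by positivity
      have e : φ * (φ * l) = l + φ * l := by
        rw [← mul_assoc, ← sq, hφ2]
        ring
      fin_cases s
      · refine (h.abs_cr_succ_le i j).trans ?_
        have h2 : Real.log (ht (P i)) < l := h.log_ht_lt i
        have h3 : l ≤ φ * l := by nlinarith
        refine mul_le_mul_of_nonneg_left (Real.exp_le_exp.2 ?_) two_pos.le
        change Real.log (ht (P i)) + l ≤ _
        rw [e]
        linarith
      · refine (h.abs_cr_succ_le (i + 1) j).trans ?_
        have h2 := h.succ_le (i + 1)
        refine mul_le_mul_of_nonneg_left (Real.exp_le_exp.2 ?_) two_pos.le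
        change l + Real.log (ht (P (i + 1 + 1))) ≤ _
        change Real.log (ht (P (i + 1 + 1))) ≤ φ * l + φ * C at h2
        rw [e]
        linarith
    refine h1.trans ?_
    rw [show φ * (φ * l) + (Real.log (2 * R) + k + φ * C) =
      Real.log (2 * R) + (φ * (φ * l) + φ * C + k) by ring, Real.exp_add (Real.log (2 * R)),
      Real.exp_log (by linarith)]
    have : Real.exp (φ * (φ * l) + φ * C) ≤ Real.exp (φ * (φ * l) + φ * C + k) :=
      Real.exp_le_exp.2 (by linarith)
    have h3 := Real.exp_pos (φ * (φ * l) + φ * C)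
    nlinarith
  have hnear : ∀ s, Near ξ (2 * Real.exp (-(φ * l) + k)) (N s) := by
    intro s
    fin_cases s
    · have := h.near_cr_succ i
      rwa [neg_mul] at this
    · refine (h.near_cr_succ (i + 1)).mono ?_
      have h2 : l < Real.log (ht (P (i + 1 + 1))) := h.log_ht_lt (i + 1)
      gcongr
      nlinarith
  have hb0 : 0 ≤ 2 * Real.exp (-(φ * l) + k) := by positivity
  have hbR : 2 * Real.exp (-(φ * l) + k) ≤ 2 * Real.exp (-(φ * l) + k) * R := by nlinarith
  refine ⟨φ * l, by nlinarith [le_abs_self Z], ?_⟩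
  obtain ⟨G₀, a₀, b₀, hG₀, ha₀, hb₀, hab₀⟩ := exists_gcd (q 0) hq2
  obtain ⟨G₁, a₁, b₁, hG₁, ha₁, hb₁, hab₁⟩ := exists_gcd (q 1) hq2
  have hGG : G₀ * G₁ ≤ |q 2| := by
    obtain ⟨c, hc⟩ := h.prim (i + 1)
    have hcop : IsCoprime G₀ G₁ := by
      refine ⟨c 0 * a₀ + c 2 * b₀, c 1 * a₁, ?_⟩
      change c 0 * q 0 + c 1 * q 1 + c 2 * q 2 = 1 at hc
      linear_combination hc - c 0 * ha₀ - c 1 * ha₁ - c 2 * hb₀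
    exact Int.le_of_dvd (abs_pos.2 hq2) ((dvd_abs _ _).2 (hcop.mul_dvd ⟨b₀, hb₀⟩ ⟨b₁, hb₁⟩))
  have hGGr : (G₀ * G₁ : ℝ) ≤ Real.exp l := by
    rw [hldef, h.exp_log_ht]
    refine le_trans ?_ (abs_le_ht q 2)
    exact_mod_cast hGG
  have hq2r : (1 : ℝ) ≤ |(q 2 : ℝ)| := by exact_mod_cast Int.one_le_abs hq2
  have hvq : |val ξ q| ≤ 1 := h.val_le_one (i + 1)
  have key : ∀ (x : ℤ) (G a b : ℤ), 0 < G → x = G * a → q 2 = G * b → (G : ℝ) ^ 2 ≤ Real.exp l →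
      Real.exp l ≤ κ * max |(x : ℝ)| |(q 2 : ℝ)| →
      Real.exp (1 / 8 * (φ * l)) ≤ max |(a : ℝ)| |(b : ℝ)| := by
    intro x G a b hG hx hb hG2 hmax
    have hGr : (0 : ℝ) < G := by exact_mod_cast hG
    rw [hx, hb] at hmax
    push_cast at hmax
    rw [abs_mul, abs_mul, ← mul_max_of_nonneg _ _ (abs_nonneg _), abs_of_pos hGr] at hmax
    set M := max |(a : ℝ)| |(b : ℝ)| with hM
    have hM0 : 0 ≤ M := (abs_nonneg _).trans (le_max_left _ _)
    have e1 : Real.exp l * Real.exp l ≤ (κ * M) ^ 2 * Real.exp l := by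
      calc Real.exp l * Real.exp l ≤ (κ * (G * M)) * (κ * (G * M)) :=
            mul_le_mul hmax hmax (Real.exp_pos _).le (by positivity)
        _ = (κ * M) ^ 2 * G ^ 2 := by ring
        _ ≤ _ := by gcongr
    have e2 : Real.exp l ≤ (κ * M) ^ 2 := le_of_mul_le_mul_right e1 (Real.exp_pos _)
    have e3 : κ * Real.exp (1 / 8 * (φ * l)) ≤ Real.exp (l / 2) := by
      rw [← Real.exp_log (lt_of_lt_of_le one_pos hκ1), ← Real.exp_add]
      refine Real.exp_le_exp.2 ?_
      nlinarith [abs_nonneg Z]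
    have e4 : (κ * Real.exp (1 / 8 * (φ * l))) ^ 2 ≤ (κ * M) ^ 2 := by
      refine (pow_le_pow_left₀ (by positivity) e3 2).trans (le_of_eq_of_le ?_ e2)
      rw [← Real.exp_nat_mul]
      congr 1
      push_cast
      ring
    have e5 := le_of_sq_le_sq e4 (by positivity)
    exact le_of_mul_le_mul_left e5 (by linarith)
  have hXle : ∀ M : ℝ, |(q 0 : ℝ)| ≤ κ * M → |(q 1 : ℝ)| ≤ κ * M → |(q 2 : ℝ)| ≤ κ * M →
      Real.exp l ≤ κ * M := by
    intro M h0 h1 h2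
    rw [hldef, h.exp_log_ht]
    refine ht_le fun j => ?_
    fin_cases j
    exacts [h0, h1, h2]
  have hdiv : 0 ≤ (2 + ξ ^ 2) / |ξ| := by positivity
  rcases le_total G₀ G₁ with hle | hle
  · left
    have hG2 : (G₀ : ℝ) ^ 2 ≤ Real.exp l := by
      have h1 : (G₀ : ℝ) ≤ G₁ := by exact_mod_cast hle
      have h2 : (0 : ℝ) < G₀ := by exact_mod_cast hG₀
      nlinarith
    refine block_of_cross (q₁ := q 1) N hG₀ ha₀ hb₀ hab₀ hq2 hdet hdot (fun s => hsz s 0)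
      (fun s => (hnear s).1.trans (hbR.trans (hKR _)))
      (fun s => (hnear s).2.trans (hbR.trans (hKR _))) (key _ _ _ _ hG₀ ha₀ hb₀ hG2 ?_)
    set M := max |(q 0 : ℝ)| |(q 2 : ℝ)| with hM
    have hM0 : |(q 0 : ℝ)| ≤ M := le_max_left _ _
    have hM2 : |(q 2 : ℝ)| ≤ M := le_max_right _ _
    have hMκ : M ≤ κ * M := by nlinarith
    refine hXle M (hM0.trans hMκ) ?_ (hM2.trans hMκ)
    have e1 : (q 1 : ℝ) * ξ = val ξ q - q 0 - q 2 * ξ ^ 2 := by rw [val]; ring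
    have e2 : |(q 1 : ℝ)| * |ξ| ≤ (2 + ξ ^ 2) * M := by
      rw [← abs_mul, e1]
      refine (abs_sub _ _).trans ?_
      rw [abs_mul, abs_of_nonneg (sq_nonneg ξ)]
      have := abs_sub (val ξ q) (q 0)
      have := mul_le_mul_of_nonneg_right hM2 (sq_nonneg ξ)
      linarith
    have e3 : |(q 1 : ℝ)| ≤ (2 + ξ ^ 2) / |ξ| * M := by
      rw [div_mul_eq_mul_div, le_div_iff₀ hξa]
      exact e2
    refine e3.trans (mul_le_mul_of_nonneg_right ?_ (by linarith))
    rw [hκ]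
    linarith [sq_nonneg ξ]
  · right
    have hG2 : (G₁ : ℝ) ^ 2 ≤ Real.exp l := by
      have h1 : (G₁ : ℝ) ≤ G₀ := by exact_mod_cast hle
      have h2 : (0 : ℝ) < G₁ := by exact_mod_cast hG₁
      nlinarith
    refine block_of_cross (q₁ := q 0) (fun s => ![N s 1, N s 0, N s 2]) hG₁ ha₁ hb₁ hab₁ hq2 ?_
      (fun s => ?_) (fun s => hsz s 1) (fun s => ?_) (fun s => ?_) (key _ _ _ _ hG₁ ha₁ hb₁ hG2 ?_)
    · intro h0
      apply hdet
      change N 0 1 * N 1 0 - N 0 0 * N 1 1 = 0 at h0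
      linear_combination -h0
    · change q 1 * N s 1 + q 0 * N s 0 + q 2 * N s 2 = 0
      linear_combination hdot s
    · change |(N s 0 : ℝ) - ξ⁻¹ * N s 1| ≤ _
      refine le_trans ?_ (hKR _)
      have e : (N s 0 : ℝ) - ξ⁻¹ * N s 1 = -(ξ⁻¹ * (N s 1 - ξ * N s 0)) := by
        field_simp
        ring
      rw [e, abs_neg, abs_mul, abs_inv, mul_comm]
      exact mul_le_mul (hnear s).1 (by linarith) (by positivity) hb0
    · change |(N s 2 : ℝ) - ξ * N s 1| ≤ _
      refine le_trans ?_ (hKR _)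
      have e : (N s 2 : ℝ) - ξ * N s 1 = (N s 2 - ξ ^ 2 * N s 0) - ξ * (N s 1 - ξ * N s 0) := by
        ring
      rw [e]
      refine (abs_sub _ _).trans ?_
      rw [abs_mul]
      have h1 := (hnear s).2
      have h2 := mul_le_mul_of_nonneg_left (hnear s).1 (abs_nonneg ξ)
      have h3 : 0 ≤ 2 * Real.exp (-(φ * l) + k) * |ξ|⁻¹ := by positivity
      rw [hR]
      linarith
    · set M := max |(q 1 : ℝ)| |(q 2 : ℝ)| with hM
      have hM1 : |(q 1 : ℝ)| ≤ M := le_max_left _ _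
      have hM2 : |(q 2 : ℝ)| ≤ M := le_max_right _ _
      have hMκ : M ≤ κ * M := by nlinarith
      refine hXle M ?_ (hM1.trans hMκ) (hM2.trans hMκ)
      have e1 : (q 0 : ℝ) = val ξ q - q 1 * ξ - q 2 * ξ ^ 2 := by rw [val]; ring
      have e2 : |(q 0 : ℝ)| ≤ (1 + |ξ| + ξ ^ 2) * M := by
        rw [e1]
        refine (abs_sub _ _).trans ?_
        rw [abs_mul, abs_of_nonneg (sq_nonneg ξ)]
        have := abs_sub (val ξ q) (q 1 * ξ)
        rw [abs_mul] at this
        have := mul_le_mul_of_nonneg_right hM2 (sq_nonneg ξ)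
        have := mul_le_mul_of_nonneg_right hM1 (abs_nonneg ξ)
        linarith
      refine e2.trans (mul_le_mul_of_nonneg_right ?_ (by linarith))
      rw [hκ]
      linarith

/-- The transcendence of the underlying number. -/
lemma transcendental (h : Good ξ k C P) (hξ : Indep ξ) : Transcendental ℚ ξ := by
  intro halg
  obtain ⟨K, hK, hblock⟩ := h.exists_block hξ
  have h1 := not_forall_exists_block (c := 1 / 8) halg (halg.pow 2) hK (by norm_num)
  have h2 := not_forall_exists_block (c := 1 / 8) halg.inv halg hK (by norm_num)
  push Not at h1 h2
  obtain ⟨Z₁, hZ₁⟩ := h1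
  obtain ⟨Z₂, hZ₂⟩ := h2
  obtain ⟨z, hz, hb | hb⟩ := hblock (max Z₁ Z₂)
  · exact hZ₁ z ((le_max_left _ _).trans hz) hb
  · exact hZ₂ z ((le_max_right _ _).trans hz) hb

end Good

end RoyExt

namespace RoyExt

open scoped goldenRatio

/-- The product `x * adjugate z * x` of symmetric `2 × 2` matrices. -/
def sandwich (x z : Fin 3 → ℤ) : Fin 3 → ℤ :=
  ![x 0 ^ 2 * z 2 - 2 * (x 0 * x 1 * z 1) + x 1 ^ 2 * z 0,
    x 0 * x 1 * z 2 - (x 0 * x 2 + x 1 ^ 2) * z 1 + x 1 * x 2 * z 0,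
    x 1 ^ 2 * z 2 - 2 * (x 1 * x 2 * z 1) + x 2 ^ 2 * z 0]

lemma sandwich_zero (x z : Fin 3 → ℤ) :
    sandwich x z 0 = x 0 ^ 2 * z 2 - 2 * (x 0 * x 1 * z 1) + x 1 ^ 2 * z 0 := rfl

lemma sandwich_one (x z : Fin 3 → ℤ) : sandwich x z 1 =
    x 0 * x 1 * z 2 - (x 0 * x 2 + x 1 ^ 2) * z 1 + x 1 * x 2 * z 0 := rfl

lemma sandwich_two (x z : Fin 3 → ℤ) :
    sandwich x z 2 = x 1 ^ 2 * z 2 - 2 * (x 1 * x 2 * z 1) + x 2 ^ 2 * z 0 := rfl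

lemma sandwich_smul (a b : ℤ) (x z : Fin 3 → ℤ) :
    sandwich (a • x) (b • z) = (a ^ 2 * b) • sandwich x z := by
  refine ext3 ?_ ?_ ?_ <;>
    simp only [sandwich_zero, sandwich_one, sandwich_two, Pi.smul_apply, smul_eq_mul] <;> ring

lemma sandwich_sandwich (x z : Fin 3 → ℤ) :
    sandwich x (sandwich x z) = (sdet x ^ 2) • z := by
  refine ext3 ?_ ?_ ?_ <;>
    simp only [sandwich_zero, sandwich_one, sandwich_two, Pi.smul_apply, smul_eq_mul, sdet] <;> ring

lemma abs_mul_le_mul {p q P Q : ℝ} (hp : |p| ≤ P) (hq : |q| ≤ Q) : |p * q| ≤ P * Q := by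
  rw [abs_mul]
  exact mul_le_mul hp hq (abs_nonneg _) ((abs_nonneg _).trans hp)

lemma abs_sub_le_add {p q P Q : ℝ} (hp : |p| ≤ P) (hq : |q| ≤ Q) : |p - q| ≤ P + Q :=
  (abs_sub _ _).trans (add_le_add hp hq)

lemma abs_add_le_add {p q P Q : ℝ} (hp : |p| ≤ P) (hq : |q| ≤ Q) : |p + q| ≤ P + Q :=
  (abs_add_le _ _).trans (add_le_add hp hq)

lemma abs_sandwich_zero_le {ξ X Z A B : ℝ} {x z : Fin 3 → ℤ} (hx : Near ξ A x) (hz : Near ξ B z)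
    (hX : |(x 0 : ℝ)| ≤ X) (hZ : |(z 0 : ℝ)| ≤ Z) :
    |(sandwich x z 0 : ℝ)| ≤ X * X * (B + 2 * |ξ| * B) + 2 * X * (A * B) + A * A * Z := by
  have e : (sandwich x z 0 : ℝ) = x 0 * x 0 * ((z 2 - ξ ^ 2 * z 0) - 2 * ξ * (z 1 - ξ * z 0)) -
      2 * x 0 * ((x 1 - ξ * x 0) * (z 1 - ξ * z 0)) + (x 1 - ξ * x 0) * (x 1 - ξ * x 0) * z 0 := by
    rw [sandwich_zero]
    push_cast
    ring
  rw [e]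
  have h2 : |(2 : ℝ)| ≤ 2 := by norm_num
  exact abs_add_le_add (abs_sub_le_add (abs_mul_le_mul (abs_mul_le_mul hX hX)
    (abs_sub_le_add hz.2 (abs_mul_le_mul (abs_mul_le_mul h2 le_rfl) hz.1)))
    (abs_mul_le_mul (abs_mul_le_mul h2 hX) (abs_mul_le_mul hx.1 hz.1)))
    (abs_mul_le_mul (abs_mul_le_mul hx.1 hx.1) hZ)

lemma sandwich_one_sub (ξ : ℝ) (x z : Fin 3 → ℤ) :
    (sandwich x z 1 : ℝ) - ξ * sandwich x z 0 =
      (x 1 - ξ * x 0) * ((x 0 : ℝ) * ((z 2 - ξ ^ 2 * z 0) - ξ * (z 1 - ξ * z 0)) -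
        (x 1 - ξ * x 0) * (ξ * z 0 + (z 1 - ξ * z 0))) -
      ((x 2 - ξ ^ 2 * x 0) - ξ * (x 1 - ξ * x 0)) *
        ((x 0 : ℝ) * (z 1 - ξ * z 0) - (x 1 - ξ * x 0) * z 0) := by
  rw [sandwich_one, sandwich_zero]
  push_cast
  ring

lemma sandwich_two_sub (ξ : ℝ) (x z : Fin 3 → ℤ) :
    (sandwich x z 2 : ℝ) - ξ ^ 2 * sandwich x z 0 =
      ((x 1 - ξ * x 0) * (((z 2 - ξ ^ 2 * z 0) - ξ * (z 1 - ξ * z 0)) * (ξ * x 0) -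
          z 0 * (ξ * ((x 2 - ξ ^ 2 * x 0) - ξ * (x 1 - ξ * x 0))) +
          ((z 2 - ξ ^ 2 * z 0) * (x 1 - ξ * x 0) - (z 1 - ξ * z 0) * (x 2 - ξ ^ 2 * x 0))) +
        ((x 2 - ξ ^ 2 * x 0) - ξ * (x 1 - ξ * x 0)) *
          ((z 0 : ℝ) * ((x 2 - ξ ^ 2 * x 0) - ξ * (x 1 - ξ * x 0)) -
            (z 1 - ξ * z 0) * (ξ * x 0 + (x 1 - ξ * x 0)))) +
      ξ * (sandwich x z 1 - ξ * sandwich x z 0) := by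
  rw [sandwich_one, sandwich_zero, sandwich_two]
  push_cast
  ring

set_option maxHeartbeats 1000000 in
lemma near_sandwich {ξ X Z A B : ℝ} {x z : Fin 3 → ℤ} (hx : Near ξ A x) (hz : Near ξ B z)
    (hX : |(x 0 : ℝ)| ≤ X) (hZ : |(z 0 : ℝ)| ≤ Z) :
    Near ξ (2 * (1 + |ξ|) ^ 4 * (A * (X * B + A * Z + 2 * (A * B)))) (sandwich x z) := by
  obtain ⟨s, hs⟩ : ∃ s, s = |ξ| := ⟨_, rfl⟩
  have hs0 : 0 ≤ s := hs ▸ abs_nonneg _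
  have hs1 : |ξ| ≤ s := hs.ge
  have hA : 0 ≤ A := (abs_nonneg _).trans hx.1
  have hB : 0 ≤ B := (abs_nonneg _).trans hz.1
  have hX0 : 0 ≤ X := (abs_nonneg _).trans hX
  have hZ0 : 0 ≤ Z := (abs_nonneg _).trans hZ
  obtain ⟨a₁, ha₁⟩ : ∃ a₁, a₁ = (x 1 : ℝ) - ξ * x 0 := ⟨_, rfl⟩
  obtain ⟨a₂, ha₂⟩ : ∃ a₂, a₂ = (x 2 : ℝ) - ξ ^ 2 * x 0 := ⟨_, rfl⟩
  obtain ⟨b₁, hb₁⟩ : ∃ b₁, b₁ = (z 1 : ℝ) - ξ * z 0 := ⟨_, rfl⟩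
  obtain ⟨b₂, hb₂⟩ : ∃ b₂, b₂ = (z 2 : ℝ) - ξ ^ 2 * z 0 := ⟨_, rfl⟩
  have hxA := hx
  have hzB := hz
  rw [Near, ← ha₁, ← ha₂] at hxA
  rw [Near, ← hb₁, ← hb₂] at hzB
  obtain ⟨hA₁, hA₂⟩ := hxA
  obtain ⟨hB₁, hB₂⟩ := hzB
  obtain ⟨T, hT⟩ : ∃ T, T = X * B + A * Z + 2 * (A * B) := ⟨_, rfl⟩
  rw [← hs, ← hT]
  have hXB : 0 ≤ X * B := by positivity
  have hAZ : 0 ≤ A * Z := by positivity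
  have hAB : 0 ≤ A * B := by positivity
  have hT0 : 0 ≤ T := by rw [hT]; positivity
  have hf : |(x 0 : ℝ) * b₁ - a₁ * z 0| ≤ T :=
    (abs_sub_le_add (abs_mul_le_mul hX hB₁) (abs_mul_le_mul hA₁ hZ)).trans (by linarith)
  have hab : |a₂ - ξ * a₁| ≤ (1 + s) * A :=
    (abs_sub_le_add hA₂ (abs_mul_le_mul hs1 hA₁)).trans (by linarith)
  have hbb : |b₂ - ξ * b₁| ≤ (1 + s) * B :=
    (abs_sub_le_add hB₂ (abs_mul_le_mul hs1 hB₁)).trans (by linarith)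
  have he₁ : |(x 0 : ℝ) * (b₂ - ξ * b₁) - a₁ * (ξ * z 0 + b₁)| ≤ (1 + s) ^ 2 * T := by
    refine (abs_sub_le_add (abs_mul_le_mul hX hbb) (abs_mul_le_mul hA₁
      (abs_add_le_add (abs_mul_le_mul hs1 hZ) hB₁))).trans ?_
    have : X * ((1 + s) * B) + A * (s * Z + B) ≤ (1 + s) * T := by
      rw [hT]
      nlinarith [mul_nonneg hs0 hAB]
    refine this.trans (mul_le_mul_of_nonneg_right ?_ hT0)
    nlinarith
  have he₂ : |(z 0 : ℝ) * (a₂ - ξ * a₁) - b₁ * (ξ * x 0 + a₁)| ≤ (1 + s) ^ 2 * T := by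
    refine (abs_sub_le_add (abs_mul_le_mul hZ hab) (abs_mul_le_mul hB₁
      (abs_add_le_add (abs_mul_le_mul hs1 hX) hA₁))).trans ?_
    have : Z * ((1 + s) * A) + B * (s * X + A) ≤ (1 + s) * T := by
      rw [hT]
      nlinarith [mul_nonneg hs0 hAB]
    refine this.trans (mul_le_mul_of_nonneg_right ?_ hT0)
    nlinarith
  have he₃ : |(b₂ - ξ * b₁) * (ξ * x 0) - z 0 * (ξ * (a₂ - ξ * a₁)) + (b₂ * a₁ - b₁ * a₂)| ≤
      (1 + s) ^ 2 * T := by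
    refine (abs_add_le_add (abs_sub_le_add (abs_mul_le_mul hbb (abs_mul_le_mul hs1 hX))
      (abs_mul_le_mul hZ (abs_mul_le_mul hs1 hab))) (abs_sub_le_add (abs_mul_le_mul hB₂ hA₁)
      (abs_mul_le_mul hB₁ hA₂))).trans ?_
    have h1 : s * (1 + s) ≤ (1 + s) ^ 2 := by nlinarith
    have h2 : 1 ≤ (1 + s) ^ 2 := by nlinarith
    have h3 := mul_le_mul_of_nonneg_right h1 hXB
    have h4 := mul_le_mul_of_nonneg_right h1 hAZ
    have h5 := mul_le_mul_of_nonneg_right h2 hAB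
    rw [hT]
    linarith
  have e1 := sandwich_one_sub ξ x z
  have e2 := sandwich_two_sub ξ x z
  rw [← ha₁, ← ha₂, ← hb₁, ← hb₂] at e1 e2
  have hAT : 0 ≤ A * T := by positivity
  have b1 : |(sandwich x z 1 : ℝ) - ξ * sandwich x z 0| ≤ 2 * (1 + s) ^ 3 * (A * T) := by
    rw [e1]
    refine (abs_sub_le_add (abs_mul_le_mul hA₁ he₁) (abs_mul_le_mul hab hf)).trans ?_
    have h1 : (1 + s) ^ 2 + (1 + s) ≤ 2 * (1 + s) ^ 3 := by
      nlinarith [pow_nonneg hs0 2, pow_nonneg hs0 3]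
    exact le_trans (le_of_eq (by ring)) (mul_le_mul_of_nonneg_right h1 hAT)
  refine ⟨b1.trans ?_, ?_⟩
  · gcongr
    · linarith
    · norm_num
  · rw [e2]
    refine (abs_add_le_add (abs_add_le_add (abs_mul_le_mul hA₁ he₃) (abs_mul_le_mul hab he₂))
      (abs_mul_le_mul hs1 b1)).trans ?_
    have h1 : (1 + s) ^ 2 + (1 + s) ^ 3 + 2 * (s * (1 + s) ^ 3) ≤ 2 * (1 + s) ^ 4 := by
      nlinarith [pow_nonneg hs0 2, pow_nonneg hs0 3, pow_nonneg hs0 4]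
    exact le_trans (le_of_eq (by ring)) (mul_le_mul_of_nonneg_right h1 hAT)

lemma abs_dt_cr_le_of_near {ξ X Y Z A B C : ℝ} {x y z : Fin 3 → ℤ} (hx : Near ξ A x)
    (hy : Near ξ B y) (hz : Near ξ C z) (hX : |(x 0 : ℝ)| ≤ X) (hY : |(y 0 : ℝ)| ≤ Y)
    (hZ : |(z 0 : ℝ)| ≤ Z) :
    |(dt x (cr y z) : ℝ)| ≤ 2 * (X * (B * C) + Y * (A * C) + Z * (A * B)) := by
  have e : (dt x (cr y z) : ℝ) =
      x 0 * ((y 1 - ξ * y 0) * (z 2 - ξ ^ 2 * z 0) - (y 2 - ξ ^ 2 * y 0) * (z 1 - ξ * z 0)) -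
      y 0 * ((x 1 - ξ * x 0) * (z 2 - ξ ^ 2 * z 0) - (x 2 - ξ ^ 2 * x 0) * (z 1 - ξ * z 0)) +
      z 0 * ((x 1 - ξ * x 0) * (y 2 - ξ ^ 2 * y 0) - (x 2 - ξ ^ 2 * x 0) * (y 1 - ξ * y 0)) := by
    simp only [dt, cr_zero, cr_one, cr_two]
    push_cast
    ring
  rw [e]
  have key := fun {b c : ℝ} {u v : Fin 3 → ℤ} (hu : Near ξ b u) (hv : Near ξ c v) =>
    abs_sub_le_add (abs_mul_le_mul hu.1 hv.2) (abs_mul_le_mul hu.2 hv.1)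
  refine (abs_add_le_add (abs_sub_le_add (abs_mul_le_mul hX (key hy hz))
    (abs_mul_le_mul hY (key hx hz))) (abs_mul_le_mul hZ (key hx hy))).trans (le_of_eq ?_)
  ring

end RoyExt

namespace RoyExt

open scoped goldenRatio

lemma ExtSeq.shift {ξ K : ℝ} {y : ℕ → Fin 3 → ℤ} {Λ : ℕ → ℝ} (h : ExtSeq ξ K y Λ) (m : ℕ) :
    ExtSeq ξ K (fun k => y (k + m)) (fun k => Λ (k + m)) where
  prim k := h.prim _
  abs_le k := h.abs_le _
  near k := h.near _
  growth k := by
    have := h.growth (k + m)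
    rwa [show k + m + 1 = k + 1 + m by ring] at this
  tendsto := h.tendsto.comp (Filter.tendsto_add_atTop_nat m)
  sdet_ne k := h.sdet_ne _
  dt_ne k := by
    have := h.dt_ne (k + m)
    rwa [show k + m + 1 = k + 1 + m by ring, show k + m + 2 = k + 2 + m by ring] at this

lemma dt_cr_eq_zero_of_near {ξ a b c K : ℝ} {x y z : Fin 3 → ℤ}
    (hx : Near ξ (Real.exp (-a + K)) x) (hy : Near ξ (Real.exp (-b + K)) y)
    (hz : Near ξ (Real.exp (-c + K)) z) (hX : |(x 0 : ℝ)| ≤ Real.exp (a + K))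
    (hY : |(y 0 : ℝ)| ≤ Real.exp (b + K)) (hZ : |(z 0 : ℝ)| ≤ Real.exp (c + K))
    (h1 : a - b - c + 3 * K ≤ -3) (h2 : b - a - c + 3 * K ≤ -3) (h3 : c - a - b + 3 * K ≤ -3) :
    dt x (cr y z) = 0 := by
  have key := abs_dt_cr_le_of_near hx hy hz hX hY hZ
  simp only [← Real.exp_add] at key
  have e1 := exp_le_eighth h1
  have e2 := exp_le_eighth h2
  have e3 := exp_le_eighth h3
  rw [show a + K + (-b + K + (-c + K)) = a - b - c + 3 * K by ring,
    show b + K + (-a + K + (-c + K)) = b - a - c + 3 * K by ring,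
    show c + K + (-a + K + (-b + K)) = c - a - b + 3 * K by ring] at key
  have : |(dt x (cr y z) : ℝ)| < 1 := by linarith
  rw [← Int.cast_abs] at this
  exact Int.abs_lt_one_iff.1 (by exact_mod_cast this)

lemma near_sandwich_exp {ξ K b d e : ℝ} {x z : Fin 3 → ℤ} (hK : 0 ≤ K)
    (hx : Near ξ (Real.exp (-d + K)) x) (hz : Near ξ (Real.exp (-e + K)) z)
    (hX : |(x 0 : ℝ)| ≤ Real.exp (d + K)) (hZ : |(z 0 : ℝ)| ≤ Real.exp (e + K))
    (hb : 0 ≤ b) (hd : 0 ≤ d) (hbe : b ≤ e) (h : |2 * d - e - b| ≤ 2 * K) :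
    |(sandwich x z 0 : ℝ)| ≤ Real.exp (b + (5 * K + Real.log (8 * (1 + |ξ|) ^ 4))) ∧
      Near ξ (Real.exp (-b + (5 * K + Real.log (8 * (1 + |ξ|) ^ 4)))) (sandwich x z) := by
  have hs : 0 ≤ |ξ| := abs_nonneg _
  obtain ⟨h1, h2⟩ := abs_le.1 h
  have hD : (0 : ℝ) < 8 * (1 + |ξ|) ^ 4 := by positivity
  have hexp : ∀ t, Real.exp (t + (5 * K + Real.log (8 * (1 + |ξ|) ^ 4))) =
      8 * (1 + |ξ|) ^ 4 * Real.exp (t + 5 * K) := fun t => by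
    rw [← add_assoc, Real.exp_add, Real.exp_log hD, mul_comm]
  rw [hexp, hexp]
  constructor
  · have key := abs_sandwich_zero_le hx hz hX hZ
    refine key.trans ?_
    have e1 : Real.exp (d + K) * Real.exp (d + K) * Real.exp (-e + K) ≤ Real.exp (b + 5 * K) := by
      rw [← Real.exp_add, ← Real.exp_add, Real.exp_le_exp]
      linarith
    have e2 : Real.exp (d + K) * (Real.exp (-d + K) * Real.exp (-e + K)) ≤
        Real.exp (b + 5 * K) := by
      rw [← Real.exp_add, ← Real.exp_add, Real.exp_le_exp]
      linarith
    have e3 : Real.exp (-d + K) * Real.exp (-d + K) * Real.exp (e + K) ≤ Real.exp (b + 5 * K) := by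
      rw [← Real.exp_add, ← Real.exp_add, Real.exp_le_exp]
      linarith
    have h4 : 4 + 2 * |ξ| ≤ 8 * (1 + |ξ|) ^ 4 := by
      nlinarith [pow_nonneg hs 2, pow_nonneg hs 3, pow_nonneg hs 4]
    refine le_trans ?_ (mul_le_mul_of_nonneg_right h4 (Real.exp_pos _).le)
    have e4 := mul_le_mul_of_nonneg_left e1 hs
    linarith
  · refine (near_sandwich hx hz hX hZ).mono ?_
    rw [show 8 * (1 + |ξ|) ^ 4 * Real.exp (-b + 5 * K) =
      2 * (1 + |ξ|) ^ 4 * (4 * Real.exp (-b + 5 * K)) by ring]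
    refine mul_le_mul_of_nonneg_left ?_ (by positivity)
    have e1 : Real.exp (-d + K) * (Real.exp (d + K) * Real.exp (-e + K)) ≤
        Real.exp (-b + 5 * K) := by
      rw [← Real.exp_add, ← Real.exp_add, Real.exp_le_exp]
      linarith
    have e2 : Real.exp (-d + K) * (Real.exp (-d + K) * Real.exp (-e + K)) ≤
        Real.exp (-b + 5 * K) := by
      rw [← Real.exp_add, ← Real.exp_add, Real.exp_le_exp]
      linarith
    have e3 : Real.exp (-d + K) * (Real.exp (-d + K) * Real.exp (e + K)) ≤
        Real.exp (-b + 5 * K) := by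
      rw [← Real.exp_add, ← Real.exp_add, Real.exp_le_exp]
      linarith
    linarith

/-- The sequence is determined by three consecutive terms. -/
def Recurrent (y : ℕ → Fin 3 → ℤ) : Prop :=
  ∀ n, ∃ c d : ℤ, c ≠ 0 ∧ c • y (n + 3) = d • sandwich (y (n + 2)) (y n)

lemma ExtSeq.exists_sandwich {ξ K : ℝ} {y : ℕ → Fin 3 → ℤ} {Λ : ℕ → ℝ} (h : ExtSeq ξ K y Λ)
    {K' : ℝ} (hK' : K' = 5 * K + Real.log (8 * (1 + |ξ|) ^ 4)) {n : ℕ}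
    (hΛ : ∀ k, n ≤ k → 12 * (K' + 1) ≤ Λ k) :
    ∃ t : ℤ, sandwich (y (n + 3)) (y (n + 4)) = t • y (n + 1) := by
  have hK : 0 ≤ K := (abs_nonneg _).trans (h.growth 0)
  have hlog : 0 ≤ Real.log (8 * (1 + |ξ|) ^ 4) := by
    refine Real.log_nonneg ?_
    have : (1 : ℝ) ≤ (1 + |ξ|) ^ 4 := one_le_pow₀ (by linarith [abs_nonneg ξ])
    linarith
  have hKK' : K ≤ K' := by linarith
  have ha := hΛ n le_rfl
  have hb := hΛ (n + 1) (by lia)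
  have hc := hΛ (n + 2) (by lia)
  have hd := hΛ (n + 3) (by lia)
  have he := hΛ (n + 4) (by lia)
  obtain ⟨g1, g1'⟩ := _root_.abs_le.1 (h.growth n)
  obtain ⟨g2, g2'⟩ := _root_.abs_le.1 (h.growth (n + 1))
  obtain ⟨g3, g3'⟩ := _root_.abs_le.1 (h.growth (n + 2))
  obtain ⟨g4, g4'⟩ := _root_.abs_le.1 (h.growth (n + 3))
  have hφ := three_halves_le_goldenRatio
  have hφ' : φ ≤ 13 / 8 := by nlinarith [Real.goldenRatio_sq]
  have hsq := Real.goldenRatio_sq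
  have mono : ∀ {s t : ℝ}, -K ≤ t - φ * s → 12 * (K' + 1) ≤ s → s ≤ t := fun {s t} h1 h2 => by
    nlinarith
  have hab := mono g1 ha
  have hbc := mono g2 hb
  have hcd := mono g3 hc
  have hde := mono g4 hd
  have hcomb : |2 * Λ (n + 3) - Λ (n + 4) - Λ (n + 1)| ≤ 2 * K := by
    have h2φ : 0 ≤ 2 - φ := by linarith
    have q : (2 - φ) * φ = φ - 1 := by linear_combination -hsq
    have q' : (φ - 1) * φ = 1 := by linear_combination hsq
    have e : 2 * Λ (n + 3) - Λ (n + 4) - Λ (n + 1) = -(Λ (n + 4) - φ * Λ (n + 3)) +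
        (2 - φ) * (Λ (n + 3) - φ * Λ (n + 2)) + (φ - 1) * (Λ (n + 2) - φ * Λ (n + 1)) := by
      linear_combination Λ (n + 2) * q + Λ (n + 1) * q'
    have m1 := mul_le_mul_of_nonneg_left g3 h2φ
    have m2 := mul_le_mul_of_nonneg_left g3' h2φ
    have m3 := mul_le_mul_of_nonneg_left g2 (show 0 ≤ φ - 1 by linarith)
    have m4 := mul_le_mul_of_nonneg_left g2' (show 0 ≤ φ - 1 by linarith)
    rw [e, _root_.abs_le]
    constructor <;> linarith
  obtain ⟨hw0, hw⟩ := near_sandwich_exp hK (h.near (n + 3)) (h.near (n + 4)) (h.abs_le _)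
    (h.abs_le _) (by linarith) (by linarith) (by linarith) hcomb
  rw [← hK'] at hw0 hw
  set w := sandwich (y (n + 3)) (y (n + 4))
  have hnear : ∀ k, Near ξ (Real.exp (-Λ k + K')) (y k) := fun k =>
    (h.near k).mono (Real.exp_le_exp.2 (by linarith))
  have habs : ∀ k, |(y k 0 : ℝ)| ≤ Real.exp (Λ k + K') := fun k =>
    (h.abs_le k).trans (Real.exp_le_exp.2 (by linarith))
  have z1 : dt (y n) (cr (y (n + 1)) w) = 0 :=
    dt_cr_eq_zero_of_near (hnear _) (hnear _) hw (habs _) (habs _) hw0 (by linarith) (by linarith)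
      (by linarith)
  have z2 : dt (y (n + 1)) (cr (y (n + 2)) w) = 0 :=
    dt_cr_eq_zero_of_near (hnear _) (hnear _) hw (habs _) (habs _) hw0 (by linarith)
      (by nlinarith) (by linarith)
  refine (h.prim (n + 1)).exists_smul ?_
  refine cr_eq_zero_of_dt (p := cr (y n) (y (n + 1))) (q := cr (y (n + 1)) (y (n + 2))) ?_ ?_ ?_
    ?_ ?_
  · rw [cr_cr]
    exact smul_ne_zero (h.dt_ne n) (h.prim _).ne_zero
  · simp only [dt, cr_zero, cr_one, cr_two]
    ring
  · simp only [dt, cr_zero, cr_one, cr_two]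
    ring
  · rw [← z1]
    simp only [dt, cr_zero, cr_one, cr_two]
    ring
  · rw [← z2]
    simp only [dt, cr_zero, cr_one, cr_two]
    ring

lemma ExtSeq.exists_recurrent {ξ K : ℝ} {y : ℕ → Fin 3 → ℤ} {Λ : ℕ → ℝ} (h : ExtSeq ξ K y Λ) :
    ∃ y' Λ', ExtSeq ξ K y' Λ' ∧ Recurrent y' := by
  obtain ⟨n, hn⟩ := Filter.eventually_atTop.1 (h.tendsto.eventually_ge_atTop
    (12 * (5 * K + Real.log (8 * (1 + |ξ|) ^ 4) + 1)))
  refine ⟨_, _, h.shift (n + 1), fun m => ?_⟩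
  obtain ⟨t, ht⟩ := h.exists_sandwich rfl (n := n + m) fun k hk => hn k (by lia)
  refine ⟨sdet (y (n + m + 3)) ^ 2, t, pow_ne_zero _ (h.sdet_ne _), ?_⟩
  rw [show m + 3 + (n + 1) = n + m + 4 by ring, show m + 2 + (n + 1) = n + m + 3 by ring,
    show m + (n + 1) = n + m + 1 by ring, ← sandwich_sandwich, ht]
  simpa using sandwich_smul 1 t (y (n + m + 3)) (y (n + m + 1))

lemma Recurrent.exists_smul {y y' : ℕ → Fin 3 → ℤ} (h : Recurrent y) (h' : Recurrent y')
    (hp : ∀ k, Prim (y k)) (h0 : y' 0 = y 0) (h1 : y' 1 = y 1)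
    (h2 : y' 2 = y 2) (n : ℕ) : ∃ s : ℤ, y' n = s • y n := by
  induction n using Nat.strong_induction_on with
  | _ n ih =>
    match n with
    | 0 => exact ⟨1, by rw [h0, one_smul]⟩
    | 1 => exact ⟨1, by rw [h1, one_smul]⟩
    | 2 => exact ⟨1, by rw [h2, one_smul]⟩
    | n + 3 =>
      obtain ⟨s, hs⟩ := ih (n + 2) (by lia)
      obtain ⟨t, ht⟩ := ih n (by lia)
      obtain ⟨c, d, hc, hcd⟩ := h n
      obtain ⟨c', d', hc', hcd'⟩ := h' n
      have hd : d ≠ 0 := by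
        rintro rfl
        rw [zero_smul] at hcd
        exact smul_ne_zero hc (hp _).ne_zero hcd
      refine (hp _).exists_smul ?_
      rw [hs, ht, sandwich_smul] at hcd'
      have e : (d * c') • y' (n + 3) = (d' * (s ^ 2 * t) * c) • y (n + 3) := by
        rw [mul_smul, hcd', mul_smul _ c, hcd, smul_smul, smul_smul, smul_smul]
        congr 1
        ring
      have e' : (d * c') • cr (y (n + 3)) (y' (n + 3)) = 0 := by
        rw [← cr_smul_right, e, cr_smul_right, cr_self, smul_zero]
      exact (smul_eq_zero.1 e').resolve_left (mul_ne_zero hd hc')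

lemma one_le_abs_of_near {ξ b : ℝ} {y : Fin 3 → ℤ} (h : Near ξ b y) (hb : b < 1) (hy : y ≠ 0) :
    1 ≤ |(y 0 : ℝ)| := by
  by_contra! hlt
  rw [← Int.cast_abs] at hlt
  have h0 : y 0 = 0 := Int.abs_lt_one_iff.1 (by exact_mod_cast hlt)
  obtain ⟨h1, h2⟩ := h
  rw [h0, Int.cast_zero, mul_zero, sub_zero, ← Int.cast_abs] at h1 h2
  exact hy (ext3 h0 (Int.abs_lt_one_iff.1 (by exact_mod_cast h1.trans_lt hb))
    (Int.abs_lt_one_iff.1 (by exact_mod_cast h2.trans_lt hb)))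

lemma abs_sub_le_of_near {ξ ξ' b b' : ℝ} {y : Fin 3 → ℤ} (h : Near ξ b y) (h' : Near ξ' b' y)
    (hb : b < 1) (hy : y ≠ 0) : |ξ - ξ'| ≤ b + b' := by
  have h1 := one_le_abs_of_near h hb hy
  calc |ξ - ξ'| ≤ |ξ - ξ'| * |(y 0 : ℝ)| := le_mul_of_one_le_right (abs_nonneg _) h1
    _ = |((y 1 : ℝ) - ξ * y 0) - (y 1 - ξ' * y 0)| := by
      rw [← abs_mul, ← abs_neg]
      congr 1
      ring
    _ ≤ b + b' := abs_sub_le_add h.1 h'.1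

lemma ExtSeq.eq_of_recurrent {ξ ξ' K K' : ℝ} {y y' : ℕ → Fin 3 → ℤ} {Λ Λ' : ℕ → ℝ}
    (h : ExtSeq ξ K y Λ) (h' : ExtSeq ξ' K' y' Λ') (hr : Recurrent y) (hr' : Recurrent y')
    (h0 : y' 0 = y 0) (h1 : y' 1 = y 1) (h2 : y' 2 = y 2) : ξ = ξ' := by
  have hlim : ∀ {Λ : ℕ → ℝ} {K : ℝ}, Filter.Tendsto Λ Filter.atTop Filter.atTop →
      Filter.Tendsto (fun n => Real.exp (-Λ n + K)) Filter.atTop (nhds 0) := fun {Λ K} hΛ =>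
    Real.tendsto_exp_atBot.comp (Filter.tendsto_atBot_add_const_right _ K
      (Filter.tendsto_neg_atTop_atBot.comp hΛ))
  have hsum := (hlim (K := K) h.tendsto).add (hlim (K := K') h'.tendsto)
  rw [add_zero] at hsum
  have hev : ∀ᶠ n in Filter.atTop, |ξ - ξ'| ≤ Real.exp (-Λ n + K) + Real.exp (-Λ' n + K') := by
    filter_upwards [(hlim (K := K) h.tendsto).eventually_lt_const one_pos] with n hn
    obtain ⟨s, hs⟩ := hr.exists_smul hr' h.prim h0 h1 h2 n
    have hs0 : s ≠ 0 := by
      rintro rfl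
      exact (h'.prim n).ne_zero (by rw [hs, zero_smul])
    have hnear := h'.near n
    rw [hs] at hnear
    exact abs_sub_le_of_near (h.near n) (hnear.of_smul hs0) hn (h.prim n).ne_zero
  have := ge_of_tendsto hsum hev
  exact sub_eq_zero.1 (abs_eq_zero.1 (le_antisymm this (abs_nonneg _)))

theorem countable_setOf_extSeq : {ξ : ℝ | ∃ K y Λ, ExtSeq ξ K y Λ}.Countable := by
  refine (Set.countable_iUnion (ι := (Fin 3 → ℤ) × (Fin 3 → ℤ) × (Fin 3 → ℤ))
    (t := fun u => {ξ : ℝ | ∃ K y Λ, ExtSeq ξ K y Λ ∧ Recurrent y ∧ y 0 = u.1 ∧ y 1 = u.2.1 ∧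
      y 2 = u.2.2}) fun u => Set.Subsingleton.countable ?_).mono ?_
  · rintro ξ ⟨K, y, Λ, h, hr, h0, h1, h2⟩ ξ' ⟨K', y', Λ', h', hr', h0', h1', h2'⟩
    exact h.eq_of_recurrent h' hr hr' (h0'.trans h0.symm) (h1'.trans h1.symm) (h2'.trans h2.symm)
  · rintro ξ ⟨K, y, Λ, h⟩
    obtain ⟨y', Λ', h', hr⟩ := h.exists_recurrent
    exact Set.mem_iUnion.2 ⟨(y' 0, y' 1, y' 2), K, y', Λ', h', hr, rfl, rfl, rfl⟩

end RoyExt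

namespace RoyExt

open scoped goldenRatio

/-- The symmetric part of the matrix product `u * !![3, m; 3 - m, 1] * v`. -/
def twist (m : ℤ) (u v : Fin 3 → ℤ) : Fin 3 → ℤ :=
  ![(3 * u 0 + (3 - m) * u 1) * v 0 + (m * u 0 + u 1) * v 1,
    (3 * u 0 + (3 - m) * u 1) * v 1 + (m * u 0 + u 1) * v 2,
    (3 * u 1 + (3 - m) * u 2) * v 1 + (m * u 1 + u 2) * v 2]

/-- The matrix `u * !![3, m; 3 - m, 1] * v` is symmetric. -/
def TwistSymm (m : ℤ) (u v : Fin 3 → ℤ) : Prop :=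
  (3 * u 0 + (3 - m) * u 1) * v 1 + (m * u 0 + u 1) * v 2 =
    (3 * u 1 + (3 - m) * u 2) * v 0 + (m * u 1 + u 2) * v 1

lemma twist_zero (m : ℤ) (u v : Fin 3 → ℤ) : twist m u v 0 =
    (3 * u 0 + (3 - m) * u 1) * v 0 + (m * u 0 + u 1) * v 1 := rfl

lemma twist_one (m : ℤ) (u v : Fin 3 → ℤ) : twist m u v 1 =
    (3 * u 0 + (3 - m) * u 1) * v 1 + (m * u 0 + u 1) * v 2 := rfl

lemma twist_two (m : ℤ) (u v : Fin 3 → ℤ) : twist m u v 2 =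
    (3 * u 1 + (3 - m) * u 2) * v 1 + (m * u 1 + u 2) * v 2 := rfl

lemma TwistSymm.twist {m : ℤ} {u v : Fin 3 → ℤ} (h : TwistSymm m u v) :
    TwistSymm (3 - m) (twist m u v) u := by
  rw [TwistSymm] at h ⊢
  rw [twist_zero, twist_one, twist_two]
  linear_combination (-(3 * u 0 + (3 - m) * u 1)) * h

lemma TwistSymm.sdet_twist {m : ℤ} {u v : Fin 3 → ℤ} (h : TwistSymm m u v) :
    sdet (RoyExt.twist m u v) = (3 - m * (3 - m)) * (sdet u * sdet v) := by
  rw [TwistSymm] at h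
  rw [sdet, sdet, sdet, twist_zero, twist_one, twist_two]
  linear_combination (-((3 * u 0 + (3 - m) * u 1) * v 1 + (m * u 0 + u 1) * v 2)) * h

lemma TwistSymm.dt_cr_twist {m : ℤ} {u v : Fin 3 → ℤ} (h : TwistSymm m u v) :
    dt v (cr u (RoyExt.twist m u v)) = (3 - 2 * m) * (sdet u * sdet v) := by
  rw [TwistSymm] at h
  simp only [dt, cr_zero, cr_one, cr_two, twist_zero, twist_one, twist_two, sdet]
  linear_combination (v 2 * u 0 - v 1 * u 1) * h

lemma TwistSymm.twist_one_mul_sub {m : ℤ} {u v : Fin 3 → ℤ} (h : TwistSymm m u v) :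
    RoyExt.twist m u v 1 * u 0 - RoyExt.twist m u v 0 * u 1 =
      ((3 - m) * v 0 + v 1) * sdet u := by
  rw [TwistSymm] at h
  rw [twist_zero, twist_one, sdet]
  linear_combination u 0 * h

/-- Successive multipliers and points of Roy's sequence. -/
def royState : ℕ → ℤ × (Fin 3 → ℤ) × (Fin 3 → ℤ)
  | 0 => (1, ![4, 3, 2], ![1, 1, 0])
  | n + 1 => (3 - (royState n).1, twist (royState n).1 (royState n).2.1 (royState n).2.2,
      (royState n).2.1)

/-- Roy's sequence of symmetric matrices. -/
def royPoint (n : ℕ) : Fin 3 → ℤ := (royState n).2.2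

lemma royPoint_add_two (n : ℕ) :
    royPoint (n + 2) = twist (royState n).1 (royPoint (n + 1)) (royPoint n) := rfl

lemma royState_fst (n : ℕ) : (royState n).1 = 1 ∨ (royState n).1 = 2 := by
  induction n with
  | zero => exact Or.inl rfl
  | succ n ih =>
    change 3 - (royState n).1 = 1 ∨ 3 - (royState n).1 = 2
    lia

lemma twistSymm_royPoint (n : ℕ) :
    TwistSymm (royState n).1 (royPoint (n + 1)) (royPoint n) := by
  induction n with
  | zero => exact rfl
  | succ n ih => exact ih.twist

lemma abs_sdet_royPoint (n : ℕ) : |sdet (royPoint n)| = 1 ∧ |sdet (royPoint (n + 1))| = 1 := by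
  induction n with
  | zero => exact ⟨rfl, rfl⟩
  | succ n ih =>
    refine ⟨ih.2, ?_⟩
    rw [royPoint_add_two, (twistSymm_royPoint n).sdet_twist, abs_mul, abs_mul, ih.1, ih.2]
    rcases royState_fst n with h | h <;> rw [h] <;> norm_num

lemma dt_cr_royPoint_ne (n : ℕ) :
    dt (royPoint n) (cr (royPoint (n + 1)) (royPoint (n + 2))) ≠ 0 := by
  rw [royPoint_add_two, (twistSymm_royPoint n).dt_cr_twist]
  obtain ⟨h0, h1⟩ := abs_sdet_royPoint n
  refine mul_ne_zero ?_ (mul_ne_zero (abs_ne_zero.1 (by lia)) (abs_ne_zero.1 (by lia)))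
  rcases royState_fst n with h | h <;> rw [h] <;> norm_num

/-- The coordinates are decreasing and nonnegative, the first one positive. -/
def Decr (u : Fin 3 → ℤ) : Prop := 1 ≤ u 0 ∧ 0 ≤ u 2 ∧ u 2 ≤ u 1 ∧ u 1 ≤ u 0

lemma Decr.twist {m : ℤ} {u v : Fin 3 → ℤ} (hu : Decr u) (hv : Decr v) (hm : m = 1 ∨ m = 2)
    (h : TwistSymm m u v) : Decr (twist m u v) ∧ 3 * (u 0 * v 0) ≤ RoyExt.twist m u v 0 ∧
      RoyExt.twist m u v 0 ≤ 7 * (u 0 * v 0) := by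
  obtain ⟨hu0, hu2, hu21, hu10⟩ := hu
  obtain ⟨hv0, hv2, hv21, hv10⟩ := hv
  rw [TwistSymm] at h
  rw [Decr, twist_zero, twist_one, twist_two]
  have hu1 : 0 ≤ u 1 := hu2.trans hu21
  have hv1 : 0 ≤ v 1 := hv2.trans hv21
  have r0 : 0 ≤ 3 * u 0 + (3 - m) * u 1 := by rcases hm with rfl | rfl <;> lia
  have r1 : 0 ≤ m * u 0 + u 1 := by rcases hm with rfl | rfl <;> lia
  have s0 : 0 ≤ 3 * u 1 + (3 - m) * u 2 := by rcases hm with rfl | rfl <;> lia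
  have s1 : 0 ≤ m * u 1 + u 2 := by rcases hm with rfl | rfl <;> lia
  have hlow : 3 * (u 0 * v 0) ≤
      (3 * u 0 + (3 - m) * u 1) * v 0 + (m * u 0 + u 1) * v 1 := by
    have e1 : 3 * u 0 ≤ 3 * u 0 + (3 - m) * u 1 := by rcases hm with rfl | rfl <;> lia
    have e2 := mul_le_mul_of_nonneg_right e1 (show 0 ≤ v 0 by lia)
    have e3 := mul_nonneg r1 hv1
    lia
  refine ⟨⟨?_, ?_, ?_, ?_⟩, hlow, ?_⟩
  · have := mul_pos (show 0 < u 0 by lia) (show 0 < v 0 by lia)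
    lia
  · positivity
  · rw [h]
    gcongr
  · gcongr
  · have e1 := mul_le_mul_of_nonneg_left hv10 r1
    have e2 : 3 * u 0 + (3 - m) * u 1 + (m * u 0 + u 1) ≤ 7 * u 0 := by
      rcases hm with rfl | rfl <;> lia
    have e3 := mul_le_mul_of_nonneg_right e2 (show 0 ≤ v 0 by lia)
    lia

lemma decr_royPoint (n : ℕ) : Decr (royPoint n) ∧ Decr (royPoint (n + 1)) := by
  induction n with
  | zero => simp [Decr, royPoint, royState]
  | succ n ih => exact ⟨ih.2, (ih.2.twist ih.1 (royState_fst n) (twistSymm_royPoint n)).1⟩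

lemma royPoint_zero_bounds (n : ℕ) :
    3 * (royPoint (n + 1) 0 * royPoint n 0) ≤ royPoint (n + 2) 0 ∧
      royPoint (n + 2) 0 ≤ 7 * (royPoint (n + 1) 0 * royPoint n 0) :=
  ((decr_royPoint n).2.twist (decr_royPoint n).1 (royState_fst n) (twistSymm_royPoint n)).2

lemma three_mul_royPoint_zero_le (n : ℕ) : 3 * royPoint n 0 ≤ royPoint (n + 1) 0 := by
  cases n with
  | zero => norm_num [royPoint, royState]
  | succ n =>
    have h1 := (royPoint_zero_bounds n).1
    have h2 := (decr_royPoint n).1.1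
    have h3 := (decr_royPoint n).2.1
    nlinarith

lemma abs_cr_royPoint_two_le (n : ℕ) :
    |royPoint (n + 1) 1 * royPoint n 0 - royPoint (n + 1) 0 * royPoint n 1| * royPoint n 0 ≤
      royPoint (n + 1) 0 := by
  cases n with
  | zero => norm_num [royPoint, royState]
  | succ n =>
    obtain ⟨h0, h2, h21, h10⟩ := (decr_royPoint n).1
    have hu0 := (decr_royPoint n).2.1
    rw [royPoint_add_two, (twistSymm_royPoint n).twist_one_mul_sub, abs_mul,
      (abs_sdet_royPoint n).2, mul_one, ← royPoint_add_two]
    refine le_trans ?_ (royPoint_zero_bounds n).1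
    have : |(3 - (royState n).1) * royPoint n 0 + royPoint n 1| ≤ 3 * royPoint n 0 := by
      rcases royState_fst n with h | h <;> rw [h, abs_le] <;> constructor <;> lia
    have := mul_le_mul_of_nonneg_right this (show 0 ≤ royPoint (n + 1) 0 by lia)
    lia

end RoyExt

namespace RoyExt

open scoped goldenRatio

/-- The first coordinates of Roy's sequence. -/
noncomputable def royNum (n : ℕ) : ℝ := royPoint n 0

lemma one_le_royNum (n : ℕ) : 1 ≤ royNum n := by
  rw [royNum]
  exact_mod_cast (decr_royPoint n).1.1

lemma royNum_pos (n : ℕ) : 0 < royNum n := one_pos.trans_le (one_le_royNum n)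

lemma three_mul_royNum_le (n : ℕ) : 3 * royNum n ≤ royNum (n + 1) := by
  rw [royNum, royNum]
  exact_mod_cast three_mul_royPoint_zero_le n

lemma royNum_add_two_le (n : ℕ) : royNum (n + 2) ≤ 7 * (royNum (n + 1) * royNum n) := by
  rw [royNum, royNum, royNum]
  exact_mod_cast (royPoint_zero_bounds n).2

lemma le_royNum_add_two (n : ℕ) : royNum (n + 1) * royNum n ≤ royNum (n + 2) := by
  have h := (royPoint_zero_bounds n).1
  have h' : 3 * (royNum (n + 1) * royNum n) ≤ royNum (n + 2) := by
    rw [royNum, royNum, royNum]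
    exact_mod_cast h
  have := mul_pos (royNum_pos (n + 1)) (royNum_pos n)
  linarith

lemma abs_royRatio_sub_le (n : ℕ) :
    |(royPoint (n + 1) 1 : ℝ) / royNum (n + 1) - royPoint n 1 / royNum n| ≤ 1 / royNum n ^ 2 := by
  have h1 := royNum_pos n
  have h2 := royNum_pos (n + 1)
  have key : |(royPoint (n + 1) 1 : ℝ) * royNum n - royNum (n + 1) * royPoint n 1| * royNum n ≤
      royNum (n + 1) := by
    rw [royNum, royNum]
    exact_mod_cast abs_cr_royPoint_two_le n
  rw [div_sub_div _ _ h2.ne' h1.ne', abs_div, abs_of_pos (mul_pos h2 h1),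
    div_le_div_iff₀ (mul_pos h2 h1) (by positivity)]
  nlinarith [mul_le_mul_of_nonneg_right key h1.le]

lemma exists_abs_sub_royRatio_le :
    ∃ ξ : ℝ, ∀ n, |ξ - royPoint n 1 / royNum n| ≤ 2 / royNum n ^ 2 := by
  have step : ∀ n, 2 / royNum (n + 1) ^ 2 ≤ 1 / royNum n ^ 2 := fun n => by
    have h1 := royNum_pos n
    have h2 := royNum_pos (n + 1)
    rw [div_le_div_iff₀ (by positivity) (by positivity)]
    nlinarith [three_mul_royNum_le n]
  have two : ∀ n, 2 / royNum n ^ 2 = 1 / royNum n ^ 2 + 1 / royNum n ^ 2 := fun n => by ring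
  have hmono : Monotone fun n => (royPoint n 1 : ℝ) / royNum n - 2 / royNum n ^ 2 :=
    monotone_nat_of_le_succ fun n => by
      linarith [(abs_le.1 (abs_royRatio_sub_le n)).1, step n, two n]
  have hanti : Antitone fun n => (royPoint n 1 : ℝ) / royNum n + 2 / royNum n ^ 2 :=
    antitone_nat_of_succ_le fun n => by
      linarith [(abs_le.1 (abs_royRatio_sub_le n)).2, step n, two n]
  have hmem := hmono.ciSup_mem_iInter_Icc_of_antitone hanti fun n => by
    have : 0 ≤ 2 / royNum n ^ 2 := by positivity
    change _ - _ ≤ _ + _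
    linarith
  refine ⟨⨆ n, ((royPoint n 1 : ℝ) / royNum n - 2 / royNum n ^ 2), fun n => ?_⟩
  obtain ⟨h1, h2⟩ := Set.mem_iInter.1 hmem n
  rw [abs_le]
  constructor <;> linarith

lemma exists_near_royPoint : ∃ ξ : ℝ, ∀ n, Near ξ (9 / royNum n) (royPoint n) := by
  obtain ⟨ξ, hξ⟩ := exists_abs_sub_royRatio_le
  have ha : ∀ n, |(royPoint n 1 : ℝ) - ξ * royNum n| ≤ 2 / royNum n := fun n => by
    have hpos := royNum_pos n
    have e : (royPoint n 1 : ℝ) - ξ * royNum n = -(ξ - royPoint n 1 / royNum n) * royNum n := by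
      field_simp
      ring
    rw [e, abs_mul, abs_neg, abs_of_pos hpos,
      show 2 / royNum n = 2 / royNum n ^ 2 * royNum n by field_simp]
    exact mul_le_mul_of_nonneg_right (hξ n) hpos.le
  have hξ3 : |ξ| ≤ 3 := by
    have := hξ 0
    rw [show royNum 0 = 1 by norm_num [royNum, royPoint, royState],
      show royPoint 0 1 = 1 from rfl] at this
    rw [abs_le] at this ⊢
    constructor <;> linarith [this.1, this.2]
  refine ⟨ξ, fun n => ?_⟩
  have hpos := royNum_pos n
  have hinv : 0 < 1 / royNum n := by positivity
  have hc : |(royPoint n 2 : ℝ) - ξ * royPoint n 1| ≤ 3 / royNum n := by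
    obtain ⟨h0, h2, h21, h10⟩ := (decr_royPoint n).1
    have hb0 : (0 : ℝ) ≤ royPoint n 1 := by exact_mod_cast h2.trans h21
    have hb : (royPoint n 1 : ℝ) ≤ royNum n := by
      rw [royNum]
      exact_mod_cast h10
    have hdet : |(royNum n * royPoint n 2 - royPoint n 1 ^ 2 : ℝ)| = 1 := by
      rw [royNum]
      exact_mod_cast (abs_sdet_royPoint n).1
    have e : (royPoint n 2 : ℝ) - ξ * royPoint n 1 =
        (royNum n * royPoint n 2 - royPoint n 1 ^ 2) / royNum n +
          royPoint n 1 / royNum n * (royPoint n 1 - ξ * royNum n) := by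
      field_simp
      ring
    have hq : |(royPoint n 1 : ℝ) / royNum n| ≤ 1 := by
      rw [abs_div, abs_of_nonneg hb0, abs_of_pos hpos, div_le_one hpos]
      exact hb
    rw [e]
    refine (abs_add_le_add (le_of_eq ?_) (abs_mul_le_mul hq (ha n))).trans
      (b := 1 / royNum n + 1 * (2 / royNum n)) (le_of_eq ?_)
    · rw [abs_div, hdet, abs_of_pos hpos]
    · ring
  constructor
  · refine (ha n).trans ?_
    gcongr
    norm_num
  · have e : (royPoint n 2 : ℝ) - ξ ^ 2 * royPoint n 0 =
        (royPoint n 2 - ξ * royPoint n 1) + ξ * (royPoint n 1 - ξ * royNum n) := by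
      rw [royNum]
      ring
    rw [e]
    refine (abs_add_le_add hc (abs_mul_le_mul hξ3 (ha n))).trans (le_of_eq ?_)
    ring

lemma tendsto_royNum : Filter.Tendsto royNum Filter.atTop Filter.atTop := by
  have h : ∀ n, (3 : ℝ) ^ n ≤ royNum n := fun n => by
    induction n with
    | zero => simpa using one_le_royNum 0
    | succ n ih =>
      rw [pow_succ]
      linarith [three_mul_royNum_le n]
  exact Filter.tendsto_atTop_mono h (tendsto_pow_atTop_atTop_of_one_lt (by norm_num))

lemma eq_zero_of_dt_eq_zero {x u v w : Fin 3 → ℤ} (hne : dt u (cr v w) ≠ 0) (hu : dt x u = 0)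
    (hv : dt x v = 0) (hw : dt x w = 0) : x = 0 := by
  have e : dt u (cr v w) • x = dt x u • cr v w + dt x v • cr w u + dt x w • cr u v := by
    refine ext3 ?_ ?_ ?_ <;>
      simp only [cr_zero, cr_one, cr_two, Pi.smul_apply, Pi.add_apply, smul_eq_mul, dt] <;> ring
  rw [hu, hv, hw, zero_smul, zero_smul, zero_smul, add_zero, add_zero] at e
  exact (smul_eq_zero.1 e).resolve_left hne

lemma indep_of_near_royPoint {ξ : ℝ} (h : ∀ n, Near ξ (9 / royNum n) (royPoint n)) :
    Indep ξ := by
  intro x hx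
  obtain ⟨n, hn⟩ := Filter.eventually_atTop.1
    (tendsto_royNum.eventually_gt_atTop (18 * (ht x : ℝ)))
  have hz : ∀ k, n ≤ k → dt x (royPoint k) = 0 := fun k hk => by
    have key := (h k).abs_dt_le x
    rw [hx, abs_zero, mul_zero, zero_add] at key
    have hlt : 2 * ((ht x : ℝ) * (9 / royNum k)) < 1 := by
      rw [show 2 * ((ht x : ℝ) * (9 / royNum k)) = 18 * ht x / royNum k by ring,
        div_lt_one (royNum_pos k)]
      exact hn k hk
    have := key.trans_lt hlt
    rw [← Int.cast_abs] at this
    exact Int.abs_lt_one_iff.1 (by exact_mod_cast this)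
  exact eq_zero_of_dt_eq_zero (dt_cr_royPoint_ne n) (hz n le_rfl) (hz _ (by lia)) (hz _ (by lia))

lemma abs_log_royNum_sub_le (n : ℕ) :
    |Real.log (royNum (n + 1)) - φ * Real.log (royNum n)| ≤ 6 := by
  have hexp : (7 : ℝ) ≤ Real.exp 2 := by
    have : Real.exp 2 = Real.exp 1 * Real.exp 1 := by rw [← Real.exp_add]; norm_num
    rw [this]
    nlinarith [Real.exp_one_gt_d9]
  have h7 : Real.log 7 ≤ 2 := by
    rw [Real.log_le_iff_le_exp (by norm_num)]
    exact hexp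
  have hφ := three_halves_le_goldenRatio
  have hφ' : φ ≤ 13 / 8 := by nlinarith [Real.goldenRatio_sq]
  induction n with
  | zero =>
    rw [show royNum 0 = 1 by norm_num [royNum, royPoint, royState],
      show royNum 1 = 4 by norm_num [royNum, royPoint, royState], Real.log_one, mul_zero, sub_zero,
      abs_of_nonneg (Real.log_nonneg (by norm_num))]
    have : Real.log 4 ≤ Real.log 7 := Real.log_le_log (by norm_num) (by norm_num)
    linarith
  | succ n ih =>
    have h1 := royNum_pos n
    have h2 := royNum_pos (n + 1)
    have hup := Real.log_le_log (royNum_pos (n + 2)) (royNum_add_two_le n)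
    have hlow := Real.log_le_log (mul_pos h2 h1) (le_royNum_add_two n)
    rw [Real.log_mul (by norm_num) (by positivity), Real.log_mul h2.ne' h1.ne'] at hup
    rw [Real.log_mul h2.ne' h1.ne'] at hlow
    obtain ⟨i1, i2⟩ := abs_le.1 ih
    have hsq := Real.goldenRatio_sq
    have m1 := mul_le_mul_of_nonneg_left i1 (show 0 ≤ φ - 1 by linarith)
    have m2 := mul_le_mul_of_nonneg_left i2 (show 0 ≤ φ - 1 by linarith)
    have e : (φ - 1) * (Real.log (royNum (n + 1)) - φ * Real.log (royNum n)) =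
        φ * Real.log (royNum (n + 1)) - Real.log (royNum (n + 1)) - Real.log (royNum n) := by
      linear_combination (-Real.log (royNum n)) * hsq
    rw [e] at m1 m2
    rw [abs_le]
    constructor <;> linarith

end RoyExt

namespace RoyExt

open scoped goldenRatio

lemma val_cr (ξ : ℝ) (x y : Fin 3 → ℤ) : val ξ (cr x y) =
    (x 1 - ξ * x 0) * (y 2 - ξ ^ 2 * y 0) - (x 2 - ξ ^ 2 * x 0) * (y 1 - ξ * y 0) := by
  rw [val, cr_zero, cr_one, cr_two]
  push_cast
  ring

lemma ht_cr_le_of_near {ξ X Y A B : ℝ} {x y : Fin 3 → ℤ} (hx : Near ξ A x) (hy : Near ξ B y)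
    (hX : |(x 0 : ℝ)| ≤ X) (hY : |(y 0 : ℝ)| ≤ Y) :
    (ht (cr x y) : ℝ) ≤ (2 + |ξ|) ^ 2 * (X * B + Y * A + A * B) := by
  have hs : 0 ≤ |ξ| := abs_nonneg _
  have hXB : 0 ≤ X * B := mul_nonneg ((abs_nonneg _).trans hX) ((abs_nonneg _).trans hy.1)
  have hYA : 0 ≤ Y * A := mul_nonneg ((abs_nonneg _).trans hY) ((abs_nonneg _).trans hx.1)
  have hAB : 0 ≤ A * B := mul_nonneg ((abs_nonneg _).trans hx.1) ((abs_nonneg _).trans hy.1)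
  have hD : 1 ≤ (2 + |ξ|) ^ 2 := by nlinarith
  have base : X * B + Y * A ≤ (2 + |ξ|) ^ 2 * (X * B + Y * A + A * B) := by
    have := mul_le_mul_of_nonneg_right hD (show 0 ≤ X * B + Y * A + A * B by positivity)
    linarith
  refine ht_le fun j => ?_
  fin_cases j
  · have e : ((cr x y 0 : ℤ) : ℝ) = ξ * (x 0 * (y 2 - ξ ^ 2 * y 0)) +
        |ξ| * |ξ| * (y 0 * (x 1 - ξ * x 0)) + (x 1 - ξ * x 0) * (y 2 - ξ ^ 2 * y 0) -
        (|ξ| * |ξ| * (x 0 * (y 1 - ξ * y 0)) + ξ * (y 0 * (x 2 - ξ ^ 2 * x 0)) +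
          (x 2 - ξ ^ 2 * x 0) * (y 1 - ξ * y 0)) := by
      rw [cr_zero, abs_mul_abs_self]
      push_cast
      ring
    have hss : |(|ξ| * |ξ|)| ≤ |ξ| * |ξ| := (abs_of_nonneg (by positivity)).le
    change |((cr x y 0 : ℤ) : ℝ)| ≤ _
    rw [e]
    refine (abs_sub_le_add (abs_add_le_add (abs_add_le_add
      (abs_mul_le_mul le_rfl (abs_mul_le_mul hX hy.2))
      (abs_mul_le_mul hss (abs_mul_le_mul hY hx.1))) (abs_mul_le_mul hx.1 hy.2))
      (abs_add_le_add (abs_add_le_add (abs_mul_le_mul hss (abs_mul_le_mul hX hy.1))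
      (abs_mul_le_mul le_rfl (abs_mul_le_mul hY hx.2))) (abs_mul_le_mul hx.2 hy.1))).trans ?_
    nlinarith [mul_nonneg hs hXB, mul_nonneg hs hYA, mul_nonneg hs hAB,
      mul_nonneg (mul_nonneg hs hs) hAB]
  · refine le_trans ?_ base
    have e : ((cr x y 1 : ℤ) : ℝ) = y 0 * (x 2 - ξ ^ 2 * x 0) - x 0 * (y 2 - ξ ^ 2 * y 0) := by
      rw [cr_one]
      push_cast
      ring
    change |((cr x y 1 : ℤ) : ℝ)| ≤ _
    rw [e, add_comm]
    exact abs_sub_le_add (abs_mul_le_mul hY hx.2) (abs_mul_le_mul hX hy.2)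
  · refine le_trans ?_ base
    have e : ((cr x y 2 : ℤ) : ℝ) = x 0 * (y 1 - ξ * y 0) - y 0 * (x 1 - ξ * x 0) := by
      rw [cr_two]
      push_cast
      ring
    change |((cr x y 2 : ℤ) : ℝ)| ≤ _
    rw [e]
    exact abs_sub_le_add (abs_mul_le_mul hX hy.1) (abs_mul_le_mul hY hx.1)

lemma ht_cr_royPoint_le {ξ : ℝ} (h : ∀ n, Near ξ (9 / royNum n) (royPoint n)) (n : ℕ) :
    (ht (cr (royPoint (n + 1)) (royPoint (n + 2))) : ℝ) ≤
      693 * (2 + |ξ|) ^ 2 * royNum n := by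
  have habs : ∀ k, |(royPoint k 0 : ℝ)| ≤ royNum k := fun k => (abs_of_pos (royNum_pos k)).le
  refine (ht_cr_le_of_near (h _) (h _) (habs _) (habs _)).trans ?_
  rw [mul_comm 693, mul_assoc]
  refine mul_le_mul_of_nonneg_left ?_ (by positivity)
  have h1 := royNum_pos (n + 1)
  have h2 := royNum_pos (n + 2)
  have h3 := three_mul_royNum_le (n + 1)
  have e1 : royNum (n + 1) * (9 / royNum (n + 2)) ≤ 9 := by
    rw [mul_div_assoc', div_le_iff₀ h2]
    linarith
  have e2 : royNum (n + 2) * (9 / royNum (n + 1)) ≤ 63 * royNum n := by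
    rw [mul_div_assoc', div_le_iff₀ h1]
    linarith [royNum_add_two_le n]
  have e3 : 9 / royNum (n + 1) * (9 / royNum (n + 2)) ≤ 81 := by
    have i1 : 9 / royNum (n + 1) ≤ 9 := div_le_self (by norm_num) (one_le_royNum _)
    have i2 : 9 / royNum (n + 2) ≤ 9 := div_le_self (by norm_num) (one_le_royNum _)
    nlinarith [div_pos (show (0 : ℝ) < 9 by norm_num) h1, div_pos (show (0 : ℝ) < 9 by norm_num) h2]
  linarith [one_le_royNum n]

lemma log_abs_val_cr_royPoint_le {ξ : ℝ} (h : ∀ n, Near ξ (9 / royNum n) (royPoint n)) (n : ℕ)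
    (hne : val ξ (cr (royPoint n) (royPoint (n + 1))) ≠ 0) :
    Real.log |val ξ (cr (royPoint n) (royPoint (n + 1)))| ≤
      -(φ + 1) * Real.log (royNum n) + (Real.log 162 + 6) := by
  have h1 := royNum_pos n
  have h2 := royNum_pos (n + 1)
  have key : |val ξ (cr (royPoint n) (royPoint (n + 1)))| ≤ 162 / (royNum n * royNum (n + 1)) := by
    rw [val_cr]
    refine (abs_sub_le_add (abs_mul_le_mul (h n).1 (h (n + 1)).2)
      (abs_mul_le_mul (h n).2 (h (n + 1)).1)).trans (le_of_eq ?_)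
    field_simp
    norm_num
  have hlog := Real.log_le_log (abs_pos.2 hne) key
  rw [Real.log_div (by norm_num) (by positivity), Real.log_mul h1.ne' h2.ne'] at hlog
  have := (abs_le.1 (abs_log_royNum_sub_le n)).1
  linarith

lemma exists_small_val {ξ : ℝ} (h : ∀ n, Near ξ (9 / royNum n) (royPoint n)) :
    ∃ (k : ℝ) (N₁ : ℕ), ∀ N : ℕ, N₁ ≤ N → ∃ x, val ξ x ≠ 0 ∧ ht x ≤ N ∧
      Real.log |val ξ x| ≤ -(φ + 1) * Real.log N + k := by
  have hC : (1 : ℝ) ≤ 693 * (2 + |ξ|) ^ 2 := by nlinarith [abs_nonneg ξ]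
  obtain ⟨C, hCe⟩ : ∃ C, C = 693 * (2 + |ξ|) ^ 2 := ⟨_, rfl⟩
  rw [← hCe] at hC
  have hC0 : 0 < C := by linarith
  refine ⟨Real.log 162 + 6 + (φ + 1) * Real.log C, ⌈C * royNum 0⌉₊, fun N hN => ?_⟩
  have hex : ∃ m, (N : ℝ) < C * royNum (m + 1) := by
    obtain ⟨m, hm⟩ := (tendsto_royNum.eventually_gt_atTop (N : ℝ)).exists
    refine ⟨m, hm.trans_le ?_⟩
    have h3 := three_mul_royNum_le m
    have h1 := royNum_pos (m + 1)
    nlinarith [royNum_pos m]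
  have hlow : C * royNum (Nat.find hex) ≤ N := by
    rcases Nat.eq_zero_or_pos (Nat.find hex) with h0 | h0
    · rw [h0]
      exact Nat.ceil_le.1 hN
    · have := Nat.find_min hex (Nat.sub_one_lt h0.ne')
      rwa [Nat.sub_add_cancel h0, not_lt] at this
  have hup := Nat.find_spec hex
  set m := Nat.find hex
  have hne : val ξ (cr (royPoint (m + 1)) (royPoint (m + 2))) ≠ 0 := fun h0 => by
    have hd := dt_cr_royPoint_ne m
    rw [indep_of_near_royPoint h _ h0] at hd
    simp [dt] at hd
  refine ⟨_, hne, ?_, (log_abs_val_cr_royPoint_le h (m + 1) hne).trans ?_⟩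
  · have := ht_cr_royPoint_le h m
    rw [← hCe] at this
    exact_mod_cast this.trans hlow
  · have hN0 : (0 : ℝ) < N := (mul_pos hC0 (royNum_pos _)).trans_le hlow
    have hlog := Real.log_le_log hN0 hup.le
    rw [Real.log_mul hC0.ne' (royNum_pos _).ne'] at hlog
    have := mul_le_mul_of_nonneg_left hlog (show 0 ≤ φ + 1 by linarith [Real.goldenRatio_pos])
    linarith

lemma natCast_ht (x : Fin 3 → ℤ) : (ht x : ℤ) = max |x 0| (max |x 1| |x 2|) := by
  rw [ht, Nat.cast_max, Nat.cast_max, Int.natCast_natAbs, Int.natCast_natAbs, Int.natCast_natAbs]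

lemma mul_rpow_eq_exp {k N : ℝ} (hN : 0 < N) :
    Real.exp k * N ^ (-((1 + Real.sqrt 5) / 2) - 1) =
      Real.exp (-(φ + 1) * Real.log N + k) := by
  rw [Real.rpow_def_of_pos hN, ← Real.exp_add]
  congr 1
  change k + Real.log N * (-φ - 1) = _
  ring

lemma royExtremalProperty_iff {ξ : ℝ} : RoyExtremalProperty ξ ↔
    ∃ (k : ℝ) (N₁ : ℕ), ∀ N : ℕ, N₁ ≤ N → ∃ x, val ξ x ≠ 0 ∧ ht x ≤ N ∧
      Real.log |val ξ x| ≤ -(φ + 1) * Real.log N + k := by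
  constructor
  · rintro ⟨c, hc, N₁, h⟩
    refine ⟨Real.log c, max N₁ 1, fun N hN => ?_⟩
    obtain ⟨x₀, x₁, x₂, h1, h2, h3⟩ := h N ((le_max_left _ _).trans hN)
    have hN0 : (0 : ℝ) < N := by exact_mod_cast (le_max_right N₁ 1).trans hN
    refine ⟨![x₀, x₁, x₂], abs_pos.1 h1, ?_, ?_⟩
    · have := natCast_ht ![x₀, x₁, x₂]
      exact_mod_cast this.trans_le h3
    · rw [← Real.exp_log hc, mul_rpow_eq_exp hN0] at h2
      exact (Real.log_le_iff_le_exp h1).2 h2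
  · rintro ⟨k, N₁, h⟩
    refine ⟨Real.exp k, Real.exp_pos k, max N₁ 1, fun N hN => ?_⟩
    obtain ⟨x, h1, h2, h3⟩ := h N ((le_max_left _ _).trans hN)
    have hN0 : (0 : ℝ) < N := by exact_mod_cast (le_max_right N₁ 1).trans hN
    refine ⟨x 0, x 1, x 2, abs_pos.2 h1, ?_, ?_⟩
    · rw [mul_rpow_eq_exp hN0]
      exact (Real.log_le_iff_le_exp (abs_pos.2 h1)).1 h3
    · rw [← natCast_ht]
      exact_mod_cast h2

lemma notQuadraticOrRational_iff {ξ : ℝ} : NotQuadraticOrRational ξ ↔ Indep ξ := by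
  constructor
  · intro h x hx
    by_contra hne
    refine h ⟨Polynomial.C (x 2 : ℚ) * Polynomial.X ^ 2 + Polynomial.C (x 1 : ℚ) * Polynomial.X +
      Polynomial.C (x 0 : ℚ), fun h0 => hne ?_, Polynomial.natDegree_quadratic_le, ?_⟩
    · have c : ∀ n, ((Polynomial.C (x 2 : ℚ) * Polynomial.X ^ 2 + Polynomial.C (x 1 : ℚ) *
          Polynomial.X + Polynomial.C (x 0 : ℚ) : Polynomial ℚ)).coeff n = 0 := fun n => by
        rw [h0, Polynomial.coeff_zero]
      have c0 := c 0
      have c1 := c 1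
      have c2 := c 2
      simp only [Polynomial.coeff_add, Polynomial.coeff_C_mul, Polynomial.coeff_X_pow,
        Polynomial.coeff_X, Polynomial.coeff_C] at c0 c1 c2
      norm_num at c0 c1 c2
      exact ext3 c0 c1 c2
    · rw [← hx, val]
      simp
      ring
  · rintro h ⟨Q, hQ0, hdeg, hQ⟩
    have hQe := Polynomial.eq_quadratic_of_degree_le_two (Polynomial.natDegree_le_iff_degree_le.1 hdeg)
    set q := Q.coeff
    have hq : ((q 0 : ℚ) : ℝ) + q 1 * ξ + q 2 * ξ ^ 2 = 0 := by
      rw [← hQ, hQe]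
      simp
      ring
    have hd : ∀ j, ((q j).den : ℝ) ≠ 0 := fun j => by exact_mod_cast (q j).den_ne_zero
    have hx := h ![(q 0).num * ((q 1).den * (q 2).den), (q 1).num * ((q 0).den * (q 2).den),
      (q 2).num * ((q 0).den * (q 1).den)] (by
        have e : ∀ j, ((q j : ℚ) : ℝ) * (q j).den = (q j).num := fun j => by
          exact_mod_cast Rat.mul_den_eq_num (q j)
        simp only [val, Matrix.cons_val]
        push_cast
        rw [← e, ← e, ← e]
        linear_combination ((q 0).den * (q 1).den * (q 2).den : ℝ) * hq)
    have h0 := congrFun hx 0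
    have h1 := congrFun hx 1
    have h2 := congrFun hx 2
    simp at h0 h1 h2
    refine hQ0 ?_
    rw [hQe]
    simp [q, h0, h1, h2]

lemma exists_good_of_royExtremalProperty {ξ : ℝ} (hξ : Indep ξ) (h : RoyExtremalProperty ξ) :
    ∃ k C P, Good ξ k C P := by
  obtain ⟨k, N₁, h⟩ := royExtremalProperty_iff.1 h
  have hlog : 0 ≤ (φ + 1) * Real.log 2 :=
    mul_nonneg (by linarith [Real.goldenRatio_pos]) (Real.log_nonneg (by norm_num))
  obtain ⟨P, hP⟩ := exists_minSeq (k := max k 0) hξ (N₁ := N₁) fun N hN => by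
    obtain ⟨x, h1, h2, h3⟩ := h N hN
    refine ⟨x, ?_, h2, h3.trans (by gcongr; exact le_max_left _ _)⟩
    rintro rfl
    simp [val] at h1
  obtain ⟨C, Q, hQ⟩ := hP.exists_good hξ (add_nonneg (le_max_right _ _) hlog)
  exact ⟨_, C, Q, hQ⟩

end RoyExt

/-- Roy's theorem on extremal numbers. -/
theorem roy_extremal :
    (∃ ξ : ℝ, NotQuadraticOrRational ξ ∧ RoyExtremalProperty ξ) ∧
    (∀ ξ : ℝ, NotQuadraticOrRational ξ → RoyExtremalProperty ξ → Transcendental ℚ ξ) ∧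
    {ξ : ℝ | NotQuadraticOrRational ξ ∧ RoyExtremalProperty ξ}.Countable := by
  refine ⟨?_, fun ξ hξ h => ?_, RoyExt.countable_setOf_extSeq.mono ?_⟩
  · obtain ⟨ξ, hξ⟩ := RoyExt.exists_near_royPoint
    exact ⟨ξ, RoyExt.notQuadraticOrRational_iff.2 (RoyExt.indep_of_near_royPoint hξ),
      RoyExt.royExtremalProperty_iff.2 (RoyExt.exists_small_val hξ)⟩
  · rw [RoyExt.notQuadraticOrRational_iff] at hξ
    obtain ⟨k, C, P, hP⟩ := RoyExt.exists_good_of_royExtremalProperty hξ h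
    exact hP.transcendental hξ
  · rintro ξ ⟨hξ, h⟩
    rw [RoyExt.notQuadraticOrRational_iff] at hξ
    obtain ⟨k, C, P, hP⟩ := RoyExt.exists_good_of_royExtremalProperty hξ h
    exact hP.exists_extSeq hξ
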